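/- arXiv:1302.0731 — 2 statements merged into one kernel-verified Lean document; each statement's English description precedes it below -/
import Mathlib

section
/- Let Ω ⊂ ℝ² be a bounded Lipschitz domain and ψ ∈ W^{2,1}(Ω). For every ε > 0 there exists δ > 0 such that for any set U ⊂ closure(Ω) with Hausdorff content H¹_∞(U) < δ, the image satisfies H¹(ψ(U)) < ε. -/
open MeasureTheory Set Metric Bornology ENNReal NNReal

noncomputable section

abbrev E2 := ℝ × ℝ

/-- `g` is the weak gradient of `f` on the set `Ω`. -/
def HasWeakGradOn (Ω : Set E2) (f : E2 → ℝ) (g : E2 → E2) : Prop :=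
  ∀ φ : E2 → ℝ, ContDiff ℝ (⊤ : ℕ∞) φ → HasCompactSupport φ → tsupport φ ⊆ Ω →
    (∫ x in Ω, f x * fderiv ℝ φ x (1, 0) = - ∫ x in Ω, (g x).1 * φ x) ∧
    (∫ x in Ω, f x * fderiv ℝ φ x (0, 1) = - ∫ x in Ω, (g x).2 * φ x)

/-- `ψ ∈ W^{2,1}(Ω)` with weak gradient `g`. -/
def MemW21 (Ω : Set E2) (ψ : E2 → ℝ) (g : E2 → E2) : Prop :=
  IntegrableOn ψ Ω ∧ IntegrableOn g Ω ∧ HasWeakGradOn Ω ψ g ∧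
  ∃ G₁ G₂ : E2 → E2, IntegrableOn G₁ Ω ∧ IntegrableOn G₂ Ω ∧
    HasWeakGradOn Ω (fun x => (g x).1) G₁ ∧ HasWeakGradOn Ω (fun x => (g x).2) G₂

/-- `Ω` has Lipschitz boundary. -/
def HasLipschitzBoundary (Ω : Set E2) : Prop :=
  ∀ x ∈ frontier Ω, ∃ U ∈ nhds x, ∃ (L : NNReal) (f : ℝ → ℝ) (A : E2 ≃L[ℝ] E2),
    LipschitzWith L f ∧
    Ω ∩ U = {y ∈ U | (A y).2 < f ((A y).1)} ∧
    frontier Ω ∩ U = {y ∈ U | (A y).2 = f ((A y).1)}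

/-- One-dimensional Hausdorff content `H¹_∞`. -/
def hausdorffContent1 (s : Set E2) : ℝ≥0∞ :=
  ⨅ (t : ℕ → Set E2) (_ : s ⊆ ⋃ n, t n), ∑' n, EMetric.diam (t n)

open scoped Topology

/-- `k` bounds the pointwise local Lipschitz constant of `F`. -/
def HasSlopeBound {X : Type*} [PseudoMetricSpace X] (F k : X → ℝ) : Prop :=
  ∀ z c, k z < c → ∀ᶠ z' in 𝓝 z, |F z' - F z| ≤ c * dist z' z

lemma HasSlopeBound.continuous {X : Type*} [PseudoMetricSpace X] {F k : X → ℝ}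
    (h : HasSlopeBound F k) : Continuous F := by
  refine continuous_iff_continuousAt.2 fun z => ?_
  have hz := h z (k z + 1) (lt_add_one _)
  refine tendsto_iff_dist_tendsto_zero.2 ?_
  have h0 : Filter.Tendsto (fun z' => (k z + 1) * dist z' z) (𝓝 z) (𝓝 0) := by
    have : Continuous (fun z' => (k z + 1) * dist z' z) := by fun_prop
    simpa using this.tendsto z
  exact squeeze_zero' (Filter.Eventually.of_forall fun _ => dist_nonneg) hz h0

lemma HasSlopeBound.neg {X : Type*} [PseudoMetricSpace X] {F k : X → ℝ}
    (h : HasSlopeBound F k) : HasSlopeBound (fun z => -F z) k := by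
  intro z c hc
  filter_upwards [h z c hc] with z' hz'
  rwa [neg_sub_neg, abs_sub_comm]

/-- Restriction of a slope bound along an isometric embedding. -/
lemma HasSlopeBound.comp_isometry {X Y : Type*} [PseudoMetricSpace X] [PseudoMetricSpace Y]
    {F k : X → ℝ} (h : HasSlopeBound F k) {γ : Y → X} (hγ : Isometry γ) :
    HasSlopeBound (F ∘ γ) (k ∘ γ) := by
  intro z c hc
  filter_upwards [hγ.continuous.continuousAt.eventually (h (γ z) c hc)] with z' hz'
  simpa [hγ.dist_eq] using hz'

lemma HasSlopeBound.comp {X : Type*} [PseudoMetricSpace X] {F k : X → ℝ} (h : HasSlopeBound F k)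
    {T χ : ℝ → ℝ} (hT : ∀ x, HasDerivAt T (χ x) x) (hχ : ∀ x, 0 ≤ χ x) :
    HasSlopeBound (fun z => T (F z)) (fun z => χ (F z) * k z) := by
  intro z c hc
  obtain ⟨η, hη, hηc⟩ : ∃ η > 0, (χ (F z) + η) * (k z + η) ≤ c := by
    have hcont : Continuous fun η : ℝ => (χ (F z) + η) * (k z + η) := by fun_prop
    have := (hcont.tendsto 0).eventually (gt_mem_nhds (by simpa using hc))
    have h2 : ∀ᶠ η in 𝓝[>] (0 : ℝ), (χ (F z) + η) * (k z + η) < c :=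
      this.filter_mono nhdsWithin_le_nhds
    obtain ⟨η, h3, h4⟩ := (h2.and self_mem_nhdsWithin).exists
    exact ⟨η, h4, h3.le⟩
  have h1 := h z (k z + η) (by linarith)
  have h2 : ∀ᶠ y in 𝓝 (F z), |T y - T (F z)| ≤ (χ (F z) + η) * |y - F z| := by
    have := (hT (F z)).isLittleO.def hη
    filter_upwards [this] with y hy
    simp only [smul_eq_mul, Real.norm_eq_abs] at hy
    have h5 : |T y - T (F z)| ≤ |T y - T (F z) - (y - F z) * χ (F z)| + |(y - F z) * χ (F z)| := by
      have := abs_add_le (T y - T (F z) - (y - F z) * χ (F z)) ((y - F z) * χ (F z))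
      simpa using this
    rw [abs_mul, abs_of_nonneg (hχ (F z))] at h5
    linarith
  filter_upwards [h1, h.continuous.continuousAt.eventually h2] with z' h3 h4
  calc |T (F z') - T (F z)| ≤ (χ (F z) + η) * |F z' - F z| := h4
    _ ≤ (χ (F z) + η) * ((k z + η) * dist z' z) := by
        gcongr
        linarith [hχ (F z)]
    _ = ((χ (F z) + η) * (k z + η)) * dist z' z := by ring
    _ ≤ c * dist z' z := by gcongr

lemma HasSlopeBound.sub_le_integral {f k : ℝ → ℝ} (h : HasSlopeBound f k) (hk : Continuous k)
    {a b : ℝ} (hab : a ≤ b) : f b - f a ≤ ∫ x in a..b, k x := by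
  have hB : ∀ x, HasDerivAt (fun x => f a + ∫ t in a..x, k t) (k x) x := fun x =>
    (intervalIntegral.integral_hasDerivAt_right (hk.intervalIntegrable _ _)
      hk.aestronglyMeasurable.stronglyMeasurableAtFilter hk.continuousAt).const_add _
  have := image_le_of_liminf_slope_right_le_deriv_boundary (f := f) (a := a) (b := b)
    (B := fun x => f a + ∫ t in a..x, k t) (B' := k) h.continuous.continuousOn (by simp)
    (fun x _ => (hB x).continuousAt.continuousWithinAt)
    (fun x _ => (hB x).hasDerivWithinAt) ?_ ⟨hab, le_rfl⟩
  · linarith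
  intro x _ r hr
  obtain ⟨c, hc, hcr⟩ := exists_between hr
  have h1 := (h x c hc).filter_mono (nhdsWithin_le_nhds (s := Ioi x))
  refine Filter.Eventually.frequently ?_
  filter_upwards [h1, self_mem_nhdsWithin] with y hy hxy
  have hxy' : 0 < y - x := sub_pos.2 hxy
  rw [slope_def_field, div_lt_iff₀ hxy']
  rw [Real.dist_eq, abs_of_pos hxy'] at hy
  calc f y - f x ≤ |f y - f x| := le_abs_self _
    _ ≤ c * (y - x) := hy
    _ < r * (y - x) := by gcongr

lemma HasSlopeBound.ofReal_abs_sub_le {f k : ℝ → ℝ} (h : HasSlopeBound f k) (hk : Continuous k)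
    (hk0 : ∀ x, 0 ≤ k x) {x l a b : ℝ} (ha : a ∈ Ico x (x + l)) (hb : b ∈ Ico x (x + l)) :
    ENNReal.ofReal |f b - f a| ≤ ∫⁻ s in Ico x (x + l), ENNReal.ofReal (k s) := by
  wlog hab : a ≤ b generalizing a b
  · rw [abs_sub_comm]
    exact this hb ha (le_of_not_ge hab)
  have h1 : |f b - f a| ≤ ∫ x in a..b, k x := by
    refine abs_le.2 ⟨?_, h.sub_le_integral hk hab⟩
    have := h.neg.sub_le_integral hk hab
    linarith
  calc ENNReal.ofReal |f b - f a| ≤ ENNReal.ofReal (∫ x in a..b, k x) :=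
        ENNReal.ofReal_le_ofReal h1
    _ = ∫⁻ s in Ioc a b, ENNReal.ofReal (k s) := by
        rw [intervalIntegral.integral_of_le hab, ofReal_integral_eq_lintegral_ofReal]
        · exact hk.integrableOn_Ioc
        · exact Filter.Eventually.of_forall hk0
    _ ≤ _ := lintegral_mono_set
        (show Ioc a b ⊆ Ico x (x + l) from fun y hy => ⟨ha.1.trans hy.1.le, hy.2.trans_lt hb.2⟩)

/-- The half-open square with lower left corner `(x, y)` and side `l`. -/
def box (x y l : ℝ) : Set E2 := Ico x (x + l) ×ˢ Ico y (y + l)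

lemma measurableSet_box (x y l : ℝ) : MeasurableSet (box x y l) :=
  measurableSet_Ico.prod measurableSet_Ico

lemma volume_box (x y : ℝ) {l : ℝ} : volume (box x y l) = ENNReal.ofReal l * ENNReal.ofReal l := by
  simp [box, Measure.volume_eq_prod, Measure.prod_prod]

lemma lintegral_box {f : E2 → ℝ≥0∞} (hf : Measurable f) (x y l : ℝ) :
    ∫⁻ z in box x y l, f z = ∫⁻ s in Ico x (x + l), ∫⁻ t in Ico y (y + l), f (s, t) := by
  rw [box, Measure.volume_eq_prod, ← Measure.prod_restrict, lintegral_prod _ hf.aemeasurable]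

lemma lintegral_box_symm {f : E2 → ℝ≥0∞} (hf : Measurable f) (x y l : ℝ) :
    ∫⁻ z in box x y l, f z = ∫⁻ t in Ico y (y + l), ∫⁻ s in Ico x (x + l), f (s, t) := by
  rw [box, Measure.volume_eq_prod, ← Measure.prod_restrict, lintegral_prod_symm _ hf.aemeasurable]

lemma Ico_halves {x l : ℝ} (hl : 0 ≤ l) :
    Ico x (x + l) = Ico x (x + l / 2) ∪ Ico (x + l / 2) (x + l / 2 + l / 2) := by
  rw [Ico_union_Ico_eq_Ico (by linarith) (by linarith)]
  congr 1; ring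

lemma disjoint_Ico_halves (x l : ℝ) :
    Disjoint (Ico x (x + l / 2)) (Ico (x + l / 2) (x + l / 2 + l / 2)) :=
  Ico_disjoint_Ico_same

lemma box_eq_union {x y l : ℝ} (hl : 0 ≤ l) :
    box x y l = (box x y (l / 2) ∪ box (x + l / 2) y (l / 2)) ∪
      (box x (y + l / 2) (l / 2) ∪ box (x + l / 2) (y + l / 2) (l / 2)) := by
  simp only [box]
  rw [← union_prod, ← union_prod, ← Ico_halves hl, ← prod_union, ← Ico_halves hl]

lemma lintegral_box_split (ν : Measure E2) {x y l : ℝ} (hl : 0 ≤ l) (f : E2 → ℝ≥0∞) :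
    ∫⁻ z in box x y l, f z ∂ν =
      (∫⁻ z in box x y (l / 2), f z ∂ν) + (∫⁻ z in box (x + l / 2) y (l / 2), f z ∂ν) +
      ((∫⁻ z in box x (y + l / 2) (l / 2), f z ∂ν) +
        ∫⁻ z in box (x + l / 2) (y + l / 2) (l / 2), f z ∂ν) := by
  rw [box_eq_union hl, lintegral_union, lintegral_union, lintegral_union]
  any_goals exact measurableSet_box _ _ _
  · exact disjoint_prod.2 (Or.inl (disjoint_Ico_halves _ _))
  · exact disjoint_prod.2 (Or.inl (disjoint_Ico_halves _ _))
  · exact (measurableSet_box _ _ _).union (measurableSet_box _ _ _)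
  · simp only [disjoint_union_left, disjoint_union_right, box]
    refine ⟨⟨?_, ?_⟩, ?_, ?_⟩ <;> exact disjoint_prod.2 (Or.inr (disjoint_Ico_halves _ _))

lemma measure_box_split (ν : Measure E2) {x y l : ℝ} (hl : 0 ≤ l) :
    ν (box x y l) = ν (box x y (l / 2)) + ν (box (x + l / 2) y (l / 2)) +
      (ν (box x (y + l / 2) (l / 2)) + ν (box (x + l / 2) (y + l / 2) (l / 2))) := by
  simpa using lintegral_box_split ν hl (fun _ => 1)

lemma measurable_lintegral_row {f : E2 → ℝ≥0∞} (hf : Measurable f) (I : Set ℝ) :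
    Measurable fun z : E2 => ∫⁻ s in I, f (s, z.2) :=
  (hf.lintegral_prod_left' (μ := volume.restrict I)).comp measurable_snd

lemma measurable_lintegral_col {f : E2 → ℝ≥0∞} (hf : Measurable f) (J : Set ℝ) :
    Measurable fun z : E2 => ∫⁻ t in J, f (z.1, t) :=
  (hf.lintegral_prod_right' (ν := volume.restrict J)).comp measurable_fst

lemma lintegral_box_snd {φ : ℝ → ℝ≥0∞} (hφ : Measurable fun z : E2 => φ z.2) (x y l : ℝ) :
    ∫⁻ z in box x y l, φ z.2 = ENNReal.ofReal l * ∫⁻ t in Ico y (y + l), φ t := by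
  rw [lintegral_box hφ]
  simp only []
  rw [lintegral_const, Measure.restrict_apply_univ, Real.volume_Ico,
    add_sub_cancel_left, mul_comm]

lemma lintegral_box_fst {φ : ℝ → ℝ≥0∞} (hφ : Measurable fun z : E2 => φ z.1) (x y l : ℝ) :
    ∫⁻ z in box x y l, φ z.1 = ENNReal.ofReal l * ∫⁻ s in Ico x (x + l), φ s := by
  rw [lintegral_box_symm hφ]
  simp only []
  rw [lintegral_const, Measure.restrict_apply_univ, Real.volume_Ico,
    add_sub_cancel_left, mul_comm]

lemma lintegral_box_row {f : E2 → ℝ≥0∞} (hf : Measurable f) (x y l : ℝ) :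
    ∫⁻ z in box x y l, (∫⁻ s in Ico x (x + l), f (s, z.2)) =
      ENNReal.ofReal l * ∫⁻ z in box x y l, f z := by
  rw [lintegral_box_snd (φ := fun t => ∫⁻ s in Ico x (x + l), f (s, t))
    (measurable_lintegral_row hf _), lintegral_box_symm hf]

lemma lintegral_box_col {f : E2 → ℝ≥0∞} (hf : Measurable f) (x y l : ℝ) :
    ∫⁻ z in box x y l, (∫⁻ t in Ico y (y + l), f (z.1, t)) =
      ENNReal.ofReal l * ∫⁻ z in box x y l, f z := by
  rw [lintegral_box_fst (φ := fun s => ∫⁻ t in Ico y (y + l), f (s, t))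
    (measurable_lintegral_col hf _), lintegral_box hf]

lemma HasSlopeBound.box_path {F k : E2 → ℝ} (h : HasSlopeBound F k) (hk : Continuous k)
    (hk0 : ∀ z, 0 ≤ k z) {x y l : ℝ} {z w : E2} (hz : z ∈ box x y l) (hw : w ∈ box x y l) :
    ENNReal.ofReal |F z - F w| ≤
      (∫⁻ s in Ico x (x + l), ENNReal.ofReal (k (s, z.2))) +
        ∫⁻ t in Ico y (y + l), ENNReal.ofReal (k (w.1, t)) := by
  have i1 : Isometry fun s : ℝ => ((s, z.2) : E2) :=
    Isometry.of_dist_eq fun a b => by simp [Prod.dist_eq]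
  have i2 : Isometry fun t : ℝ => ((w.1, t) : E2) :=
    Isometry.of_dist_eq fun a b => by simp [Prod.dist_eq]
  have h1 := (h.comp_isometry i1).ofReal_abs_sub_le (hk.comp i1.continuous)
    (fun _ => hk0 _) hw.1 hz.1
  have h2 := (h.comp_isometry i2).ofReal_abs_sub_le (hk.comp i2.continuous)
    (fun _ => hk0 _) hw.2 hz.2
  simp only [Function.comp_def] at h1 h2
  refine le_trans ?_ (add_le_add h1 h2)
  rw [← ENNReal.ofReal_add (abs_nonneg _) (abs_nonneg _)]
  exact ENNReal.ofReal_le_ofReal (abs_sub_le _ _ _)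

/-- Poincaré inequality on a square for a function that vanishes on half of it. -/
lemma HasSlopeBound.poincare {F k : E2 → ℝ} (h : HasSlopeBound F k) (hk : Continuous k)
    (hk0 : ∀ z, 0 ≤ k z) {x y l : ℝ} (hl : 0 < l) {Z : Set E2}
    (hZb : Z ⊆ box x y l) (hF0 : ∀ z ∈ Z, F z = 0)
    (hZv : ENNReal.ofReal l * ENNReal.ofReal l ≤ 2 * volume Z) :
    ∫⁻ z in box x y l, ENNReal.ofReal (F z) ≤
      4 * ENNReal.ofReal l * ∫⁻ z in box x y l, ENNReal.ofReal (k z) := by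
  set L := ENNReal.ofReal l
  set A := ∫⁻ z in box x y l, ENNReal.ofReal (F z)
  set B := ∫⁻ z in box x y l, ENNReal.ofReal (k z)
  have hL0 : L ≠ 0 := by simpa [L] using hl
  have hLt : L ≠ ⊤ := ENNReal.ofReal_ne_top
  have hkm : Measurable fun z => ENNReal.ofReal (k z) := hk.measurable.ennreal_ofReal
  have hrow := measurable_lintegral_row hkm (Ico x (x + l))
  have hcol := measurable_lintegral_col hkm (Ico y (y + l))
  have hrowB := lintegral_box_row hkm x y l
  have hcolB := lintegral_box_col hkm x y l
  have h1 : ∀ w ∈ Z, A ≤ L * B + L * L * ∫⁻ t in Ico y (y + l), ENNReal.ofReal (k (w.1, t)) := by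
    intro w hw
    calc A ≤ ∫⁻ z in box x y l, ((∫⁻ s in Ico x (x + l), ENNReal.ofReal (k (s, z.2))) +
          ∫⁻ t in Ico y (y + l), ENNReal.ofReal (k (w.1, t))) := by
          refine setLIntegral_mono (hrow.add measurable_const) fun z hz => ?_
          have := h.box_path hk hk0 hz (hZb hw)
          rw [hF0 w hw, sub_zero] at this
          exact (ENNReal.ofReal_le_ofReal (le_abs_self _)).trans this
      _ = _ := by
          rw [lintegral_add_right _ measurable_const, hrowB, lintegral_const,
            Measure.restrict_apply_univ, volume_box, mul_comm (∫⁻ _ in _, _)]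
  have h2 : volume Z * A ≤ volume Z * (L * B) + L * L * (L * B) := by
    calc volume Z * A = ∫⁻ _ in Z, A := by
          rw [lintegral_const, Measure.restrict_apply_univ, mul_comm]
      _ ≤ ∫⁻ w in Z, (L * B + L * L * ∫⁻ t in Ico y (y + l), ENNReal.ofReal (k (w.1, t))) :=
          setLIntegral_mono (measurable_const.add (hcol.const_mul _)) h1
      _ = volume Z * (L * B) +
          L * L * ∫⁻ w in Z, ∫⁻ t in Ico y (y + l), ENNReal.ofReal (k (w.1, t)) := by
          rw [lintegral_add_left measurable_const, lintegral_const, Measure.restrict_apply_univ,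
            lintegral_const_mul _ hcol, mul_comm (L * B)]
      _ ≤ _ := by
          gcongr
          exact (lintegral_mono_set hZb).trans hcolB.le
  have hZle : volume Z ≤ L * L := (measure_mono hZb).trans (volume_box x y).le
  have h3 : (L * L) * A ≤ (L * L) * (4 * L * B) := by
    calc (L * L) * A ≤ 2 * volume Z * A := by gcongr
      _ = 2 * (volume Z * A) := by ring
      _ ≤ 2 * (volume Z * (L * B) + L * L * (L * B)) := by gcongr
      _ ≤ 2 * (L * L * (L * B) + L * L * (L * B)) := by gcongr
      _ = (L * L) * (4 * L * B) := by ring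
  exact (ENNReal.mul_le_mul_iff_right (mul_ne_zero hL0 hL0) (ENNReal.mul_ne_top hLt hLt)).1 h3

/-- The oscillation on a square of a function with slope bound `h`, where `h` itself has slope
bound `k`. -/
lemma HasSlopeBound.mul_ofReal_abs_sub_le {u h k : E2 → ℝ} (hu : HasSlopeBound u h)
    (hh : HasSlopeBound h k) (hk : Continuous k) (hh0 : ∀ z, 0 ≤ h z) (hk0 : ∀ z, 0 ≤ k z)
    {x y l : ℝ} {z w : E2} (hz : z ∈ box x y l) (hw : w ∈ box x y l) :
    ENNReal.ofReal l * ENNReal.ofReal |u z - u w| ≤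
      2 * ((∫⁻ z in box x y l, ENNReal.ofReal (h z)) +
        ENNReal.ofReal l * ∫⁻ z in box x y l, ENNReal.ofReal (k z)) := by
  set L := ENNReal.ofReal l
  have hhm : Measurable fun z => ENNReal.ofReal (h z) := hh.continuous.measurable.ennreal_ofReal
  have hkm : Measurable fun z => ENNReal.ofReal (k z) := hk.measurable.ennreal_ofReal
  have hrow := measurable_lintegral_row hkm (Ico x (x + l))
  have hcol := measurable_lintegral_col hkm (Ico y (y + l))
  have hle : ∀ p q : E2, ENNReal.ofReal (h p) ≤ ENNReal.ofReal (h q) +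
      ENNReal.ofReal |h p - h q| := fun p q => by
    rw [← ENNReal.ofReal_add (hh0 _) (abs_nonneg _)]
    exact ENNReal.ofReal_le_ofReal (by linarith [le_abs_self (h p - h q)])
  have h1 : L * ∫⁻ s in Ico x (x + l), ENNReal.ofReal (h (s, z.2)) ≤
      (∫⁻ z in box x y l, ENNReal.ofReal (h z)) + L * ∫⁻ z in box x y l, ENNReal.ofReal (k z) := by
    rw [← lintegral_box_fst (φ := fun s => ENNReal.ofReal (h (s, z.2)))
      (hhm.comp (by fun_prop)) x y l,
      ← lintegral_box_col hkm, ← lintegral_add_left hhm]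
    refine setLIntegral_mono (hhm.add hcol) fun p hp => ?_
    refine (hle _ p).trans (add_le_add le_rfl ?_)
    have i2 : Isometry fun t : ℝ => ((p.1, t) : E2) :=
      Isometry.of_dist_eq fun a b => by simp [Prod.dist_eq]
    exact (hh.comp_isometry i2).ofReal_abs_sub_le (hk.comp i2.continuous) (fun _ => hk0 _)
      hp.2 hz.2
  have h2 : L * ∫⁻ t in Ico y (y + l), ENNReal.ofReal (h (w.1, t)) ≤
      (∫⁻ z in box x y l, ENNReal.ofReal (h z)) + L * ∫⁻ z in box x y l, ENNReal.ofReal (k z) := by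
    rw [← lintegral_box_snd (φ := fun t => ENNReal.ofReal (h (w.1, t)))
      (hhm.comp (by fun_prop)) x y l,
      ← lintegral_box_row hkm, ← lintegral_add_left hhm]
    refine setLIntegral_mono (hhm.add hrow) fun p hp => ?_
    refine (hle _ p).trans (add_le_add le_rfl ?_)
    have i1 : Isometry fun s : ℝ => ((s, p.2) : E2) :=
      Isometry.of_dist_eq fun a b => by simp [Prod.dist_eq]
    exact (hh.comp_isometry i1).ofReal_abs_sub_le (hk.comp i1.continuous) (fun _ => hk0 _)
      hp.1 hw.1
  calc L * ENNReal.ofReal |u z - u w| ≤ L * _ := by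
        gcongr; exact hu.box_path hh.continuous hh0 hz hw
    _ = _ := mul_add _ _ _
    _ ≤ _ := add_le_add h1 h2
    _ = _ := (two_mul _).symm

/-- A continuous bump supported in `[0, 1]` with integral `1`. -/
def layerBump (r : ℝ) : ℝ := max 0 (6 * r * (1 - r))

/-- The primitive of `layerBump`, a smoothed Heaviside function. -/
def layerStep (r : ℝ) : ℝ := ∫ s in (0 : ℝ)..r, layerBump s

lemma continuous_layerBump : Continuous layerBump := by unfold layerBump; fun_prop

lemma layerBump_nonneg (r : ℝ) : 0 ≤ layerBump r := le_max_left _ _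

lemma layerBump_le (r : ℝ) : layerBump r ≤ (Ioo (0 : ℝ) 1).indicator (fun _ => 2) r := by
  unfold layerBump
  by_cases hr : r ∈ Ioo (0 : ℝ) 1
  · rw [indicator_of_mem hr]
    exact max_le (by norm_num) (by nlinarith [sq_nonneg (2 * r - 1)])
  · rw [indicator_of_notMem hr]
    refine max_le le_rfl ?_
    by_contra! h
    exact hr ⟨by nlinarith [sq_nonneg r], by nlinarith [sq_nonneg (1 - r)]⟩

lemma layerBump_eq_zero {r : ℝ} (hr : r ∉ Ioo (0 : ℝ) 1) : layerBump r = 0 := by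
  have := layerBump_le r
  rw [indicator_of_notMem hr] at this
  exact this.antisymm (layerBump_nonneg r)

lemma hasDerivAt_layerStep (r : ℝ) : HasDerivAt layerStep (layerBump r) r :=
  intervalIntegral.integral_hasDerivAt_right (continuous_layerBump.intervalIntegrable _ _)
    continuous_layerBump.aestronglyMeasurable.stronglyMeasurableAtFilter
    continuous_layerBump.continuousAt

lemma layerStep_of_nonpos {r : ℝ} (hr : r ≤ 0) : layerStep r = 0 := by
  unfold layerStep
  rw [intervalIntegral.integral_congr (g := fun _ => 0)]
  · simp
  intro s hs
  rw [uIcc_of_ge hr] at hs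
  exact layerBump_eq_zero fun h => absurd hs.2 (not_le.2 h.1)

lemma layerStep_of_one_le {r : ℝ} (hr : 1 ≤ r) : layerStep r = 1 := by
  unfold layerStep
  rw [← intervalIntegral.integral_add_adjacent_intervals
    (continuous_layerBump.intervalIntegrable 0 1) (continuous_layerBump.intervalIntegrable 1 r)]
  have h1 : ∫ s in (1 : ℝ)..r, layerBump s = 0 := by
    rw [intervalIntegral.integral_congr (g := fun _ => 0)]
    · simp
    intro s hs
    rw [uIcc_of_le hr] at hs
    exact layerBump_eq_zero fun h => absurd hs.1 (not_le.2 h.2)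
  have h2 : ∫ s in (0 : ℝ)..1, layerBump s = ∫ s in (0 : ℝ)..1, (6 * s - 6 * s ^ 2) := by
    refine intervalIntegral.integral_congr fun s hs => ?_
    rw [uIcc_of_le zero_le_one] at hs
    simp only [layerBump]
    rw [max_eq_right (by nlinarith [hs.1, hs.2])]
    ring
  have h3 : ∫ s in (0 : ℝ)..1, (6 * s - 6 * s ^ 2) = 1 := by
    rw [intervalIntegral.integral_sub (Continuous.intervalIntegrable (by fun_prop) _ _)
      (Continuous.intervalIntegrable (by fun_prop) _ _),
      intervalIntegral.integral_const_mul 6 (fun s : ℝ => s), integral_id,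
      intervalIntegral.integral_const_mul, integral_pow]
    norm_num
  rw [h1, h2, h3, add_zero]

/-- The energy of `k` in the square, concentrated on the level set `{h = t}`. -/
def layerEnergy (h k : E2 → ℝ) (t x y l : ℝ) : ℝ≥0∞ :=
  Filter.liminf (fun n : ℕ => ∫⁻ z in box x y l,
    ENNReal.ofReal ((n + 1) * layerBump ((n + 1) * (h z - t)) * k z)) Filter.atTop

lemma layerEnergy_split (h k : E2 → ℝ) (t x y : ℝ) {l : ℝ} (hl : 0 ≤ l) :
    layerEnergy h k t x y (l / 2) + layerEnergy h k t (x + l / 2) y (l / 2) +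
      (layerEnergy h k t x (y + l / 2) (l / 2) +
        layerEnergy h k t (x + l / 2) (y + l / 2) (l / 2)) ≤ layerEnergy h k t x y l := by
  have hadd : ∀ a b : ℕ → ℝ≥0∞, Filter.liminf a Filter.atTop + Filter.liminf b Filter.atTop ≤
      Filter.liminf (fun n => a n + b n) Filter.atTop := fun a b => by
    simp only [Filter.liminf_eq_iSup_iInf_of_nat]
    rw [ENNReal.iSup_add_iSup_of_monotone]
    · exact iSup_mono fun n => le_iInf₂ fun i hi => add_le_add (iInf₂_le i hi) (iInf₂_le i hi)
    · exact fun m n hmn => biInf_mono fun i hi => hmn.trans hi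
    · exact fun m n hmn => biInf_mono fun i hi => hmn.trans hi
  simp only [layerEnergy]
  simp_rw [lintegral_box_split volume hl]
  exact (add_le_add (hadd _ _) (hadd _ _)).trans (hadd _ _)

/-- Relative isoperimetric inequality on a square for the superlevel sets of `h`. -/
lemma HasSlopeBound.volume_superlevel_le {h k : E2 → ℝ} (hh : HasSlopeBound h k)
    (hk : Continuous k) (hk0 : ∀ z, 0 ≤ k z) {t x y l : ℝ} (hl : 0 < l)
    (hv : ENNReal.ofReal l * ENNReal.ofReal l ≤ 2 * volume ({z | h z ≤ t} ∩ box x y l)) :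
    volume ({z | t < h z} ∩ box x y l) ≤ 4 * ENNReal.ofReal l * layerEnergy h k t x y l := by
  have hT : ∀ (n : ℕ) (r : ℝ), HasDerivAt (fun r => layerStep ((n + 1) * (r - t)))
      ((n + 1) * layerBump ((n + 1) * (r - t))) r := fun n r => by
    have h1 : HasDerivAt (fun r : ℝ => ((n : ℝ) + 1) * (r - t)) (n + 1) r := by
      simpa using ((hasDerivAt_id r).sub_const t).const_mul ((n : ℝ) + 1)
    rw [mul_comm]
    exact (hasDerivAt_layerStep _).comp r h1
  have hF : ∀ n : ℕ, HasSlopeBound (fun z => layerStep ((n + 1) * (h z - t)))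
      (fun z => (n + 1) * layerBump ((n + 1) * (h z - t)) * k z) := fun n =>
    hh.comp (hT n) fun r => mul_nonneg (by positivity) (layerBump_nonneg _)
  have hhc := hh.continuous
  have hm : MeasurableSet {z | t < h z} := measurableSet_lt measurable_const hhc.measurable
  have hc : ∀ n : ℕ, Continuous fun z => (n + 1) * layerBump ((n + 1) * (h z - t)) * k z := fun n =>
    (continuous_const.mul (continuous_layerBump.comp (by fun_prop))).mul hk
  calc volume ({z | t < h z} ∩ box x y l)
      = ∫⁻ z in box x y l, {z | t < h z}.indicator 1 z := by
        rw [lintegral_indicator_one hm, Measure.restrict_apply hm]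
    _ ≤ ∫⁻ z in box x y l, Filter.liminf
          (fun n : ℕ => ENNReal.ofReal (layerStep ((n + 1) * (h z - t)))) Filter.atTop := by
        refine lintegral_mono fun z => ?_
        by_cases hz : t < h z
        · rw [indicator_of_mem (by exact hz)]
          refine Filter.le_liminf_of_le (by isBoundedDefault) ?_
          obtain ⟨N, hN⟩ := exists_nat_gt (1 / (h z - t))
          filter_upwards [Filter.eventually_ge_atTop N] with n hn
          have hp : 0 < h z - t := sub_pos.2 hz
          rw [layerStep_of_one_le, ENNReal.ofReal_one, Pi.one_apply]
          have h2 : (N : ℝ) ≤ n := by exact_mod_cast hn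
          rw [div_lt_iff₀ hp] at hN
          nlinarith
        · rw [indicator_of_notMem (by exact hz)]
          exact bot_le
    _ ≤ Filter.liminf (fun n : ℕ => ∫⁻ z in box x y l,
          ENNReal.ofReal (layerStep ((n + 1) * (h z - t)))) Filter.atTop :=
        lintegral_liminf_le fun n => (hF n).continuous.measurable.ennreal_ofReal
    _ ≤ Filter.liminf (fun n : ℕ => 4 * ENNReal.ofReal l * ∫⁻ z in box x y l,
          ENNReal.ofReal ((n + 1) * layerBump ((n + 1) * (h z - t)) * k z)) Filter.atTop := by
        refine Filter.liminf_le_liminf (Filter.Eventually.of_forall fun n => ?_)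
        refine (hF n).poincare (hc n) (fun z => mul_nonneg (mul_nonneg (by positivity)
          (layerBump_nonneg _)) (hk0 z)) hl inter_subset_right (fun z hz => ?_) hv
        exact layerStep_of_nonpos (mul_nonpos_of_nonneg_of_nonpos (by positivity)
          (sub_nonpos.2 hz.1))
    _ = 4 * ENNReal.ofReal l * layerEnergy h k t x y l :=
        ENNReal.liminf_const_mul_of_ne_top (ENNReal.mul_ne_top (by simp) ENNReal.ofReal_ne_top)

lemma lintegral_layerEnergy_le {h k : E2 → ℝ} (hh : Continuous h) (hk : Continuous k)
    (hk0 : ∀ z, 0 ≤ k z) (x y l : ℝ) :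
    ∫⁻ t, layerEnergy h k t x y l ≤ 2 * ∫⁻ z in box x y l, ENNReal.ofReal (k z) := by
  have hc : ∀ n : ℕ, Continuous fun p : ℝ × E2 =>
      (n + 1) * layerBump ((n + 1) * (h p.2 - p.1)) * k p.2 := fun n =>
    (continuous_const.mul (continuous_layerBump.comp (by fun_prop))).mul (by fun_prop)
  have hm : ∀ n : ℕ, Measurable fun p : ℝ × E2 =>
      ENNReal.ofReal ((n + 1) * layerBump ((n + 1) * (h p.2 - p.1)) * k p.2) := fun n =>
    (hc n).measurable.ennreal_ofReal
  have hle : ∀ n : ℕ, ∫⁻ t, ∫⁻ z in box x y l,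
      ENNReal.ofReal ((n + 1) * layerBump ((n + 1) * (h z - t)) * k z) ≤
        2 * ∫⁻ z in box x y l, ENNReal.ofReal (k z) := by
    intro n
    rw [lintegral_lintegral_swap (hm n).aemeasurable, ← lintegral_const_mul _
      hk.measurable.ennreal_ofReal]
    refine lintegral_mono fun z => ?_
    have hn : (0 : ℝ) < n + 1 := by positivity
    calc ∫⁻ t, ENNReal.ofReal ((n + 1) * layerBump ((n + 1) * (h z - t)) * k z)
        ≤ ∫⁻ t, (Ioo (h z - 1 / (n + 1)) (h z)).indicator
            (fun _ => ENNReal.ofReal ((n + 1) * 2 * k z)) t := by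
          refine lintegral_mono fun t => ?_
          by_cases ht : t ∈ Ioo (h z - 1 / (n + 1)) (h z)
          · rw [indicator_of_mem ht]
            refine ENNReal.ofReal_le_ofReal ?_
            have := layerBump_le ((n + 1) * (h z - t))
            have h2 : layerBump ((n + 1) * (h z - t)) ≤ 2 :=
              this.trans (indicator_apply_le' (fun _ => le_rfl) fun _ => zero_le_two)
            have := hk0 z
            gcongr
          · rw [layerBump_eq_zero]
            · simp
            rintro ⟨h1, h2⟩
            refine ht ⟨?_, ?_⟩
            · have : h z - t < 1 / (n + 1) := by rwa [lt_div_iff₀ hn, mul_comm]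
              linarith
            · have := (pos_iff_pos_of_mul_pos h1).1 hn
              linarith
      _ = ENNReal.ofReal ((n + 1) * 2 * k z) * ENNReal.ofReal (1 / (n + 1)) := by
          rw [lintegral_indicator_const measurableSet_Ioo, Real.volume_Ioo]
          congr 2; ring
      _ = 2 * ENNReal.ofReal (k z) := by
          rw [← ENNReal.ofReal_mul' (by positivity), ← ENNReal.ofReal_ofNat,
            ← ENNReal.ofReal_mul (by norm_num)]
          congr 1; field_simp
  calc ∫⁻ t, layerEnergy h k t x y l
      ≤ Filter.liminf (fun n : ℕ => ∫⁻ t, ∫⁻ z in box x y l,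
          ENNReal.ofReal ((n + 1) * layerBump ((n + 1) * (h z - t)) * k z)) Filter.atTop :=
        lintegral_liminf_le fun n => (hm n).lintegral_prod_right'
    _ ≤ Filter.liminf (fun _ : ℕ => 2 * ∫⁻ z in box x y l, ENNReal.ofReal (k z)) Filter.atTop :=
        Filter.liminf_le_liminf (Filter.Eventually.of_forall hle)
    _ = _ := Filter.liminf_const _


/-- A finite family of pairwise disjoint dyadic subsquares of a square, encoded as a tree. -/
inductive DyadicTree : Type
  | empty : DyadicTree
  | sel : DyadicTree
  | node (a b c d : DyadicTree) : DyadicTree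

namespace DyadicTree

/-- The sum of `f` over the selected squares. -/
def sum (f : ℝ → ℝ → ℝ → ℝ≥0∞) : DyadicTree → ℝ → ℝ → ℝ → ℝ≥0∞
  | empty, _, _, _ => 0
  | sel, x, y, l => f x y l
  | node a b c d, x, y, l =>
    a.sum f x y (l / 2) + b.sum f (x + l / 2) y (l / 2) +
      (c.sum f x (y + l / 2) (l / 2) + d.sum f (x + l / 2) (y + l / 2) (l / 2))

/-- The sum of the side lengths of the selected squares. -/
def mass (T : DyadicTree) : ℝ → ℝ → ℝ → ℝ≥0∞ := T.sum fun _ _ l => ENNReal.ofReal l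

/-- The union of the selected squares. -/
def cover : DyadicTree → ℝ → ℝ → ℝ → Set E2
  | empty, _, _, _ => ∅
  | sel, x, y, l => box x y l
  | node a b c d, x, y, l =>
    a.cover x y (l / 2) ∪ b.cover (x + l / 2) y (l / 2) ∪
      (c.cover x (y + l / 2) (l / 2) ∪ d.cover (x + l / 2) (y + l / 2) (l / 2))

/-- At every node the selected squares have total side length at most that of the node. -/
def Packed : DyadicTree → ℝ → ℝ → ℝ → Prop
  | empty, _, _, _ => True
  | sel, _, _, _ => True
  | node a b c d, x, y, l =>
    (node a b c d).mass x y l ≤ ENNReal.ofReal l ∧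
      (a.Packed x y (l / 2) ∧ b.Packed (x + l / 2) y (l / 2)) ∧
      (c.Packed x (y + l / 2) (l / 2) ∧ d.Packed (x + l / 2) (y + l / 2) (l / 2))

/-- The number of selected squares. -/
def count : DyadicTree → ℝ≥0∞
  | empty => 0
  | sel => 1
  | node a b c d => a.count + b.count + (c.count + d.count)

lemma count_ne_top (T : DyadicTree) : T.count ≠ ⊤ := by
  induction T with
  | empty => simp [count]
  | sel => simp [count]
  | node a b c d ha hb hc hd => simp [count, ha, hb, hc, hd]

lemma sum_one (T : DyadicTree) (x y l : ℝ) : T.sum (fun _ _ _ => 1) x y l = T.count := by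
  induction T generalizing x y l with
  | empty => rfl
  | sel => rfl
  | node a b c d ha hb hc hd => simp only [sum, count, ha, hb, hc, hd]

lemma sum_add (T : DyadicTree) (f f' : ℝ → ℝ → ℝ → ℝ≥0∞) (x y l : ℝ) :
    T.sum (fun x y l => f x y l + f' x y l) x y l = T.sum f x y l + T.sum f' x y l := by
  induction T generalizing x y l with
  | empty => simp [sum]
  | sel => rfl
  | node a b c d ha hb hc hd => simp only [sum, ha, hb, hc, hd]; ring

lemma sum_const_mul (T : DyadicTree) (C : ℝ≥0∞) (f : ℝ → ℝ → ℝ → ℝ≥0∞) (x y l : ℝ) :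
    T.sum (fun x y l => C * f x y l) x y l = C * T.sum f x y l := by
  induction T generalizing x y l with
  | empty => simp [sum]
  | sel => rfl
  | node a b c d ha hb hc hd => simp only [sum, ha, hb, hc, hd]; ring

lemma sum_mono_of_subset (T : DyadicTree) {f f' : ℝ → ℝ → ℝ → ℝ≥0∞} {S : Set E2} {x y l : ℝ}
    (hl : 0 < l) (hS : box x y l ⊆ S)
    (h : ∀ x y l, 0 < l → box x y l ⊆ S → f x y l ≤ f' x y l) :
    T.sum f x y l ≤ T.sum f' x y l := by
  induction T generalizing x y l with
  | empty => simp [sum]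
  | sel => exact h _ _ _ hl hS
  | node a b c d ha hb hc hd =>
    rw [box_eq_union hl.le, union_subset_iff, union_subset_iff, union_subset_iff] at hS
    exact add_le_add (add_le_add (ha (half_pos hl) hS.1.1) (hb (half_pos hl) hS.1.2))
      (add_le_add (hc (half_pos hl) hS.2.1) (hd (half_pos hl) hS.2.2))

lemma sum_mono (T : DyadicTree) {f f' : ℝ → ℝ → ℝ → ℝ≥0∞} {x y l : ℝ}
    (hl : 0 < l) (h : ∀ x y l, 0 < l → f x y l ≤ f' x y l) :
    T.sum f x y l ≤ T.sum f' x y l :=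
  T.sum_mono_of_subset hl (subset_univ _) fun x y l hl _ => h x y l hl

lemma sum_lintegral (T : DyadicTree) {α : Type*} [MeasurableSpace α] (μ : Measure α)
    (f : ℝ → ℝ → ℝ → α → ℝ≥0∞) (hf : ∀ x y l, Measurable (f x y l)) (x y l : ℝ) :
    Measurable (fun t => T.sum (fun x y l => f x y l t) x y l) ∧
    T.sum (fun x y l => ∫⁻ t, f x y l t ∂μ) x y l =
      ∫⁻ t, T.sum (fun x y l => f x y l t) x y l ∂μ := by
  induction T generalizing x y l with
  | empty => simp [sum]
  | sel => exact ⟨hf _ _ _, rfl⟩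
  | node a b c d ha hb hc hd =>
    refine ⟨((ha _ _ _).1.add (hb _ _ _).1).add ((hc _ _ _).1.add (hd _ _ _).1), ?_⟩
    simp only [sum]
    have hab := (ha x y (l / 2)).1.add (hb (x + l / 2) y (l / 2)).1
    simp only [Pi.add_def] at hab
    rw [lintegral_add_left hab, lintegral_add_left (ha _ _ _).1,
      lintegral_add_left (hc _ _ _).1, (ha _ _ _).2, (hb _ _ _).2, (hc _ _ _).2, (hd _ _ _).2]

lemma sum_setLIntegral_le (T : DyadicTree) (f : E2 → ℝ≥0∞) {x y l : ℝ} (hl : 0 < l) :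
    T.sum (fun x y l => ∫⁻ z in box x y l, f z) x y l ≤ ∫⁻ z in box x y l, f z := by
  induction T generalizing x y l with
  | empty => simp [sum]
  | sel => rfl
  | node a b c d ha hb hc hd =>
    rw [lintegral_box_split volume hl.le]
    exact add_le_add (add_le_add (ha (half_pos hl)) (hb (half_pos hl)))
      (add_le_add (hc (half_pos hl)) (hd (half_pos hl)))

lemma Packed.mass_le {T : DyadicTree} {x y l : ℝ} (hT : T.Packed x y l) :
    T.mass x y l ≤ ENNReal.ofReal l := by
  cases T with
  | empty => simp [mass, sum]
  | sel => exact le_rfl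
  | node a b c d => exact hT.1

/-- Every family of dyadic squares can be packed without increasing the total side length. -/
lemma exists_packed (T : DyadicTree) (x y : ℝ) {l : ℝ} (hl : 0 < l) :
    ∃ T' : DyadicTree, T'.Packed x y l ∧ T'.mass x y l ≤ T.mass x y l ∧
      T.cover x y l ⊆ T'.cover x y l ∧ T'.cover x y l ⊆ box x y l := by
  induction T generalizing x y l with
  | empty => exact ⟨empty, trivial, le_rfl, subset_rfl, empty_subset _⟩
  | sel => exact ⟨sel, trivial, le_rfl, subset_rfl, subset_rfl⟩
  | node a b c d ha hb hc hd =>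
    obtain ⟨a', ha1, ha2, ha3, ha4⟩ := ha x y (half_pos hl)
    obtain ⟨b', hb1, hb2, hb3, hb4⟩ := hb (x + l / 2) y (half_pos hl)
    obtain ⟨c', hc1, hc2, hc3, hc4⟩ := hc x (y + l / 2) (half_pos hl)
    obtain ⟨d', hd1, hd2, hd3, hd4⟩ := hd (x + l / 2) (y + l / 2) (half_pos hl)
    have hm : (node a' b' c' d').mass x y l ≤ (node a b c d).mass x y l :=
      add_le_add (add_le_add ha2 hb2) (add_le_add hc2 hd2)
    have hcov : (node a b c d).cover x y l ⊆ (node a' b' c' d').cover x y l :=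
      union_subset_union (union_subset_union ha3 hb3) (union_subset_union hc3 hd3)
    have hbox : (node a' b' c' d').cover x y l ⊆ box x y l := by
      rw [box_eq_union hl.le]
      exact union_subset_union (union_subset_union ha4 hb4) (union_subset_union hc4 hd4)
    by_cases h : (node a' b' c' d').mass x y l ≤ ENNReal.ofReal l
    · exact ⟨node a' b' c' d', ⟨h, ⟨ha1, hb1⟩, hc1, hd1⟩, hm, hcov, hbox⟩
    · exact ⟨sel, trivial, (le_of_not_ge h).trans hm, hcov.trans hbox, subset_rfl⟩

/-- The union of two families of dyadic squares is again such a family. -/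
lemma exists_union (T T' : DyadicTree) (x y : ℝ) {l : ℝ} (hl : 0 < l) :
    ∃ T'' : DyadicTree, T''.mass x y l ≤ T.mass x y l + T'.mass x y l ∧
      T.cover x y l ∪ T'.cover x y l ⊆ T''.cover x y l := by
  have hsub : ∀ (T : DyadicTree), T.cover x y l ⊆ box x y l := fun T => by
    obtain ⟨P, -, -, h1, h2⟩ := T.exists_packed x y hl
    exact h1.trans h2
  induction T generalizing T' x y l with
  | empty => exact ⟨T', le_add_self, by simp [cover]⟩
  | sel => exact ⟨sel, le_self_add, union_subset subset_rfl (hsub T')⟩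
  | node a b c d ha hb hc hd =>
    cases T' with
    | empty => exact ⟨node a b c d, le_self_add, by simp [cover]⟩
    | sel => exact ⟨sel, le_add_self, union_subset (hsub _) subset_rfl⟩
    | node a' b' c' d' =>
      have hsub' : ∀ (x y l : ℝ), 0 < l → ∀ T : DyadicTree, T.cover x y l ⊆ box x y l :=
        fun x y l hl T => by
          obtain ⟨P, -, -, h1, h2⟩ := T.exists_packed x y hl
          exact h1.trans h2
      obtain ⟨A, hA1, hA2⟩ := ha a' x y (half_pos hl) (hsub' _ _ _ (half_pos hl))
      obtain ⟨B, hB1, hB2⟩ := hb b' (x + l / 2) y (half_pos hl) (hsub' _ _ _ (half_pos hl))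
      obtain ⟨C, hC1, hC2⟩ := hc c' x (y + l / 2) (half_pos hl) (hsub' _ _ _ (half_pos hl))
      obtain ⟨D, hD1, hD2⟩ := hd d' (x + l / 2) (y + l / 2) (half_pos hl)
        (hsub' _ _ _ (half_pos hl))
      refine ⟨node A B C D, ?_, ?_⟩
      · refine (add_le_add (add_le_add hA1 hB1) (add_le_add hC1 hD1)).trans (le_of_eq ?_)
        simp only [mass, sum]
        ring
      · simp only [cover]
        rintro p ((((h | h) | (h | h))) | (((h | h) | (h | h))))
        · exact Or.inl (Or.inl (hA2 (Or.inl h)))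
        · exact Or.inl (Or.inr (hB2 (Or.inl h)))
        · exact Or.inr (Or.inl (hC2 (Or.inl h)))
        · exact Or.inr (Or.inr (hD2 (Or.inl h)))
        · exact Or.inl (Or.inl (hA2 (Or.inr h)))
        · exact Or.inl (Or.inr (hB2 (Or.inr h)))
        · exact Or.inr (Or.inl (hC2 (Or.inr h)))
        · exact Or.inr (Or.inr (hD2 (Or.inr h)))

lemma volume_image_cover_le (T : DyadicTree) (f : E2 → ℝ) (x y l : ℝ) :
    volume (f '' T.cover x y l) ≤ T.sum (fun x y l => ediam (f '' box x y l)) x y l := by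
  induction T generalizing x y l with
  | empty => simp [sum, cover]
  | sel => exact Real.volume_le_diam _
  | node a b c d ha hb hc hd =>
    simp only [cover, sum, image_union]
    exact (measure_union_le _ _).trans (add_le_add
      ((measure_union_le _ _).trans (add_le_add (ha _ _ _) (hb _ _ _)))
      ((measure_union_le _ _).trans (add_le_add (hc _ _ _) (hd _ _ _))))

/-- Trace inequality for the superlevel sets of `h`. -/
lemma sum_superlevel_le {h k : E2 → ℝ} (hh : HasSlopeBound h k) (hk : Continuous k)
    (hk0 : ∀ z, 0 ≤ k z) {t : ℝ} (T : DyadicTree) {x y l : ℝ} (hl : 0 < l)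
    (hT : T.Packed x y l)
    (hv : ENNReal.ofReal l * ENNReal.ofReal l ≤ 2 * volume ({z | h z ≤ t} ∩ box x y l)) :
    T.sum (fun x y l => (ENNReal.ofReal l)⁻¹ * volume ({z | t < h z} ∩ box x y l)) x y l ≤
      32 * layerEnergy h k t x y l := by
  induction T generalizing x y l with
  | empty => simp [sum]
  | sel =>
    have hL : ENNReal.ofReal l ≠ 0 := by simpa using hl
    have h1 := hh.volume_superlevel_le hk hk0 hl hv
    calc (ENNReal.ofReal l)⁻¹ * volume ({z | t < h z} ∩ box x y l)
        ≤ (ENNReal.ofReal l)⁻¹ * (4 * ENNReal.ofReal l * layerEnergy h k t x y l) := by gcongr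
      _ = ((ENNReal.ofReal l)⁻¹ * ENNReal.ofReal l) * (4 * layerEnergy h k t x y l) := by ring
      _ = 4 * layerEnergy h k t x y l := by
        rw [ENNReal.inv_mul_cancel hL ENNReal.ofReal_ne_top, one_mul]
      _ ≤ _ := by gcongr; norm_num
  | node a b c d ha hb hc hd =>
    set M := ENNReal.ofReal (l / 2)
    have hl2 := half_pos hl
    have hM0 : M ≠ 0 := by simpa [M] using hl
    have hMt : M ≠ ⊤ := ENNReal.ofReal_ne_top
    have hLM : ENNReal.ofReal l = 2 * M := by
      rw [← ENNReal.ofReal_ofNat, ← ENNReal.ofReal_mul (by norm_num)]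
      congr 1; ring
    have hbad : ∀ x' y', box x' y' (l / 2) ⊆ box x y l →
        ¬ (M * M ≤ 2 * volume ({z | h z ≤ t} ∩ box x' y' (l / 2))) →
        ENNReal.ofReal l ≤ 32 * layerEnergy h k t x y l := by
      intro x' y' hsub hn
      have h1 : M * M = volume ({z | h z ≤ t} ∩ box x' y' (l / 2)) +
          volume ({z | t < h z} ∩ box x' y' (l / 2)) := by
        rw [← volume_box x' y', ← measure_inter_add_sdiff (box x' y' (l / 2))
          (measurableSet_le hh.continuous.measurable (measurable_const (a := t)))]
        congr 2
        · exact inter_comm _ _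
        · ext z; simp [and_comm]
      have h2 : M * M ≤ 2 * volume ({z | t < h z} ∩ box x' y' (l / 2)) := by
        by_contra! h3
        push Not at hn
        have h4 := ENNReal.add_lt_add hn h3
        rw [← mul_add, ← h1, two_mul] at h4
        exact lt_irrefl _ h4
      have h3 : M * M ≤ M * (16 * layerEnergy h k t x y l) := by
        calc M * M ≤ 2 * volume ({z | t < h z} ∩ box x y l) :=
              h2.trans (mul_le_mul_right (measure_mono (inter_subset_inter_right _ hsub)) _)
          _ ≤ 2 * (4 * ENNReal.ofReal l * layerEnergy h k t x y l) := by
              gcongr; exact hh.volume_superlevel_le hk hk0 hl hv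
          _ = _ := by rw [hLM]; ring
      have h4 := (ENNReal.mul_le_mul_iff_right hM0 hMt).1 h3
      rw [hLM]
      calc 2 * M ≤ 2 * (16 * layerEnergy h k t x y l) := by gcongr
        _ = _ := by ring
    have hmass : (node a b c d).sum
        (fun x y l => (ENNReal.ofReal l)⁻¹ * volume ({z | t < h z} ∩ box x y l)) x y l ≤
          ENNReal.ofReal l := by
      refine (sum_mono _ hl fun x y l hl => ?_).trans hT.1
      have hL : ENNReal.ofReal l ≠ 0 := by simpa using hl
      calc _ ≤ (ENNReal.ofReal l)⁻¹ * volume (box x y l) := by gcongr; exact inter_subset_right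
        _ = _ := by
          rw [volume_box, ← mul_assoc, ENNReal.inv_mul_cancel hL ENNReal.ofReal_ne_top, one_mul]
    have hU := box_eq_union (x := x) (y := y) hl.le
    by_cases ca : M * M ≤ 2 * volume ({z | h z ≤ t} ∩ box x y (l / 2))
    swap
    · exact hmass.trans (hbad _ _ (fun z hz => hU ▸ Or.inl (Or.inl hz)) ca)
    by_cases cb : M * M ≤ 2 * volume ({z | h z ≤ t} ∩ box (x + l / 2) y (l / 2))
    swap
    · exact hmass.trans (hbad _ _ (fun z hz => hU ▸ Or.inl (Or.inr hz)) cb)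
    by_cases cc : M * M ≤ 2 * volume ({z | h z ≤ t} ∩ box x (y + l / 2) (l / 2))
    swap
    · exact hmass.trans (hbad _ _ (fun z hz => hU ▸ Or.inr (Or.inl hz)) cc)
    by_cases cd : M * M ≤ 2 * volume ({z | h z ≤ t} ∩ box (x + l / 2) (y + l / 2) (l / 2))
    swap
    · exact hmass.trans (hbad _ _ (fun z hz => hU ▸ Or.inr (Or.inr hz)) cd)
    refine le_trans (add_le_add
      (add_le_add (ha hl2 hT.2.1.1 ca) (hb hl2 hT.2.1.2 cb))
      (add_le_add (hc hl2 hT.2.2.1 cc) (hd hl2 hT.2.2.2 cd))) ?_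
    rw [← mul_add, ← mul_add, ← mul_add]
    gcongr
    exact layerEnergy_split h k t x y hl.le

/-- Trace inequality: the normalized integrals of `h` over a packed family of dyadic squares. -/
lemma sum_average_le {h k : E2 → ℝ} (hh : HasSlopeBound h k) (hk : Continuous k)
    (hh0 : ∀ z, 0 ≤ h z) (hk0 : ∀ z, 0 ≤ k z) (T : DyadicTree) (hT : T.Packed 0 0 1) :
    T.sum (fun x y l => (ENNReal.ofReal l)⁻¹ * ∫⁻ z in box x y l, ENNReal.ofReal (h z)) 0 0 1 ≤
      2 * (∫⁻ z in box 0 0 1, ENNReal.ofReal (h z)) +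
        64 * ∫⁻ z in box 0 0 1, ENNReal.ofReal (k z) := by
  have hhm := hh.continuous.measurable
  set H := ∫⁻ z in box 0 0 1, ENNReal.ofReal (h z)
  by_cases hH : H = ⊤
  · simp [hH]
  have hanti : ∀ x y l, Antitone fun t : ℝ => volume ({z | t < h z} ∩ box x y l) :=
    fun x y l s t hst => measure_mono (inter_subset_inter_left _ fun z hz => hst.trans_lt hz)
  have hmeas : ∀ x y l, Measurable fun t : ℝ =>
      (ENNReal.ofReal l)⁻¹ * volume ({z | t < h z} ∩ box x y l) := fun x y l =>
    (hanti x y l).measurable.const_mul _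
  have hcake : ∀ x y l, (ENNReal.ofReal l)⁻¹ * ∫⁻ z in box x y l, ENNReal.ofReal (h z) =
      ∫⁻ t in Ioi (0 : ℝ), (ENNReal.ofReal l)⁻¹ * volume ({z | t < h z} ∩ box x y l) := by
    intro x y l
    rw [lintegral_const_mul _ (hanti x y l).measurable,
      lintegral_eq_lintegral_meas_lt _ (Filter.Eventually.of_forall hh0) hhm.aemeasurable]
    congr 1
    refine lintegral_congr fun t => ?_
    rw [Measure.restrict_apply (measurableSet_lt measurable_const hhm)]
  simp_rw [hcake]
  rw [(T.sum_lintegral _ _ hmeas 0 0 1).2]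
  have hpt : ∀ t ∈ Ioi (0 : ℝ),
      T.sum (fun x y l => (ENNReal.ofReal l)⁻¹ * volume ({z | t < h z} ∩ box x y l)) 0 0 1 ≤
        32 * layerEnergy h k t 0 0 1 + (Ioc 0 (2 * H.toReal)).indicator 1 t := by
    intro t ht
    by_cases hv : ENNReal.ofReal 1 * ENNReal.ofReal 1 ≤ 2 * volume ({z | h z ≤ t} ∩ box 0 0 1)
    · exact (sum_superlevel_le hh hk hk0 T one_pos hT hv).trans le_self_add
    · refine le_trans ?_ le_add_self
      have h1 : (1 : ℝ≥0∞) = volume ({z | h z ≤ t} ∩ box 0 0 1) +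
          volume ({z | t < h z} ∩ box 0 0 1) := by
        have : (1 : ℝ≥0∞) = volume (box 0 0 1) := by rw [volume_box]; simp
        rw [this, ← measure_inter_add_sdiff (box 0 0 1)
          (measurableSet_le hhm (measurable_const (a := t)))]
        congr 2
        · exact inter_comm _ _
        · ext z; simp [and_comm]
      have h2 : 1 ≤ 2 * volume ({z | t < h z} ∩ box 0 0 1) := by
        by_contra! h3
        simp only [ENNReal.ofReal_one, one_mul] at hv
        push Not at hv
        have h4 := ENNReal.add_lt_add hv h3
        rw [← mul_add, ← h1, mul_one, one_add_one_eq_two] at h4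
        exact lt_irrefl _ h4
      have h3 : ENNReal.ofReal t * volume ({z | t < h z} ∩ box 0 0 1) ≤ H := by
        rw [← Measure.restrict_apply (measurableSet_lt measurable_const hhm)]
        refine le_trans ?_ (mul_meas_ge_le_lintegral hhm.ennreal_ofReal (ENNReal.ofReal t))
        gcongr with z
        intro hz
        exact ENNReal.ofReal_le_ofReal (le_of_lt hz)
      have h4 : ENNReal.ofReal t ≤ 2 * H := by
        calc ENNReal.ofReal t ≤ ENNReal.ofReal t * (2 * volume ({z | t < h z} ∩ box 0 0 1)) :=
              le_mul_of_one_le_right' h2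
          _ = 2 * (ENNReal.ofReal t * volume ({z | t < h z} ∩ box 0 0 1)) := by ring
          _ ≤ _ := by gcongr
      have h5 : t ≤ 2 * H.toReal := by
        have := ENNReal.toReal_mono (ENNReal.mul_ne_top (by simp) hH) h4
        rwa [ENNReal.toReal_ofReal (le_of_lt ht), ENNReal.toReal_mul, ENNReal.toReal_ofNat] at this
      rw [indicator_of_mem (show t ∈ Ioc 0 (2 * H.toReal) from ⟨ht, h5⟩), Pi.one_apply]
      refine le_trans (sum_mono T one_pos fun x y l hl => ?_)
        (hT.mass_le.trans ENNReal.ofReal_one.le)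
      have hL : ENNReal.ofReal l ≠ 0 := by simpa using hl
      calc _ ≤ (ENNReal.ofReal l)⁻¹ * volume (box x y l) := by gcongr; exact inter_subset_right
        _ = _ := by
          rw [volume_box, ← mul_assoc, ENNReal.inv_mul_cancel hL ENNReal.ofReal_ne_top, one_mul]
  refine (setLIntegral_mono' measurableSet_Ioi hpt).trans ?_
  rw [lintegral_add_right _ (measurable_one.indicator measurableSet_Ioc), add_comm]
  refine add_le_add ?_ ?_
  · refine (setLIntegral_le_lintegral _ _).trans ?_
    rw [lintegral_indicator_one measurableSet_Ioc, Real.volume_Ioc, sub_zero,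
      ENNReal.ofReal_mul (by norm_num), ENNReal.ofReal_toReal hH, ENNReal.ofReal_ofNat]
  · refine (setLIntegral_le_lintegral _ _).trans ?_
    rw [lintegral_const_mul' _ _ (by simp)]
    calc 32 * ∫⁻ t, layerEnergy h k t 0 0 1
        ≤ 32 * (2 * ∫⁻ z in box 0 0 1, ENNReal.ofReal (k z)) := by
          gcongr; exact lintegral_layerEnergy_le hh.continuous hk hk0 0 0 1
      _ = _ := by ring

/-- The total oscillation over a packed family of dyadic squares of a function with two
integrable derivatives. -/
lemma sum_ediam_image_le {u h k : E2 → ℝ} (hu : HasSlopeBound u h) (hh : HasSlopeBound h k)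
    (hk : Continuous k) (hh0 : ∀ z, 0 ≤ h z) (hk0 : ∀ z, 0 ≤ k z) (T : DyadicTree)
    (hT : T.Packed 0 0 1) :
    T.sum (fun x y l => ediam (u '' box x y l)) 0 0 1 ≤
      130 * ((∫⁻ z in box 0 0 1, ENNReal.ofReal (h z)) +
        ∫⁻ z in box 0 0 1, ENNReal.ofReal (k z)) := by
  calc T.sum (fun x y l => ediam (u '' box x y l)) 0 0 1
      ≤ T.sum (fun x y l => 2 * ((ENNReal.ofReal l)⁻¹ * (∫⁻ z in box x y l, ENNReal.ofReal (h z)) +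
          ∫⁻ z in box x y l, ENNReal.ofReal (k z))) 0 0 1 := by
        refine sum_mono T one_pos fun x y l hl => ?_
        have hL : ENNReal.ofReal l ≠ 0 := by simpa using hl
        refine ediam_image_le_iff.2 fun z hz w hw => ?_
        have h1 := hu.mul_ofReal_abs_sub_le hh hk hh0 hk0 hz hw
        rw [edist_dist, Real.dist_eq]
        calc ENNReal.ofReal |u z - u w|
            = (ENNReal.ofReal l)⁻¹ * (ENNReal.ofReal l * ENNReal.ofReal |u z - u w|) := by
              rw [← mul_assoc, ENNReal.inv_mul_cancel hL ENNReal.ofReal_ne_top, one_mul]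
          _ ≤ (ENNReal.ofReal l)⁻¹ * (2 * ((∫⁻ z in box x y l, ENNReal.ofReal (h z)) +
                ENNReal.ofReal l * ∫⁻ z in box x y l, ENNReal.ofReal (k z))) := by gcongr
          _ = 2 * ((ENNReal.ofReal l)⁻¹ * (∫⁻ z in box x y l, ENNReal.ofReal (h z)) +
                ((ENNReal.ofReal l)⁻¹ * ENNReal.ofReal l) *
                  ∫⁻ z in box x y l, ENNReal.ofReal (k z)) := by ring
          _ = _ := by rw [ENNReal.inv_mul_cancel hL ENNReal.ofReal_ne_top, one_mul]
    _ ≤ 2 * ((2 * (∫⁻ z in box 0 0 1, ENNReal.ofReal (h z)) +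
          64 * ∫⁻ z in box 0 0 1, ENNReal.ofReal (k z)) +
            ∫⁻ z in box 0 0 1, ENNReal.ofReal (k z)) := by
        rw [sum_const_mul, sum_add]
        gcongr
        · exact sum_average_le hh hk hh0 hk0 T hT
        · exact T.sum_setLIntegral_le _ one_pos
    _ = 4 * (∫⁻ z in box 0 0 1, ENNReal.ofReal (h z)) +
          130 * ∫⁻ z in box 0 0 1, ENNReal.ofReal (k z) := by ring
    _ ≤ _ := by
        rw [mul_add]
        gcongr
        norm_num

lemma exists_cover_uniform {B t : Set E2} (m : ℕ) (x y : ℝ) {l : ℝ} (hl : 0 < l)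
    (h : ∀ q ∈ t, closedBall q (l / 2 ^ m) ⊆ B) :
    ∃ T : DyadicTree, t ∩ box x y l ⊆ T.cover x y l ∧
      T.mass x y l * ENNReal.ofReal (l / 2 ^ m) ≤ volume.restrict B (box x y l) := by
  induction m generalizing x y l with
  | zero =>
    rcases (t ∩ box x y l).eq_empty_or_nonempty with h0 | ⟨q, hqt, hq⟩
    · exact ⟨empty, h0.le, by simp [mass, sum]⟩
    · refine ⟨sel, inter_subset_right, ?_⟩
      have hsub : box x y l ⊆ B := by
        refine Subset.trans (fun z hz => ?_) (h q hqt)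
        rw [pow_zero, div_one, mem_closedBall, Prod.dist_eq, Real.dist_eq, Real.dist_eq]
        refine max_le (abs_le.2 ⟨?_, ?_⟩) (abs_le.2 ⟨?_, ?_⟩)
        · linarith [hz.1.1, hq.1.2]
        · linarith [hz.1.2, hq.1.1]
        · linarith [hz.2.1, hq.2.2]
        · linarith [hz.2.2, hq.2.1]
      rw [Measure.restrict_apply (measurableSet_box _ _ _), inter_eq_left.2 hsub, volume_box]
      simp [mass, sum]
  | succ m ih =>
    have hlm : l / 2 ^ (m + 1) = l / 2 / 2 ^ m := by rw [pow_succ, div_div, mul_comm]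
    rw [hlm] at h ⊢
    obtain ⟨a, ha1, ha2⟩ := ih x y (half_pos hl) h
    obtain ⟨b, hb1, hb2⟩ := ih (x + l / 2) y (half_pos hl) h
    obtain ⟨c, hc1, hc2⟩ := ih x (y + l / 2) (half_pos hl) h
    obtain ⟨d, hd1, hd2⟩ := ih (x + l / 2) (y + l / 2) (half_pos hl) h
    refine ⟨node a b c d, ?_, ?_⟩
    · rw [box_eq_union hl.le, inter_union_distrib_left, inter_union_distrib_left,
        inter_union_distrib_left]
      exact union_subset_union (union_subset_union ha1 hb1) (union_subset_union hc1 hd1)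
    · rw [measure_box_split _ hl.le]
      refine le_trans (le_of_eq ?_) (add_le_add (add_le_add ha2 hb2) (add_le_add hc2 hd2))
      simp only [mass, sum]
      ring

lemma exists_cover {t : Set E2} (ht : t ⊆ box 0 0 1) {r : ℝ} (hr : 0 < r)
    (hd : ediam t ≤ ENNReal.ofReal r) :
    ∃ T : DyadicTree, t ⊆ T.cover 0 0 1 ∧ T.mass 0 0 1 ≤ 32 * ENNReal.ofReal r := by
  rcases t.eq_empty_or_nonempty with rfl | ⟨p, hp⟩
  · exact ⟨empty, empty_subset _, by simp [mass, sum]⟩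
  rcases le_or_gt 1 r with h1 | h1
  · refine ⟨sel, ht, ?_⟩
    simp only [mass, sum]
    calc ENNReal.ofReal 1 ≤ 1 * ENNReal.ofReal r := by
          rw [one_mul]; exact ENNReal.ofReal_le_ofReal h1
      _ ≤ _ := by gcongr; norm_num
  obtain ⟨m, hm1, hm2⟩ := exists_nat_pow_near_of_lt_one hr h1.le (y := (1 / 2 : ℝ))
    (by norm_num) (by norm_num)
  set s : ℝ := (1 / 2 : ℝ) ^ m
  have hs : 0 < s := by positivity
  have hsr : s < 2 * r := by
    rw [pow_succ] at hm1; linarith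
  have hsm : (1 : ℝ) / 2 ^ m = s := by simp [s]
  obtain ⟨T, hT1, hT2⟩ := exists_cover_uniform (B := closedBall p (r + s)) (t := t) m 0 0 one_pos
    (fun q hq => by
      rw [hsm]
      refine closedBall_subset_closedBall' ?_
      have h2 : edist q p ≤ ENNReal.ofReal r := (edist_le_ediam_of_mem hq hp).trans hd
      rw [edist_dist, ENNReal.ofReal_le_ofReal_iff hr.le] at h2
      linarith)
  refine ⟨T, (subset_inter subset_rfl ht).trans hT1, ?_⟩
  rw [hsm] at hT2
  have hs0 : ENNReal.ofReal s ≠ 0 := by simpa using hs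
  have hvol : volume (closedBall p (r + s)) = ENNReal.ofReal (2 * (r + s)) *
      ENNReal.ofReal (2 * (r + s)) := by
    rw [← closedBall_prod_same, Measure.volume_eq_prod, Measure.prod_prod, Real.volume_closedBall,
      Real.volume_closedBall]
  have h3 : T.mass 0 0 1 * ENNReal.ofReal s ≤ 32 * ENNReal.ofReal r * ENNReal.ofReal s := by
    refine hT2.trans ((measure_mono (subset_univ _)).trans ?_)
    rw [Measure.restrict_apply_univ, hvol, ← ENNReal.ofReal_ofNat,
      ← ENNReal.ofReal_mul (by positivity),
      ← ENNReal.ofReal_mul (by positivity), ← ENNReal.ofReal_mul (by positivity)]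
    refine ENNReal.ofReal_le_ofReal ?_
    nlinarith [mul_pos hr hs, mul_nonneg hs.le (sub_nonneg.2 hsr.le),
      mul_nonneg hr.le (sub_nonneg.2 hm2)]
  exact (ENNReal.mul_le_mul_iff_left hs0 ENNReal.ofReal_ne_top).1 h3

/-- To bound the measure of `f '' U` it suffices to control the total oscillation of `f` over
packed families of dyadic squares. -/
lemma volume_image_le {f : E2 → ℝ} {U : Set E2} (hU : U ⊆ box 0 0 1) {δ ε : ℝ≥0∞}
    (hδ : hausdorffContent1 U < δ)
    (H : ∀ T : DyadicTree, T.Packed 0 0 1 → T.mass 0 0 1 ≤ 32 * δ →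
      T.sum (fun x y l => ediam (f '' box x y l)) 0 0 1 ≤ ε) :
    volume (f '' U) ≤ ε := by
  simp only [hausdorffContent1, iInf_lt_iff] at hδ
  obtain ⟨t, htU, htδ⟩ := hδ
  change ∑' n, ediam (t n) < δ at htδ
  obtain ⟨c, hc0, hcs⟩ := ENNReal.exists_pos_sum_of_countable (tsub_pos_of_lt htδ).ne' ℕ
  have hfin : ∀ n, ediam (t n) ≠ ⊤ := fun n =>
    ((ENNReal.le_tsum n).trans_lt (htδ.trans_le le_top)).ne
  have hr : ∀ n, ENNReal.ofReal ((ediam (t n)).toReal + c n) = ediam (t n) + c n := fun n => by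
    rw [ENNReal.ofReal_add ENNReal.toReal_nonneg (c n).coe_nonneg, ENNReal.ofReal_toReal (hfin n),
      ENNReal.ofReal_coe_nnreal]
  have hV : ∀ n, ∃ T : DyadicTree, t n ∩ box 0 0 1 ⊆ T.cover 0 0 1 ∧
      T.mass 0 0 1 ≤ 32 * (ediam (t n) + c n) := fun n => by
    rw [← hr n]
    refine exists_cover inter_subset_right (add_pos_of_nonneg_of_pos ENNReal.toReal_nonneg
      (NNReal.coe_pos.2 (hc0 n))) ?_
    rw [hr n]
    exact (ediam_mono inter_subset_left).trans le_self_add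
  choose V hV1 hV2 using hV
  choose un hun1 hun2 using fun T T' : DyadicTree => exists_union T T' 0 0 one_pos
  let W : ℕ → DyadicTree := fun n => Nat.rec empty (fun n T => un T (V n)) n
  have hWs : ∀ n, W (n + 1) = un (W n) (V n) := fun n => rfl
  have hWmass : ∀ n, (W n).mass 0 0 1 ≤ ∑ i ∈ Finset.range n, 32 * (ediam (t i) + c i) := by
    intro n
    induction n with
    | zero => simp [W, mass, sum]
    | succ n ih =>
      rw [hWs, Finset.sum_range_succ]
      exact (hun1 _ _).trans (add_le_add ih (hV2 n))
  have hWmono : Monotone fun n => f '' (W n).cover 0 0 1 :=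
    monotone_nat_of_le_succ fun n => by
      rw [hWs]
      exact image_mono (subset_union_left.trans (hun2 (W n) (V n)))
  have hUW : f '' U ⊆ ⋃ n, f '' (W n).cover 0 0 1 := by
    rintro _ ⟨p, hp, rfl⟩
    obtain ⟨n, hn⟩ := mem_iUnion.1 (htU hp)
    exact mem_iUnion.2 ⟨n + 1, mem_image_of_mem f (by
      rw [hWs]
      exact hun2 _ _ (Or.inr (hV1 n ⟨hn, hU hp⟩)))⟩
  refine (measure_mono hUW).trans ?_
  rw [hWmono.measure_iUnion]
  refine iSup_le fun n => ?_
  obtain ⟨P, hP1, hP2, hP3, -⟩ := (W n).exists_packed 0 0 one_pos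
  refine (measure_mono (image_mono hP3)).trans ((P.volume_image_cover_le f 0 0 1).trans
    (H P hP1 (hP2.trans ((hWmass n).trans ?_))))
  rw [← Finset.mul_sum]
  gcongr
  refine (ENNReal.sum_le_tsum _).trans ?_
  rw [ENNReal.tsum_add]
  refine (add_le_add le_rfl hcs.le).trans ?_
  rw [add_tsub_cancel_of_le htδ.le]

end DyadicTree

lemma exists_translate_lintegral_le {f : E2 → ℝ} (hf : Integrable f) {η : ℝ≥0∞} (hη : η ≠ 0) :
    ∃ r > 0, ∀ t : E2, ‖t‖ < r → ∫⁻ x, ‖f (x - t) - f x‖ₑ ≤ η := by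
  have hη3 : η / 3 ≠ 0 := by simp [hη]
  obtain ⟨g, hgs, hfg, hgc, hgi⟩ := hf.exists_hasCompactSupport_lintegral_sub_le hη3
  obtain ⟨R, hR⟩ := hgs.isBounded.subset_closedBall 0
  have hVt : volume (closedBall (0 : E2) (R + 1)) ≠ ⊤ := measure_closedBall_lt_top.ne
  obtain ⟨ω, hω0, hω⟩ : ∃ ω : ℝ≥0, 0 < ω ∧ ω * volume (closedBall (0 : E2) (R + 1)) ≤ η / 3 := by
    obtain ⟨ω, h0, h1⟩ := ENNReal.exists_nnreal_pos_mul_lt hVt hη3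
    exact ⟨ω, h0, h1.le⟩
  obtain ⟨r, hr0, hr⟩ := Metric.uniformContinuous_iff.1
    (hgs.uniformContinuous_of_continuous hgc) ω (NNReal.coe_pos.2 hω0)
  refine ⟨min r 1, lt_min hr0 one_pos, fun t ht => ?_⟩
  have hg : ∫⁻ x, ‖g (x - t) - g x‖ₑ ≤ η / 3 := by
    refine le_trans ?_ hω
    rw [← lintegral_indicator_const measurableSet_closedBall]
    refine lintegral_mono fun x => ?_
    by_cases hx : x ∈ closedBall (0 : E2) (R + 1)
    · rw [indicator_of_mem hx]
      have h1 : dist (g (x - t)) (g x) < ω := hr <| by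
        simpa [dist_eq_norm] using ht.trans_le (min_le_left _ _)
      rw [enorm_le_coe, ← NNReal.coe_le_coe, coe_nnnorm, ← dist_eq_norm]
      exact h1.le
    · rw [indicator_of_notMem hx]
      have h0 : ∀ y, y ∉ closedBall (0 : E2) R → g y = 0 := fun y hy =>
        image_eq_zero_of_notMem_tsupport fun h => hy (hR h)
      rw [mem_closedBall, dist_zero_right, not_le] at hx
      rw [h0 x, h0 (x - t)]
      · simp
      · rw [mem_closedBall, dist_zero_right, not_le]
        have := norm_sub_norm_le x t
        have := ht.trans_le (min_le_right _ _)
        linarith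
      · rw [mem_closedBall, dist_zero_right, not_le]
        linarith
  have hfgm : AEMeasurable (fun x => ‖f x - g x‖ₑ) := (hf.sub hgi).1.enorm
  have hfgt : ∫⁻ x, ‖f (x - t) - g (x - t)‖ₑ ≤ η / 3 := by
    rwa [lintegral_sub_right_eq_self (fun x => ‖f x - g x‖ₑ) t]
  calc ∫⁻ x, ‖f (x - t) - f x‖ₑ
      ≤ ∫⁻ x, (‖f (x - t) - g (x - t)‖ₑ + ‖g (x - t) - g x‖ₑ + ‖f x - g x‖ₑ) := by
        refine lintegral_mono fun x => ?_
        calc ‖f (x - t) - f x‖ₑ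
            = ‖(f (x - t) - g (x - t)) + (g (x - t) - g x) - (f x - g x)‖ₑ := by congr 1; ring
          _ ≤ _ := enorm_sub_le.trans (add_le_add (enorm_add_le _ _) le_rfl)
    _ = (∫⁻ x, ‖f (x - t) - g (x - t)‖ₑ) + (∫⁻ x, ‖g (x - t) - g x‖ₑ) + ∫⁻ x, ‖f x - g x‖ₑ := by
        rw [lintegral_add_right' _ hfgm, lintegral_add_right']
        exact Measurable.aemeasurable (by fun_prop)
    _ ≤ η / 3 + η / 3 + η / 3 := by gcongr
    _ = η := ENNReal.add_thirds η

/-- Convolution of `f` with the kernel `κ`. -/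
def mollify (κ f : E2 → ℝ) (x : E2) : ℝ := ∫ t, f t * κ (x - t)

lemma mollify_eq_convolution (κ f : E2 → ℝ) :
    mollify κ f = convolution f κ (ContinuousLinearMap.mul ℝ ℝ) volume := rfl

lemma integrable_mul_kernel {κ f : E2 → ℝ} (hκ : Continuous κ) (hκs : HasCompactSupport κ)
    (hf : LocallyIntegrable f) (x : E2) : Integrable fun t => f t * κ (x - t) :=
  hκs.convolutionExists_right (ContinuousLinearMap.mul ℝ ℝ) hf hκ x

lemma mollify_sub_eq {κ f : E2 → ℝ} (hκ : Continuous κ) (hκs : HasCompactSupport κ)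
    (hκi : ∫ t, κ t = 1) (hf : LocallyIntegrable f) (x : E2) (a : ℝ) :
    Integrable (fun t => (f (x - t) - a) * κ t) ∧
      mollify κ f x - a = ∫ t, (f (x - t) - a) * κ t := by
  have h1 : Integrable fun t => f (x - t) * κ t := by
    have := (integrable_mul_kernel hκ hκs hf x).comp_sub_left x
    simpa using this
  have h2 : Integrable fun t => a * κ t := (hκ.integrable_of_hasCompactSupport hκs).const_mul a
  have h3 : mollify κ f x = ∫ t, f (x - t) * κ t := by
    rw [mollify, ← integral_sub_left_eq_self _ volume x]
    simp
  simp_rw [sub_mul]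
  refine ⟨h1.sub h2, ?_⟩
  rw [integral_sub h1 h2, integral_const_mul, hκi, mul_one, h3]

lemma lintegral_mollify_sub_le {κ f : E2 → ℝ} (hκ : Continuous κ) (hκs : HasCompactSupport κ)
    (hκi : ∫ t, κ t = 1) (hκ0 : ∀ t, 0 ≤ κ t) (hf : Integrable f) {η : ℝ≥0∞}
    (h : ∀ t, κ t ≠ 0 → ∫⁻ x, ‖f (x - t) - f x‖ₑ ≤ η) :
    ∫⁻ x, ‖mollify κ f x - f x‖ₑ ≤ η := by
  have hm : AEMeasurable (fun p : E2 × E2 => ‖(f (p.1 - p.2) - f p.1) * κ p.2‖ₑ) := by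
    have h1 : AEStronglyMeasurable (fun p : E2 × E2 => f (p.1 - p.2)) (volume.prod volume) :=
      hf.1.comp_quasiMeasurePreserving
        (quasiMeasurePreserving_sub_of_right_invariant volume volume)
    have h2 : AEStronglyMeasurable (fun p : E2 × E2 => f p.1) (volume.prod volume) :=
      hf.1.comp_fst
    have h3 : AEStronglyMeasurable (fun p : E2 × E2 => κ p.2) (volume.prod volume) :=
      (hκ.comp continuous_snd).aestronglyMeasurable
    exact ((h1.sub h2).mul h3).enorm
  calc ∫⁻ x, ‖mollify κ f x - f x‖ₑ
      ≤ ∫⁻ x, ∫⁻ t, ‖(f (x - t) - f x) * κ t‖ₑ := by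
        refine lintegral_mono fun x => ?_
        rw [(mollify_sub_eq hκ hκs hκi hf.locallyIntegrable x (f x)).2]
        exact enorm_integral_le_lintegral_enorm _
    _ = ∫⁻ t, ∫⁻ x, ‖(f (x - t) - f x) * κ t‖ₑ := lintegral_lintegral_swap hm
    _ ≤ ∫⁻ t, η * ENNReal.ofReal (κ t) := by
        refine lintegral_mono fun t => ?_
        simp_rw [enorm_mul]
        rw [lintegral_mul_const' _ _ (by simp), Real.enorm_of_nonneg (hκ0 t)]
        by_cases ht : κ t = 0
        · simp [ht]
        · gcongr
          exact h t ht
    _ = η := by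
        rw [lintegral_const_mul _ hκ.measurable.ennreal_ofReal,
          ← ofReal_integral_eq_lintegral_ofReal (hκ.integrable_of_hasCompactSupport hκs)
            (Filter.Eventually.of_forall hκ0), hκi, ENNReal.ofReal_one, mul_one]

lemma abs_mollify_sub_le {κ f : E2 → ℝ} (hκ : Continuous κ) (hκs : HasCompactSupport κ)
    (hκi : ∫ t, κ t = 1) (hκ0 : ∀ t, 0 ≤ κ t) (hf : LocallyIntegrable f) {x : E2} {a η : ℝ}
    (h : ∀ t, κ t ≠ 0 → |f (x - t) - a| ≤ η) : |mollify κ f x - a| ≤ η := by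
  rw [(mollify_sub_eq hκ hκs hκi hf x a).2]
  calc |∫ t, (f (x - t) - a) * κ t| ≤ ∫ t, η * κ t := by
        rw [← Real.norm_eq_abs]
        refine norm_integral_le_of_norm_le
          ((hκ.integrable_of_hasCompactSupport hκs).const_mul η)
          (Filter.Eventually.of_forall fun t => ?_)
        rw [norm_mul, Real.norm_eq_abs, Real.norm_of_nonneg (hκ0 t)]
        by_cases ht : κ t = 0
        · simp [ht]
        · exact mul_le_mul_of_nonneg_right (h t ht) (hκ0 t)
    _ = η := by rw [integral_const_mul, hκi, mul_one]

lemma contDiff_mollify {κ f : E2 → ℝ} (hκ : ContDiff ℝ (⊤ : ℕ∞) κ) (hκs : HasCompactSupport κ)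
    (hf : LocallyIntegrable f) : ContDiff ℝ (⊤ : ℕ∞) (mollify κ f) :=
  hκs.contDiff_convolution_right (ContinuousLinearMap.mul ℝ ℝ) hf hκ

lemma fderiv_mollify_apply {κ f : E2 → ℝ} (hκ : ContDiff ℝ (⊤ : ℕ∞) κ)
    (hκs : HasCompactSupport κ) (hf : LocallyIntegrable f) (x e : E2) :
    fderiv ℝ (mollify κ f) x e = ∫ t, f t * fderiv ℝ κ (x - t) e := by
  have hκ1 : ContDiff ℝ 1 κ := hκ.of_le (by exact_mod_cast le_top)
  rw [mollify_eq_convolution,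
    (hκs.hasFDerivAt_convolution_right (ContinuousLinearMap.mul ℝ ℝ) hf hκ1 x).fderiv,
    convolution_precompR_apply _ hf (hκs.fderiv ℝ) (hκ1.continuous_fderiv one_ne_zero)]
  rfl

/-- Mollification commutes with weak derivatives away from the boundary. -/
lemma HasWeakGradOn.fderiv_mollify {Ω : Set E2} (hΩ : IsOpen Ω) {f : E2 → ℝ} {g : E2 → E2}
    (h : HasWeakGradOn Ω f g) (hf : IntegrableOn f Ω) {κ : E2 → ℝ}
    (hκ : ContDiff ℝ (⊤ : ℕ∞) κ) (hκs : HasCompactSupport κ) {x : E2}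
    (hx : ∀ t ∈ tsupport κ, x - t ∈ Ω) :
    fderiv ℝ (mollify κ (Ω.indicator f)) x (1, 0) =
        mollify κ (Ω.indicator fun y => (g y).1) x ∧
      fderiv ℝ (mollify κ (Ω.indicator f)) x (0, 1) =
        mollify κ (Ω.indicator fun y => (g y).2) x := by
  have hfi : LocallyIntegrable (Ω.indicator f) :=
    ((integrable_indicator_iff hΩ.measurableSet).2 hf).locallyIntegrable
  have hind : ∀ a b : E2 → ℝ, ∫ t, Ω.indicator a t * b t = ∫ t in Ω, a t * b t := fun a b => by
    rw [← integral_indicator hΩ.measurableSet]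
    congr 1
    ext t
    by_cases ht : t ∈ Ω <;> simp [ht]
  set φ : E2 → ℝ := fun t => κ (x - t)
  have hφ : ContDiff ℝ (⊤ : ℕ∞) φ := hκ.comp (contDiff_const.sub contDiff_id)
  have hφs : HasCompactSupport φ := hκs.comp_homeomorph (Homeomorph.subLeft x)
  have hφt : tsupport φ ⊆ Ω := by
    have : tsupport φ = (Homeomorph.subLeft x) ⁻¹' tsupport κ :=
      tsupport_comp_eq_preimage κ (Homeomorph.subLeft x)
    rw [this]
    intro t ht
    simpa using hx _ ht
  have hd : ∀ t e, fderiv ℝ φ t e = -fderiv ℝ κ (x - t) e := fun t e => by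
    have h1 : HasFDerivAt κ (fderiv ℝ κ (x - t)) (x - t) :=
      (hκ.differentiable (by simp) _).hasFDerivAt
    have h2 : HasFDerivAt (fun t : E2 => x - t) (-ContinuousLinearMap.id ℝ E2) t :=
      (hasFDerivAt_id t).const_sub x
    have h3 : HasFDerivAt φ _ t := h1.comp t h2
    rw [h3.fderiv]
    simp
  obtain ⟨h1, h2⟩ := h φ hφ hφs hφt
  simp only [hd, mul_neg, integral_neg, neg_inj] at h1 h2
  rw [fderiv_mollify_apply hκ hκs hfi, fderiv_mollify_apply hκ hκs hfi, hind, hind]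
  exact ⟨h1.trans (hind _ _).symm, h2.trans (hind _ _).symm⟩

/-- The first partial derivative. -/
def dx (v : E2 → ℝ) (z : E2) : ℝ := fderiv ℝ v z (1, 0)

/-- The second partial derivative. -/
def dy (v : E2 → ℝ) (z : E2) : ℝ := fderiv ℝ v z (0, 1)

/-- The `ℓ¹` norm of the gradient. -/
def slope1 (v : E2 → ℝ) (z : E2) : ℝ := |dx v z| + |dy v z|

/-- The `ℓ¹` norm of the Hessian. -/
def slope2 (v : E2 → ℝ) (z : E2) : ℝ := slope1 (dx v) z + slope1 (dy v) z

/-- All partial derivatives of orders one and two. -/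
def jet (v : E2 → ℝ) : Fin 6 → E2 → ℝ :=
  ![dx v, dy v, dx (dx v), dy (dx v), dx (dy v), dy (dy v)]

lemma slope1_nonneg (v : E2 → ℝ) (z : E2) : 0 ≤ slope1 v z := by
  unfold slope1; positivity

lemma slope2_nonneg (v : E2 → ℝ) (z : E2) : 0 ≤ slope2 v z :=
  add_nonneg (slope1_nonneg _ _) (slope1_nonneg _ _)

lemma contDiff_dx {v : E2 → ℝ} (hv : ContDiff ℝ (⊤ : ℕ∞) v) : ContDiff ℝ (⊤ : ℕ∞) (dx v) :=
  (hv.fderiv_right (m := (⊤ : ℕ∞)) (by simp)).clm_apply contDiff_const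

lemma contDiff_dy {v : E2 → ℝ} (hv : ContDiff ℝ (⊤ : ℕ∞) v) : ContDiff ℝ (⊤ : ℕ∞) (dy v) :=
  (hv.fderiv_right (m := (⊤ : ℕ∞)) (by simp)).clm_apply contDiff_const

lemma continuous_slope1 {v : E2 → ℝ} (hv : ContDiff ℝ (⊤ : ℕ∞) v) : Continuous (slope1 v) :=
  (contDiff_dx hv).continuous.abs.add (contDiff_dy hv).continuous.abs

lemma continuous_slope2 {v : E2 → ℝ} (hv : ContDiff ℝ (⊤ : ℕ∞) v) : Continuous (slope2 v) :=
  (continuous_slope1 (contDiff_dx hv)).add (continuous_slope1 (contDiff_dy hv))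

lemma continuous_jet {v : E2 → ℝ} (hv : ContDiff ℝ (⊤ : ℕ∞) v) (i : Fin 6) :
    Continuous (jet v i) := by
  have hx := contDiff_dx hv
  have hy := contDiff_dy hv
  fin_cases i
  exacts [hx.continuous, hy.continuous, (contDiff_dx hx).continuous, (contDiff_dy hx).continuous,
    (contDiff_dx hy).continuous, (contDiff_dy hy).continuous]

lemma slope1_add_slope2 (v : E2 → ℝ) (z : E2) : slope1 v z + slope2 v z = ∑ i, |jet v i z| := by
  simp only [Fin.sum_univ_six, slope1, slope2, jet]
  simp only [Matrix.cons_val]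
  ring

lemma dx_sub {v w : E2 → ℝ} (hv : ContDiff ℝ (⊤ : ℕ∞) v) (hw : ContDiff ℝ (⊤ : ℕ∞) w) :
    dx (fun z => v z - w z) = fun z => dx v z - dx w z := by
  ext z
  simp only [dx]
  rw [fderiv_fun_sub (hv.differentiable (by simp) z) (hw.differentiable (by simp) z)]
  simp

lemma dy_sub {v w : E2 → ℝ} (hv : ContDiff ℝ (⊤ : ℕ∞) v) (hw : ContDiff ℝ (⊤ : ℕ∞) w) :
    dy (fun z => v z - w z) = fun z => dy v z - dy w z := by
  ext z
  simp only [dy]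
  rw [fderiv_fun_sub (hv.differentiable (by simp) z) (hw.differentiable (by simp) z)]
  simp

lemma jet_sub {v w : E2 → ℝ} (hv : ContDiff ℝ (⊤ : ℕ∞) v) (hw : ContDiff ℝ (⊤ : ℕ∞) w)
    (i : Fin 6) (z : E2) : jet (fun z => v z - w z) i z = jet v i z - jet w i z := by
  simp only [jet, dx_sub hv hw, dy_sub hv hw, dx_sub (contDiff_dx hv) (contDiff_dx hw),
    dx_sub (contDiff_dy hv) (contDiff_dy hw), dy_sub (contDiff_dx hv) (contDiff_dx hw),
    dy_sub (contDiff_dy hv) (contDiff_dy hw)]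
  fin_cases i <;> rfl

lemma HasSlopeBound.of_contDiff {v : E2 → ℝ} (hv : ContDiff ℝ (⊤ : ℕ∞) v) :
    HasSlopeBound v (slope1 v) := by
  intro z c hc
  have h := (hv.differentiable (by simp) z).hasFDerivAt.isLittleO.def (sub_pos.2 hc)
  filter_upwards [h] with z' hz'
  have h1 : |fderiv ℝ v z (z' - z)| ≤ slope1 v z * dist z' z := by
    have h2 : z' - z = (z' - z).1 • ((1, 0) : E2) + (z' - z).2 • ((0, 1) : E2) := by
      ext <;> simp
    rw [h2, map_add, map_smul, map_smul, smul_eq_mul, smul_eq_mul, slope1, dist_eq_norm, add_mul]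
    refine (abs_add_le _ _).trans (add_le_add ?_ ?_)
    · rw [abs_mul, mul_comm]
      exact mul_le_mul_of_nonneg_left (norm_fst_le (z' - z)) (abs_nonneg _)
    · rw [abs_mul, mul_comm]
      exact mul_le_mul_of_nonneg_left (norm_snd_le (z' - z)) (abs_nonneg _)
  rw [Real.norm_eq_abs, ← dist_eq_norm] at hz'
  have h3 := abs_add_le (v z' - v z - fderiv ℝ v z (z' - z)) (fderiv ℝ v z (z' - z))
  rw [sub_add_cancel] at h3
  nlinarith

lemma HasSlopeBound.abs_add {X : Type*} [PseudoMetricSpace X] {F G k l : X → ℝ}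
    (hF : HasSlopeBound F k) (hG : HasSlopeBound G l) :
    HasSlopeBound (fun z => |F z| + |G z|) (fun z => k z + l z) := by
  intro z c hc
  have hη : 0 < (c - (k z + l z)) / 2 := by linarith
  filter_upwards [hF z (k z + (c - (k z + l z)) / 2) (by linarith),
    hG z (l z + (c - (k z + l z)) / 2) (by linarith)] with z' h1 h2
  have h3 := abs_abs_sub_abs_le (F z') (F z)
  have h4 := abs_abs_sub_abs_le (G z') (G z)
  have h5 := abs_add_le (|F z'| - |F z|) (|G z'| - |G z|)
  have h6 : |F z'| + |G z'| - (|F z| + |G z|) = |F z'| - |F z| + (|G z'| - |G z|) := by ring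
  rw [h6]
  nlinarith

lemma HasSlopeBound.slope1 {v : E2 → ℝ} (hv : ContDiff ℝ (⊤ : ℕ∞) v) :
    HasSlopeBound (slope1 v) (slope2 v) :=
  (HasSlopeBound.of_contDiff (contDiff_dx hv)).abs_add (HasSlopeBound.of_contDiff (contDiff_dy hv))

/-- Every small scale `r` admits a translation `c` of size `< r` moving `W` into the interior of
`Ω`, uniformly. -/
def HasInwardShifts (Ω W : Set E2) : Prop :=
  ∀ r > 0, ∃ c : E2, ‖c‖ < r ∧ ∃ ε > 0, ε < r ∧ ∀ x ∈ W, closedBall (x - c) ε ⊆ Ω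

lemma exists_smooth_approx {Ω W : Set E2} (hΩo : IsOpen Ω) (hΩb : IsBounded Ω) {ψ : E2 → ℝ}
    {g G₁ G₂ : E2 → E2} (hψ : IntegrableOn ψ Ω) (hg : IntegrableOn g Ω)
    (hG₁ : IntegrableOn G₁ Ω) (hG₂ : IntegrableOn G₂ Ω) (h : HasWeakGradOn Ω ψ g)
    (h₁ : HasWeakGradOn Ω (fun x => (g x).1) G₁) (h₂ : HasWeakGradOn Ω (fun x => (g x).2) G₂)
    (hcont : ContinuousOn ψ (closure Ω)) (hWm : MeasurableSet W) (hW : W ⊆ closure Ω)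
    (hin : HasInwardShifts Ω W) :
    ∃ q : Fin 6 → E2 → ℝ, (∀ i, Integrable (q i)) ∧
      ∀ η : ℝ≥0∞, η ≠ 0 → ∀ η' : ℝ, 0 < η' → ∃ φ : E2 → ℝ, ContDiff ℝ (⊤ : ℕ∞) φ ∧
        (∀ x ∈ W, |φ x - ψ x| ≤ η') ∧ ∀ i, ∫⁻ x in W, ‖jet φ i x - q i x‖ₑ ≤ η := by
  set p₁ := Ω.indicator fun y => (g y).1
  set p₂ := Ω.indicator fun y => (g y).2
  set q : Fin 6 → E2 → ℝ := ![p₁, p₂, Ω.indicator fun y => (G₁ y).1,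
    Ω.indicator fun y => (G₁ y).2, Ω.indicator fun y => (G₂ y).1, Ω.indicator fun y => (G₂ y).2]
  have hq : ∀ i, Integrable (q i) := by
    intro i
    have hm := hΩo.measurableSet
    fin_cases i
    exacts [(integrable_indicator_iff hm).2 hg.fst, (integrable_indicator_iff hm).2 hg.snd,
      (integrable_indicator_iff hm).2 hG₁.fst, (integrable_indicator_iff hm).2 hG₁.snd,
      (integrable_indicator_iff hm).2 hG₂.fst, (integrable_indicator_iff hm).2 hG₂.snd]
  refine ⟨q, hq, fun η hη η' hη' => ?_⟩
  choose r hr0 hr using fun i => exists_translate_lintegral_le (hq i) hη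
  obtain ⟨s, hs0, hs⟩ := Metric.uniformContinuousOn_iff.1
    (hΩb.isCompact_closure.uniformContinuousOn_of_continuous hcont) η' hη'
  obtain ⟨ρ, hρ0, hρs, hρr⟩ : ∃ ρ > 0, ρ ≤ s ∧ ∀ i, ρ ≤ r i := by
    obtain ⟨j, hj⟩ := Finite.exists_min r
    exact ⟨min s (r j), lt_min hs0 (hr0 j), min_le_left _ _,
      fun i => (min_le_right _ _).trans (hj i)⟩
  obtain ⟨c, hc, ε, hε0, hερ, hεW⟩ := hin (ρ / 2) (half_pos hρ0)
  let b : ContDiffBump c := ⟨ε / 4, ε / 2, by linarith, by linarith⟩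
  set κ := b.normed volume
  have hκ : ContDiff ℝ (⊤ : ℕ∞) κ := b.contDiff_normed
  have hκs : HasCompactSupport κ := b.hasCompactSupport_normed
  have hκ0 : ∀ t, 0 ≤ κ t := b.nonneg_normed
  have hκi : ∫ t, κ t = 1 := b.integral_normed
  have hκt : tsupport κ = closedBall c (ε / 2) := b.tsupport_normed_eq
  have hmem : ∀ t, κ t ≠ 0 → t ∈ closedBall c (ε / 2) := fun t ht => by
    rw [← hκt]
    exact subset_tsupport _ ht
  have hsmall : ∀ t, κ t ≠ 0 → ‖t‖ < ρ := fun t ht => by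
    have h1 := hmem t ht
    rw [mem_closedBall, dist_eq_norm] at h1
    have h2 := norm_sub_norm_le t c
    linarith
  have hfi : LocallyIntegrable (Ω.indicator ψ) :=
    ((integrable_indicator_iff hΩo.measurableSet).2 hψ).locallyIntegrable
  have hxt : ∀ x ∈ W, ∀ᶠ y in 𝓝 x, ∀ t ∈ tsupport κ, y - t ∈ Ω := by
    intro x hx
    filter_upwards [ball_mem_nhds x (half_pos hε0)] with y hy t ht
    refine hεW x hx ?_
    rw [hκt, mem_closedBall, dist_eq_norm] at ht
    rw [mem_ball, dist_eq_norm] at hy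
    rw [mem_closedBall, dist_eq_norm]
    have h3 : y - t - (x - c) = (y - x) - (t - c) := by abel
    rw [h3]
    exact (norm_sub_le _ _).trans (by linarith)
  have hjet : ∀ x ∈ W, ∀ i, jet (mollify κ (Ω.indicator ψ)) i x = mollify κ (q i) x := by
    intro x hx
    have hex := (hxt x hx).mono fun y hy => (h.fderiv_mollify hΩo hψ hκ hκs hy).1
    have hey := (hxt x hx).mono fun y hy => (h.fderiv_mollify hΩo hψ hκ hκs hy).2
    have hx' := (hxt x hx).self_of_nhds
    have e₁ := h₁.fderiv_mollify hΩo hg.fst hκ hκs hx'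
    have e₂ := h₂.fderiv_mollify hΩo hg.snd hκ hκs hx'
    have d₁ : fderiv ℝ (dx (mollify κ (Ω.indicator ψ))) x = fderiv ℝ (mollify κ p₁) x :=
      Filter.EventuallyEq.fderiv_eq hex
    have d₂ : fderiv ℝ (dy (mollify κ (Ω.indicator ψ))) x = fderiv ℝ (mollify κ p₂) x :=
      Filter.EventuallyEq.fderiv_eq hey
    intro i
    fin_cases i
    · exact hex.self_of_nhds
    · exact hey.self_of_nhds
    · exact (congrArg (· (1, 0)) d₁).trans e₁.1
    · exact (congrArg (· (0, 1)) d₁).trans e₁.2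
    · exact (congrArg (· (1, 0)) d₂).trans e₂.1
    · exact (congrArg (· (0, 1)) d₂).trans e₂.2
  refine ⟨mollify κ (Ω.indicator ψ), contDiff_mollify hκ hκs hfi, fun x hx => ?_, fun i => ?_⟩
  · refine abs_mollify_sub_le hκ.continuous hκs hκi hκ0 hfi fun t ht => ?_
    have h1 : x - t ∈ Ω := (hxt x hx).self_of_nhds t (subset_tsupport _ ht)
    rw [indicator_of_mem h1, ← Real.dist_eq]
    refine (hs _ (subset_closure h1) _ (hW hx) ?_).le
    rw [dist_eq_norm, sub_sub_cancel_left, norm_neg]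
    exact (hsmall t ht).trans_le hρs
  · calc ∫⁻ x in W, ‖jet (mollify κ (Ω.indicator ψ)) i x - q i x‖ₑ
        = ∫⁻ x in W, ‖mollify κ (q i) x - q i x‖ₑ :=
          setLIntegral_congr_fun hWm fun x hx => by simp only [hjet x hx i]
      _ ≤ ∫⁻ x, ‖mollify κ (q i) x - q i x‖ₑ := setLIntegral_le_lintegral _ _
      _ ≤ η := lintegral_mollify_sub_le hκ.continuous hκs hκi hκ0 (hq i) fun t ht =>
          hr i t ((hsmall t ht).trans_le (hρr i))

/-- `ψ` is, on `W`, a uniform limit of smooth functions that all lie within `η` of a fixed smooth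
function in the `W^{2,1}` seminorm. -/
def IsW21Approximable (W : Set E2) (ψ : E2 → ℝ) : Prop :=
  ∀ η : ℝ≥0∞, η ≠ 0 → ∃ φ : E2 → ℝ, ContDiff ℝ (⊤ : ℕ∞) φ ∧ ∀ η' : ℝ, 0 < η' →
    ∃ v : E2 → ℝ, ContDiff ℝ (⊤ : ℕ∞) v ∧ (∀ x ∈ W, |φ x + v x - ψ x| ≤ η') ∧
      (∫⁻ x in W, ENNReal.ofReal (slope1 v x)) + ∫⁻ x in W, ENNReal.ofReal (slope2 v x) ≤ η

lemma isW21Approximable_of_memW21 {Ω W : Set E2} (hΩo : IsOpen Ω) (hΩb : IsBounded Ω)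
    {ψ : E2 → ℝ} {g : E2 → E2} (hψ : MemW21 Ω ψ g)
    (hcont : ContinuousOn ψ (closure Ω)) (hWm : MeasurableSet W) (hW : W ⊆ closure Ω)
    (hin : HasInwardShifts Ω W) : IsW21Approximable W ψ := by
  obtain ⟨hψi, hg, h, G₁, G₂, hG₁, hG₂, h₁, h₂⟩ := hψ
  obtain ⟨q, hq, H⟩ := exists_smooth_approx hΩo hΩb hψi hg hG₁ hG₂ h h₁ h₂ hcont hWm hW hin
  intro η hη
  have hη12 : η / 12 ≠ 0 := by simp [hη]
  obtain ⟨φ, hφ, -, hφq⟩ := H (η / 12) hη12 1 one_pos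
  refine ⟨φ, hφ, fun η' hη' => ?_⟩
  obtain ⟨φ', hφ', hφψ, hφq'⟩ := H (η / 12) hη12 η' hη'
  have hv : ContDiff ℝ (⊤ : ℕ∞) fun x => φ' x - φ x := hφ'.sub hφ
  refine ⟨fun x => φ' x - φ x, hv, fun x hx => by simpa using hφψ x hx, ?_⟩
  have hi : ∀ i, ∫⁻ x in W, ‖jet (fun x => φ' x - φ x) i x‖ₑ ≤ η / 12 + η / 12 := fun i => by
    calc ∫⁻ x in W, ‖jet (fun x => φ' x - φ x) i x‖ₑ
        ≤ ∫⁻ x in W, (‖jet φ' i x - q i x‖ₑ + ‖jet φ i x - q i x‖ₑ) := by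
          refine lintegral_mono fun x => ?_
          rw [jet_sub hφ' hφ, ← sub_sub_sub_cancel_right _ _ (q i x)]
          exact enorm_sub_le
      _ = (∫⁻ x in W, ‖jet φ' i x - q i x‖ₑ) + ∫⁻ x in W, ‖jet φ i x - q i x‖ₑ :=
          lintegral_add_left' ((continuous_jet hφ' i).aemeasurable.sub
            (hq i).1.aemeasurable.restrict).enorm _
      _ ≤ η / 12 + η / 12 := add_le_add (hφq' i) (hφq i)
  rw [← lintegral_add_left (continuous_slope1 hv).measurable.ennreal_ofReal]
  calc ∫⁻ x in W, (ENNReal.ofReal (slope1 (fun x => φ' x - φ x) x) +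
        ENNReal.ofReal (slope2 (fun x => φ' x - φ x) x))
      = ∫⁻ x in W, ∑ i, ‖jet (fun x => φ' x - φ x) i x‖ₑ := by
        refine lintegral_congr fun x => ?_
        rw [← ENNReal.ofReal_add (slope1_nonneg _ _) (slope2_nonneg _ _), slope1_add_slope2,
          ENNReal.ofReal_sum_of_nonneg fun _ _ => abs_nonneg _]
        simp [Real.enorm_eq_ofReal_abs]
    _ = ∑ i, ∫⁻ x in W, ‖jet (fun x => φ' x - φ x) i x‖ₑ :=
        lintegral_finsetSum _ fun i _ => (continuous_jet hv i).measurable.enorm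
    _ ≤ ∑ _i : Fin 6, (η / 12 + η / 12) := Finset.sum_le_sum fun i _ => hi i
    _ = η := by
        rw [Finset.sum_const, Finset.card_univ, Fintype.card_fin, nsmul_eq_mul, ← two_mul,
          ← mul_assoc, show ((6 : ℕ) : ℝ≥0∞) * 2 = 12 by norm_num,
          ENNReal.mul_div_cancel (by norm_num) (by norm_num)]

lemma HasSlopeBound.comp_lipschitzWith {X Y : Type*} [PseudoMetricSpace X] [PseudoMetricSpace Y]
    {F k : X → ℝ} (h : HasSlopeBound F k) (hk : ∀ z, 0 ≤ k z) {Ψ : Y → X} {K : ℝ≥0}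
    (hΨ : LipschitzWith K Ψ) : HasSlopeBound (fun z => F (Ψ z)) (fun z => K * k (Ψ z)) := by
  intro z c hc
  have hK : (0 : ℝ) < K + 1 := by positivity
  have hc0 : 0 < (c - K * k (Ψ z)) / (K + 1) := div_pos (by linarith) hK
  have h1 : (K : ℝ) * (k (Ψ z) + (c - K * k (Ψ z)) / (K + 1)) ≤ c := by
    have h4 : (K : ℝ) * ((c - K * k (Ψ z)) / (K + 1)) ≤ c - K * k (Ψ z) := by
      rw [mul_div_assoc', div_le_iff₀ hK]
      nlinarith
    rw [mul_add]
    linarith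
  filter_upwards [hΨ.continuous.continuousAt.eventually
    (h (Ψ z) (k (Ψ z) + (c - K * k (Ψ z)) / (K + 1)) (by linarith))] with y hy
  calc |F (Ψ y) - F (Ψ z)|
      ≤ (k (Ψ z) + (c - K * k (Ψ z)) / (K + 1)) * dist (Ψ y) (Ψ z) := hy
    _ ≤ (k (Ψ z) + (c - K * k (Ψ z)) / (K + 1)) * (K * dist y z) :=
        mul_le_mul_of_nonneg_left (hΨ.dist_le_mul _ _) (add_nonneg (hk _) hc0.le)
    _ = K * (k (Ψ z) + (c - K * k (Ψ z)) / (K + 1)) * dist y z := by ring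
    _ ≤ c * dist y z := mul_le_mul_of_nonneg_right h1 dist_nonneg

lemma HasSlopeBound.const_mul {X : Type*} [PseudoMetricSpace X] {F k : X → ℝ}
    (h : HasSlopeBound F k) (K : ℝ≥0) :
    HasSlopeBound (fun z => K * F z) (fun z => K * k z) :=
  h.comp (T := fun x => K * x) (χ := fun _ => K)
    (fun x => by simpa using (hasDerivAt_id x).const_mul (K : ℝ)) fun _ => K.coe_nonneg

lemma setLIntegral_comp_le {Ψ : E2 → E2} {K : ℝ≥0} (hc : Continuous Ψ)
    (hΨ : AntilipschitzWith K Ψ) {S : Set E2} {F : E2 → ℝ≥0∞}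
    (hF : Measurable F) : ∫⁻ z in S, F (Ψ z) ≤ (K : ℝ≥0∞) ^ 2 * ∫⁻ z in Ψ '' S, F z := by
  rw [← lintegral_map hF hc.measurable, ← smul_eq_mul, ← lintegral_smul_measure]
  refine lintegral_mono' (Measure.le_iff.2 fun A hA => ?_) le_rfl
  rw [Measure.map_apply hc.measurable hA, Measure.restrict_apply (hc.measurable hA),
    Measure.smul_apply, Measure.restrict_apply hA, smul_eq_mul]
  have h := hΨ.hausdorffMeasure_preimage_le (d := 2) (by norm_num) (A ∩ Ψ '' S)
  rw [hausdorffMeasure_prod_real, ENNReal.rpow_ofNat] at h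
  refine (measure_mono ?_).trans h
  exact fun z hz => ⟨hz.1, mem_image_of_mem _ hz.2⟩

lemma hausdorffContent1_mono {s t : Set E2} (h : s ⊆ t) :
    hausdorffContent1 s ≤ hausdorffContent1 t :=
  le_iInf₂ fun u hu => iInf₂_le u (h.trans hu)

lemma hausdorffContent1_preimage_lt {Ψ : E2 → E2} {K : ℝ≥0} (hK : K ≠ 0)
    (hΨ : AntilipschitzWith K Ψ) {U : Set E2} {δ : ℝ≥0∞} (hU : hausdorffContent1 U < δ) :
    hausdorffContent1 (Ψ ⁻¹' U) < K * δ := by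
  simp only [hausdorffContent1, iInf_lt_iff] at hU
  obtain ⟨t, htU, ht⟩ := hU
  have hcov : Ψ ⁻¹' U ⊆ ⋃ n, Ψ ⁻¹' t n := by
    rw [← preimage_iUnion]
    exact preimage_mono htU
  calc hausdorffContent1 (Ψ ⁻¹' U) ≤ ∑' n, ediam (Ψ ⁻¹' t n) :=
        iInf₂_le (fun n => Ψ ⁻¹' t n) hcov
    _ ≤ ∑' n, K * ediam (t n) := ENNReal.tsum_le_tsum fun n => hΨ.ediam_preimage_le _
    _ = K * ∑' n, ediam (t n) := ENNReal.tsum_mul_left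
    _ < K * δ := ENNReal.mul_lt_mul_right (by simpa using hK) ENNReal.coe_ne_top ht

lemma box_subset_Icc (x y l : ℝ) : box x y l ⊆ Icc x (x + l) ×ˢ Icc y (y + l) :=
  prod_mono Ico_subset_Icc_self Ico_subset_Icc_self

lemma edist_le_of_mem_box {x y l : ℝ} {z w : E2} (hz : z ∈ box x y l) (hw : w ∈ box x y l) :
    edist z w ≤ ENNReal.ofReal l := by
  rw [edist_dist]
  refine ENNReal.ofReal_le_ofReal ?_
  obtain ⟨⟨h1, h2⟩, h3, h4⟩ := hz
  obtain ⟨⟨h5, h6⟩, h7, h8⟩ := hw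
  rw [Prod.dist_eq, Real.dist_eq, Real.dist_eq]
  exact max_le (abs_sub_le_iff.2 ⟨by linarith, by linarith⟩)
    (abs_sub_le_iff.2 ⟨by linarith, by linarith⟩)

lemma IsW21Approximable.sum_ediam_image_le {ψ : E2 → ℝ} {Ψ : E2 → E2} {K : ℝ≥0}
    (hL : LipschitzWith K Ψ) (hA : AntilipschitzWith K Ψ)
    (happ : IsW21Approximable (Ψ '' box 0 0 1) ψ) {η : ℝ≥0} (hη : 0 < η) :
    ∃ M : ℝ≥0, ∀ T : DyadicTree, T.Packed 0 0 1 →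
      T.sum (fun x y l => ediam ((fun z => ψ (Ψ z)) '' box x y l)) 0 0 1 ≤
        2 * η + M * T.mass 0 0 1 := by
  obtain ⟨a, ha0, ha⟩ := ENNReal.exists_nnreal_pos_mul_lt
    (a := 130 * ((K + K * K) * K ^ 2 : ℝ≥0)) (b := η)
    (ENNReal.mul_ne_top (by norm_num) ENNReal.coe_ne_top) (by simpa using hη.ne')
  obtain ⟨φ, hφ, H⟩ := happ a (by simpa using ha0.ne')
  have hcpt : IsCompact (Icc (0 : ℝ) (0 + 1) ×ˢ Icc (0 : ℝ) (0 + 1)) :=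
    isCompact_Icc.prod isCompact_Icc
  obtain ⟨M, hM⟩ := (((hφ.of_le (by exact_mod_cast le_top :
    (1 : WithTop ℕ∞) ≤ (⊤ : ℕ∞))).locallyLipschitz.comp
      hL.locallyLipschitz).locallyLipschitzOn
        (s := Icc (0 : ℝ) (0 + 1) ×ˢ Icc (0 : ℝ) (0 + 1))).exists_lipschitzOnWith_of_compact hcpt
  refine ⟨M, fun T hT => ?_⟩
  obtain ⟨b, hb0, hb⟩ := ENNReal.exists_nnreal_pos_mul_lt
    (a := 2 * T.count) (b := η) (ENNReal.mul_ne_top (by norm_num) T.count_ne_top)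
    (by simpa using hη.ne')
  obtain ⟨v, hv, hvψ, hvi⟩ := H b (NNReal.coe_pos.2 hb0)
  have hpt : ∀ x y l, 0 < l → box x y l ⊆ box 0 0 1 →
      ediam ((fun z => ψ (Ψ z)) '' box x y l) ≤
        ediam ((fun z => v (Ψ z)) '' box x y l) + (M * ENNReal.ofReal l + b * 2 * 1) := by
    intro x y l _ hS
    refine ediam_le ?_
    rintro _ ⟨z, hz, rfl⟩ _ ⟨w, hw, rfl⟩
    have e₁ : edist (v (Ψ z)) (v (Ψ w)) ≤ ediam ((fun z => v (Ψ z)) '' box x y l) :=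
      edist_le_ediam_of_mem ⟨z, hz, rfl⟩ ⟨w, hw, rfl⟩
    have e₂ : edist (φ (Ψ z)) (φ (Ψ w)) ≤ M * ENNReal.ofReal l :=
      (hM (box_subset_Icc _ _ _ (hS hz)) (box_subset_Icc _ _ _ (hS hw))).trans
        (mul_le_mul_right (edist_le_of_mem_box hz hw) _)
    have e₃ : ∀ z ∈ box x y l, edist (ψ (Ψ z)) (φ (Ψ z) + v (Ψ z)) ≤ b := fun z hz => by
      rw [edist_comm, edist_dist, Real.dist_eq]
      exact ENNReal.ofReal_le_of_le_toReal (hvψ _ (mem_image_of_mem _ (hS hz)))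
    calc edist (ψ (Ψ z)) (ψ (Ψ w))
        ≤ edist (ψ (Ψ z)) (φ (Ψ z) + v (Ψ z)) +
            edist (φ (Ψ z) + v (Ψ z)) (φ (Ψ w) + v (Ψ w)) +
            edist (φ (Ψ w) + v (Ψ w)) (ψ (Ψ w)) := edist_triangle4 _ _ _ _
      _ ≤ b + (M * ENNReal.ofReal l + ediam ((fun z => v (Ψ z)) '' box x y l)) + b := by
          gcongr
          · exact e₃ z hz
          · exact (edist_add_add_le _ _ _ _).trans (add_le_add e₂ e₁)
          · rw [edist_comm]
            exact e₃ w hw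
      _ = _ := by ring
  have hsum : T.sum (fun x y l => ediam ((fun z => v (Ψ z)) '' box x y l)) 0 0 1 ≤ η := by
    have h0 := HasSlopeBound.of_contDiff hv
    have h1 := HasSlopeBound.slope1 hv
    have hm1 : Measurable fun z => ENNReal.ofReal (slope1 v z) :=
      (continuous_slope1 hv).measurable.ennreal_ofReal
    have hm2 : Measurable fun z => ENNReal.ofReal (slope2 v z) :=
      (continuous_slope2 hv).measurable.ennreal_ofReal
    have hk : Continuous fun z => (K : ℝ) * (K * slope2 v (Ψ z)) :=
      ((continuous_slope2 hv).comp hL.continuous).const_mul (K : ℝ) |>.const_mul (K : ℝ)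
    have i₁ : ∫⁻ z in box 0 0 1, ENNReal.ofReal (K * slope1 v (Ψ z)) ≤
        K * (K ^ 2 * ∫⁻ z in Ψ '' box 0 0 1, ENNReal.ofReal (slope1 v z)) := by
      simp_rw [ENNReal.ofReal_mul K.coe_nonneg, ENNReal.ofReal_coe_nnreal]
      rw [lintegral_const_mul' _ _ ENNReal.coe_ne_top]
      gcongr
      exact setLIntegral_comp_le hL.continuous hA hm1
    have i₂ : ∫⁻ z in box 0 0 1, ENNReal.ofReal (K * (K * slope2 v (Ψ z))) ≤
        K * (K * (K ^ 2 * ∫⁻ z in Ψ '' box 0 0 1, ENNReal.ofReal (slope2 v z))) := by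
      simp_rw [ENNReal.ofReal_mul K.coe_nonneg, ENNReal.ofReal_coe_nnreal]
      rw [lintegral_const_mul' _ _ ENNReal.coe_ne_top, lintegral_const_mul' _ _ ENNReal.coe_ne_top]
      gcongr
      exact setLIntegral_comp_le hL.continuous hA hm2
    set I₁ := ∫⁻ z in Ψ '' box 0 0 1, ENNReal.ofReal (slope1 v z)
    set I₂ := ∫⁻ z in Ψ '' box 0 0 1, ENNReal.ofReal (slope2 v z)
    calc T.sum (fun x y l => ediam ((fun z => v (Ψ z)) '' box x y l)) 0 0 1
        ≤ 130 * ((∫⁻ z in box 0 0 1, ENNReal.ofReal (K * slope1 v (Ψ z))) +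
            ∫⁻ z in box 0 0 1, ENNReal.ofReal (K * (K * slope2 v (Ψ z)))) :=
          DyadicTree.sum_ediam_image_le (h0.comp_lipschitzWith (slope1_nonneg v) hL)
            ((h1.comp_lipschitzWith (slope2_nonneg v) hL).const_mul K) hk
            (fun z => mul_nonneg K.coe_nonneg (slope1_nonneg _ _))
            (fun z => mul_nonneg K.coe_nonneg (mul_nonneg K.coe_nonneg (slope2_nonneg _ _))) T hT
      _ ≤ 130 * (K * (K ^ 2 * I₁) + K * (K * (K ^ 2 * I₂))) := by gcongr
      _ ≤ 130 * ((K + K * K) * K ^ 2 * (I₁ + I₂)) := by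
          gcongr
          calc (K : ℝ≥0∞) * (K ^ 2 * I₁) + K * (K * (K ^ 2 * I₂))
              ≤ K * (K ^ 2 * I₁) + K * (K * (K ^ 2 * I₂)) +
                (K * (K ^ 2 * I₂) + K * (K * (K ^ 2 * I₁))) := le_self_add
            _ = (K + K * K) * K ^ 2 * (I₁ + I₂) := by ring
      _ ≤ 130 * ((K + K * K) * K ^ 2 * a) := by gcongr
      _ = a * (130 * ((K + K * K) * K ^ 2 : ℝ≥0)) := by push_cast; ring
      _ ≤ η := ha.le
  calc T.sum (fun x y l => ediam ((fun z => ψ (Ψ z)) '' box x y l)) 0 0 1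
      ≤ T.sum (fun x y l => ediam ((fun z => v (Ψ z)) '' box x y l) +
          (M * ENNReal.ofReal l + b * 2 * 1)) 0 0 1 :=
        T.sum_mono_of_subset one_pos subset_rfl hpt
    _ = T.sum (fun x y l => ediam ((fun z => v (Ψ z)) '' box x y l)) 0 0 1 +
          (M * T.mass 0 0 1 + b * 2 * T.count) := by
        rw [T.sum_add, T.sum_add, T.sum_const_mul, T.sum_const_mul, T.sum_one, DyadicTree.mass]
    _ ≤ η + (M * T.mass 0 0 1 + η) := by
        gcongr
        rw [mul_assoc]
        exact hb.le
    _ = 2 * η + M * T.mass 0 0 1 := by ring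

/-- The images under `ψ` of subsets of `s` with small content have small `H¹`-measure. -/
def HasLuzinN (ψ : E2 → ℝ) (s : Set E2) : Prop :=
  ∀ ε : ℝ≥0∞, 0 < ε → ∃ δ : ℝ≥0∞, 0 < δ ∧
    ∀ U ⊆ s, hausdorffContent1 U < δ → μH[1] (ψ '' U) < ε

lemma IsW21Approximable.hasLuzinN {ψ : E2 → ℝ} {Ψ : E2 → E2} {K : ℝ≥0} (hK : K ≠ 0)
    (hL : LipschitzWith K Ψ) (hA : AntilipschitzWith K Ψ)
    (happ : IsW21Approximable (Ψ '' box 0 0 1) ψ) : HasLuzinN ψ (Ψ '' box 0 0 1) := by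
  intro ε hε
  obtain ⟨η, hη0, hη⟩ := ENNReal.exists_nnreal_pos_mul_lt (a := 3) (by norm_num) hε.ne'
  obtain ⟨M, hM⟩ := happ.sum_ediam_image_le hL hA hη0
  obtain ⟨δ, hδ0, hδ⟩ := ENNReal.exists_nnreal_pos_mul_lt (a := M * (32 * K)) (b := η)
    (by finiteness) (by simpa using hη0.ne')
  refine ⟨δ, by simpa using hδ0, fun U hU hUδ => ?_⟩
  have himg : ψ '' U ⊆ (fun z => ψ (Ψ z)) '' (Ψ ⁻¹' U ∩ box 0 0 1) := by
    rintro _ ⟨w, hw, rfl⟩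
    obtain ⟨z, hz, rfl⟩ := hU hw
    exact ⟨z, ⟨hw, hz⟩, rfl⟩
  have hcon : hausdorffContent1 (Ψ ⁻¹' U ∩ box 0 0 1) < K * δ :=
    (hausdorffContent1_mono inter_subset_left).trans_lt (hausdorffContent1_preimage_lt hK hA hUδ)
  rw [hausdorffMeasure_real]
  refine lt_of_le_of_lt ((measure_mono himg).trans
    (DyadicTree.volume_image_le inter_subset_right hcon fun T hT hTm => ?_)) hη
  calc T.sum (fun x y l => ediam ((fun z => ψ (Ψ z)) '' box x y l)) 0 0 1
      ≤ 2 * η + M * T.mass 0 0 1 := hM T hT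
    _ ≤ 2 * η + M * (32 * (K * δ)) := by gcongr
    _ = 2 * η + δ * (M * (32 * K)) := by ring
    _ ≤ 2 * η + η := by gcongr
    _ = η * 3 := by ring

/-- Parametrization by the unit square of the region of height `ρ` below the graph of `f` over the
interval of radius `ρ` around `p`, in the linear coordinates given by `A`. -/
def graphChart (A : E2 ≃L[ℝ] E2) (f : ℝ → ℝ) (p ρ : ℝ) (z : E2) : E2 :=
  A.symm (p + ρ * (2 * z.1 - 1), f (p + ρ * (2 * z.1 - 1)) - ρ * z.2)

lemma mem_image_graphChart {A : E2 ≃L[ℝ] E2} {f : ℝ → ℝ} {p ρ : ℝ} (hρ : 0 < ρ) {y : E2}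
    (h1 : |(A y).1 - p| < ρ) (h2 : (A y).2 ≤ f (A y).1) (h3 : f (A y).1 - (A y).2 < ρ) :
    y ∈ graphChart A f p ρ '' box 0 0 1 := by
  rw [abs_lt] at h1
  refine ⟨((((A y).1 - p) / ρ + 1) / 2, (f (A y).1 - (A y).2) / ρ), ⟨⟨?_, ?_⟩, ?_, ?_⟩, ?_⟩
  · have : -1 < ((A y).1 - p) / ρ := by rw [lt_div_iff₀ hρ]; linarith
    simp only
    linarith
  · have : ((A y).1 - p) / ρ < 1 := by rw [div_lt_iff₀ hρ]; linarith
    simp only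
    linarith
  · exact div_nonneg (sub_nonneg.2 h2) hρ.le
  · simp only [zero_add]
    rw [div_lt_iff₀ hρ]
    linarith
  · have e1 : p + ρ * (2 * ((((A y).1 - p) / ρ + 1) / 2) - 1) = (A y).1 := by
      field_simp
      ring
    have e2 : ρ * ((f (A y).1 - (A y).2) / ρ) = f (A y).1 - (A y).2 := by field_simp
    rw [graphChart, A.symm_apply_eq]
    refine Prod.ext e1 ?_
    simp only [e1, e2]
    ring

lemma lipschitzWith_graphChart (A : E2 ≃L[ℝ] E2) {f : ℝ → ℝ} {L : ℝ≥0} (hf : LipschitzWith L f)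
    (p : ℝ) {ρ : ℝ} (hρ : 0 < ρ) : ∃ K, LipschitzWith K (graphChart A f p ρ) := by
  refine ⟨_, A.symm.lipschitz.comp (LipschitzWith.of_dist_le_mul
    (K := .mk (ρ * (3 + 2 * L)) (by positivity)) fun z w => ?_)⟩
  have h1 : |z.1 - w.1| ≤ dist z w := norm_fst_le (z - w) |>.trans_eq (dist_eq_norm _ _).symm
  have h2 : |z.2 - w.2| ≤ dist z w := norm_snd_le (z - w) |>.trans_eq (dist_eq_norm _ _).symm
  have h3 := hf.dist_le_mul (p + ρ * (2 * z.1 - 1)) (p + ρ * (2 * w.1 - 1))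
  have e1 : p + ρ * (2 * z.1 - 1) - (p + ρ * (2 * w.1 - 1)) = 2 * ρ * (z.1 - w.1) := by ring
  have hL : (0 : ℝ) ≤ L := L.coe_nonneg
  have hd : 0 ≤ dist z w := dist_nonneg
  rw [Real.dist_eq, Real.dist_eq, e1, abs_mul, abs_of_pos (by positivity : 0 < 2 * ρ)] at h3
  have h1' : ρ * |z.1 - w.1| ≤ ρ * dist z w := by gcongr
  have h2' : ρ * |z.2 - w.2| ≤ ρ * dist z w := by gcongr
  have h1L : (L : ℝ) * (ρ * |z.1 - w.1|) ≤ L * (ρ * dist z w) := by gcongr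
  have hLd : 0 ≤ (L : ℝ) * (ρ * dist z w) := by positivity
  have hρd : 0 ≤ ρ * dist z w := by positivity
  rw [Prod.dist_eq, Real.dist_eq, Real.dist_eq]
  refine max_le ?_ ?_
  · simp only [e1, NNReal.coe_mk]
    rw [abs_mul, abs_of_pos (by positivity : 0 < 2 * ρ)]
    nlinarith
  · simp only [NNReal.coe_mk]
    have e2 : f (p + ρ * (2 * z.1 - 1)) - ρ * z.2 - (f (p + ρ * (2 * w.1 - 1)) - ρ * w.2) =
      f (p + ρ * (2 * z.1 - 1)) - f (p + ρ * (2 * w.1 - 1)) + -(ρ * (z.2 - w.2)) := by ring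
    rw [e2]
    refine (abs_add_le _ _).trans ?_
    rw [abs_neg, abs_mul, abs_of_pos hρ]
    nlinarith

lemma antilipschitzWith_graphChart (A : E2 ≃L[ℝ] E2) {f : ℝ → ℝ} {L : ℝ≥0}
    (hf : LipschitzWith L f) (p : ℝ) {ρ : ℝ} (hρ : 0 < ρ) :
    ∃ K, AntilipschitzWith K (graphChart A f p ρ) := by
  refine ⟨_, A.symm.antilipschitz.comp (AntilipschitzWith.of_le_mul_dist
    (K := .mk ((1 + L) / ρ) (by positivity))
    (f := fun z : E2 => (p + ρ * (2 * z.1 - 1), f (p + ρ * (2 * z.1 - 1)) - ρ * z.2))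
    fun z w => ?_)⟩
  set P : E2 := (p + ρ * (2 * z.1 - 1), f (p + ρ * (2 * z.1 - 1)) - ρ * z.2) with hP
  set Q : E2 := (p + ρ * (2 * w.1 - 1), f (p + ρ * (2 * w.1 - 1)) - ρ * w.2) with hQ
  have h1 : |P.1 - Q.1| ≤ dist P Q := norm_fst_le (P - Q) |>.trans_eq (dist_eq_norm _ _).symm
  have h2 : |P.2 - Q.2| ≤ dist P Q := norm_snd_le (P - Q) |>.trans_eq (dist_eq_norm _ _).symm
  have h3 := hf.dist_le_mul P.1 Q.1
  have hL : (0 : ℝ) ≤ L := L.coe_nonneg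
  have hd : 0 ≤ dist P Q := dist_nonneg
  rw [Real.dist_eq, Real.dist_eq] at h3
  have e1 : 2 * ρ * (z.1 - w.1) = P.1 - Q.1 := by simp only [hP, hQ]; ring
  have e2 : ρ * (z.2 - w.2) = f P.1 - f Q.1 + -(P.2 - Q.2) := by simp only [hP, hQ]; ring
  have hLd : (L : ℝ) * |P.1 - Q.1| ≤ L * dist P Q := by gcongr
  have hLd0 : 0 ≤ (L : ℝ) * dist P Q := by positivity
  rw [Prod.dist_eq, Real.dist_eq, Real.dist_eq, NNReal.coe_mk, div_mul_eq_mul_div,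
    le_div_iff₀ hρ]
  rw [max_mul_of_nonneg _ _ hρ.le]
  refine max_le ?_ ?_
  · have := congrArg abs e1
    rw [abs_mul, abs_of_pos (by positivity : 0 < 2 * ρ)] at this
    have h5 : 0 ≤ |z.1 - w.1| * ρ := by positivity
    nlinarith
  · have := congrArg abs e2
    rw [abs_mul, abs_of_pos hρ] at this
    have h6 := abs_add_le (f P.1 - f Q.1) (-(P.2 - Q.2))
    rw [abs_neg] at h6
    nlinarith

lemma hasLuzinN_image_graphChart {Ω : Set E2} (hΩo : IsOpen Ω) (hΩb : IsBounded Ω)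
    {ψ : E2 → ℝ} {g : E2 → E2} (hψ : MemW21 Ω ψ g) (hcont : ContinuousOn ψ (closure Ω))
    (A : E2 ≃L[ℝ] E2) {f : ℝ → ℝ} {L : ℝ≥0} (hf : LipschitzWith L f) (p : ℝ) {ρ : ℝ} (hρ : 0 < ρ)
    (hsub : graphChart A f p ρ '' box 0 0 1 ⊆ closure Ω)
    (hin : HasInwardShifts Ω (graphChart A f p ρ '' box 0 0 1)) :
    HasLuzinN ψ (graphChart A f p ρ '' box 0 0 1) := by
  obtain ⟨K₁, h₁⟩ := lipschitzWith_graphChart A hf p hρ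
  obtain ⟨K₂, h₂⟩ := antilipschitzWith_graphChart A hf p hρ
  refine IsW21Approximable.hasLuzinN (K := max (max K₁ K₂) 1) (by positivity)
    (h₁.weaken ((le_max_left _ _).trans (le_max_left _ _))) (fun z w => (h₂ z w).trans ?_)
    (isW21Approximable_of_memW21 hΩo hΩb hψ hcont ?_ hsub hin)
  · gcongr
    exact (le_max_right _ _).trans (le_max_left _ _)
  · exact (measurableSet_box _ _ _).image_of_continuousOn_injOn h₁.continuous.continuousOn
      h₂.injective.injOn

lemma HasLuzinN.mono {ψ : E2 → ℝ} {s t : Set E2} (h : s ⊆ t) (ht : HasLuzinN ψ t) :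
    HasLuzinN ψ s := fun ε hε =>
  let ⟨δ, hδ, H⟩ := ht ε hε
  ⟨δ, hδ, fun U hU => H U (hU.trans h)⟩

lemma HasLuzinN.union {ψ : E2 → ℝ} {s t : Set E2} (hs : HasLuzinN ψ s) (ht : HasLuzinN ψ t) :
    HasLuzinN ψ (s ∪ t) := by
  intro ε hε
  obtain ⟨δ₁, hδ₁, H₁⟩ := hs (ε / 2) (ENNReal.half_pos hε.ne')
  obtain ⟨δ₂, hδ₂, H₂⟩ := ht (ε / 2) (ENNReal.half_pos hε.ne')
  refine ⟨min δ₁ δ₂, lt_min hδ₁ hδ₂, fun U hU hUδ => ?_⟩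
  have h₁ := H₁ (U ∩ s) inter_subset_right <|
    (hausdorffContent1_mono inter_subset_left).trans_lt (hUδ.trans_le (min_le_left _ _))
  have h₂ := H₂ (U ∩ t) inter_subset_right <|
    (hausdorffContent1_mono inter_subset_left).trans_lt (hUδ.trans_le (min_le_right _ _))
  have h : ψ '' U = ψ '' (U ∩ s) ∪ ψ '' (U ∩ t) := by
    rw [← image_union, ← inter_union_distrib_left, inter_eq_left.2 hU]
  calc μH[1] (ψ '' U) ≤ μH[1] (ψ '' (U ∩ s)) + μH[1] (ψ '' (U ∩ t)) := by
        rw [h]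
        exact measure_union_le _ _
    _ < ε / 2 + ε / 2 := ENNReal.add_lt_add h₁ h₂
    _ = ε := ENNReal.add_halves ε

lemma exists_mem_nhds_hasLuzinN_of_mem {Ω : Set E2} (hΩo : IsOpen Ω) (hΩb : IsBounded Ω)
    {ψ : E2 → ℝ} {g : E2 → E2} (hψ : MemW21 Ω ψ g) (hcont : ContinuousOn ψ (closure Ω))
    {x : E2} (hx : x ∈ Ω) : ∃ t ∈ 𝓝[closure Ω] x, HasLuzinN ψ t := by
  obtain ⟨R, hR0, hR⟩ := Metric.nhds_basis_closedBall.mem_iff.1 (hΩo.mem_nhds hx)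
  set ρ := R / 2
  have hρ : 0 < ρ := half_pos hR0
  set A := ContinuousLinearEquiv.refl ℝ E2
  set W := graphChart A (fun _ => x.2 + ρ / 2) x.1 ρ '' box 0 0 1
  have hW : W ⊆ closedBall x ρ := by
    rintro _ ⟨z, ⟨⟨h1, h2⟩, h3, h4⟩, rfl⟩
    rw [mem_closedBall, Prod.dist_eq, Real.dist_eq, Real.dist_eq]
    change max |x.1 + ρ * (2 * z.1 - 1) - x.1| |x.2 + ρ / 2 - ρ * z.2 - x.2| ≤ ρ
    exact max_le (abs_le.2 ⟨by nlinarith, by nlinarith⟩) (abs_le.2 ⟨by nlinarith, by nlinarith⟩)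
  refine ⟨W, mem_nhdsWithin_of_mem_nhds ?_, hasLuzinN_image_graphChart hΩo hΩb hψ hcont A
    (LipschitzWith.const' (K := 0) _) _ hρ ?_ fun r hr => ?_⟩
  · filter_upwards [ball_mem_nhds x (half_pos hρ)] with y hy
    rw [mem_ball, Prod.dist_eq, Real.dist_eq, Real.dist_eq, max_lt_iff, abs_lt, abs_lt] at hy
    obtain ⟨⟨h1, h2⟩, h3, h4⟩ := hy
    refine mem_image_graphChart hρ ?_ ?_ ?_
    · change |y.1 - x.1| < ρ
      exact abs_lt.2 ⟨by linarith, by linarith⟩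
    · change y.2 ≤ x.2 + ρ / 2
      linarith
    · change x.2 + ρ / 2 - y.2 < ρ
      linarith
  · exact (hW.trans (closedBall_subset_closedBall (half_le_self hR0.le))).trans
      (hR.trans subset_closure)
  · refine ⟨0, by simpa using hr, min (r / 2) ρ, lt_min (half_pos hr) hρ,
      (min_le_left _ _).trans_lt (half_lt_self hr), fun y hy => ?_⟩
    rw [sub_zero]
    refine (closedBall_subset_closedBall' ?_).trans hR
    have := mem_closedBall.1 (hW hy)
    have := min_le_right (r / 2) ρ
    simp only [ρ] at *
    linarith

lemma exists_mem_nhds_hasLuzinN_of_mem_frontier {Ω : Set E2} (hΩo : IsOpen Ω) (hΩb : IsBounded Ω)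
    (hΩlip : HasLipschitzBoundary Ω) {ψ : E2 → ℝ} {g : E2 → E2} (hψ : MemW21 Ω ψ g)
    (hcont : ContinuousOn ψ (closure Ω)) {x : E2} (hx : x ∈ frontier Ω) :
    ∃ t ∈ 𝓝[closure Ω] x, HasLuzinN ψ t := by
  obtain ⟨U, hU, L, f, A, hf, hΩU, hfU⟩ := hΩlip x hx
  have hxf : (A x).2 = f (A x).1 := (hfU.subset ⟨hx, mem_of_mem_nhds hU⟩).2
  obtain ⟨R, hR0, hR⟩ := Metric.mem_nhds_iff.1 hU
  have hL : (0 : ℝ) ≤ L := L.coe_nonneg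
  set p := (A x).1
  set B : E2 →L[ℝ] E2 := A.symm.toContinuousLinearMap
  obtain ⟨ρ, hρ, hρR⟩ := exists_pos_mul_lt (half_pos hR0) (‖B‖ * (2 + L))
  set W := graphChart A f p ρ '' box 0 0 1
  have hWball : W ⊆ closedBall x (R / 2) := by
    rintro _ ⟨z, ⟨⟨h1, h2⟩, h3, h4⟩, rfl⟩
    rw [zero_add] at h2 h4
    have e : graphChart A f p ρ z - x =
        B (ρ * (2 * z.1 - 1), f (p + ρ * (2 * z.1 - 1)) - f p - ρ * z.2) := by
      have : x = B (p, f p) := by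
        rw [← hxf]
        simp [B, p]
      conv_lhs => rw [this]
      change B _ - B _ = _
      rw [← map_sub]
      congr 1
      ext <;> simp
      ring
    rw [mem_closedBall, dist_eq_norm, e]
    refine (B.le_opNorm _).trans (le_trans ?_ hρR.le)
    rw [mul_assoc]
    gcongr
    have h5 : |ρ * (2 * z.1 - 1)| ≤ ρ := abs_le.2 ⟨by nlinarith, by nlinarith⟩
    have h6 : |f (p + ρ * (2 * z.1 - 1)) - f p| ≤ L * ρ := by
      have := hf.dist_le_mul (p + ρ * (2 * z.1 - 1)) p
      rw [Real.dist_eq, Real.dist_eq, add_sub_cancel_left] at this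
      exact this.trans (by gcongr)
    rw [Prod.norm_def]
    refine max_le ?_ ?_
    · refine h5.trans ?_
      nlinarith
    · refine (abs_sub _ _).trans ?_
      rw [abs_of_nonneg (mul_nonneg hρ.le h3)]
      nlinarith
  have hWgraph : ∀ y ∈ W, (A y).2 ≤ f (A y).1 := by
    rintro _ ⟨z, ⟨-, h3, -⟩, rfl⟩
    simp only [graphChart, ContinuousLinearEquiv.apply_symm_apply]
    have := mul_nonneg hρ.le h3
    linarith
  have hWΩ : W ⊆ closure Ω := fun y hy => by
    have hyU : y ∈ U := hR (closedBall_subset_ball (half_lt_self hR0) (hWball hy))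
    rcases (hWgraph y hy).lt_or_eq with h | h
    · exact subset_closure (hΩU.symm.subset ⟨hyU, h⟩).1
    · exact frontier_subset_closure (hfU.symm.subset ⟨hyU, h⟩).1
  refine ⟨W, ?_, hasLuzinN_image_graphChart hΩo hΩb hψ hcont A hf p hρ hWΩ fun r hr => ?_⟩
  · have hc1 : Continuous fun y => |(A y).1 - p| := by fun_prop
    have hc2 : Continuous fun y => f (A y).1 - (A y).2 :=
      (hf.continuous.comp (continuous_fst.comp A.continuous)).sub
        (continuous_snd.comp A.continuous)
    have n1 : ∀ᶠ y in 𝓝 x, |(A y).1 - p| < ρ :=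
      hc1.continuousAt.eventually (gt_mem_nhds (by simpa [p] using hρ))
    have n2 : ∀ᶠ y in 𝓝 x, f (A y).1 - (A y).2 < ρ :=
      hc2.continuousAt.eventually (gt_mem_nhds ((sub_eq_zero.2 hxf.symm).trans_lt hρ))
    filter_upwards [mem_nhdsWithin_of_mem_nhds hU, mem_nhdsWithin_of_mem_nhds n1,
      mem_nhdsWithin_of_mem_nhds n2, self_mem_nhdsWithin] with y hyU h1 h2 hy
    refine mem_image_graphChart hρ h1 ?_ h2
    rw [closure_eq_self_union_frontier] at hy
    rcases hy with hy | hy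
    · exact (hΩU.subset ⟨hy, hyU⟩).2.le
    · exact (hfU.subset ⟨hy, hyU⟩).2.le
  · obtain ⟨τ, hτ, hτr⟩ := exists_pos_mul_lt (lt_min hr (by linarith : 0 < R / 4)) ‖B (0, 1)‖
    obtain ⟨ε, hε, hετ⟩ := exists_pos_mul_lt hτ ((1 + L) * ‖(A : E2 →L[ℝ] E2)‖)
    have hcn : ‖τ • B (0, 1)‖ < min r (R / 4) := by
      rwa [norm_smul, Real.norm_of_nonneg hτ.le, mul_comm]
    have hm : 0 < min (r / 2) (R / 4) := lt_min (half_pos hr) (by linarith)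
    refine ⟨τ • B (0, 1), hcn.trans_le (min_le_left _ _), min ε (min (r / 2) (R / 4)),
      lt_min hε hm, ?_, fun w hw v hv => ?_⟩
    · exact ((min_le_right _ _).trans (min_le_left _ _)).trans_lt (half_lt_self hr)
    rw [mem_closedBall, dist_eq_norm] at hv
    set Δ := v - (w - τ • B (0, 1))
    have hvΔ : v - x = (w - x) - τ • B (0, 1) + Δ := by simp only [Δ]; abel
    have hwx : ‖w - x‖ ≤ R / 2 := by rw [← dist_eq_norm]; exact hWball hw
    have hvU : v ∈ U := hR <| by
      rw [mem_ball, dist_eq_norm, hvΔ]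
      have h1 := norm_add_le (w - x - τ • B (0, 1)) Δ
      have h2 := norm_sub_le (w - x) (τ • B (0, 1))
      have h3 := hcn.trans_le (min_le_right _ _)
      have h4 := hv.trans ((min_le_right _ _).trans (min_le_right _ _))
      linarith
    refine (hΩU.symm.subset ⟨hvU, ?_⟩).1
    have hAv : A v = A w - (0, τ) + A Δ := by
      have : v = w - τ • B (0, 1) + Δ := by simp only [Δ]; abel
      rw [this, map_add, map_sub, map_smul]
      simp [B]
    have hAΔ : ‖A Δ‖ ≤ ‖(A : E2 →L[ℝ] E2)‖ * ε :=
      ((A : E2 →L[ℝ] E2).le_opNorm Δ).trans (by gcongr; exact hv.trans (min_le_left _ _))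
    have h1 : |(A Δ).1| ≤ ‖A Δ‖ := norm_fst_le (A Δ)
    have h2 : (A Δ).2 ≤ ‖A Δ‖ := (le_abs_self _).trans (norm_snd_le (A Δ))
    have h3 := hf.dist_le_mul (A w).1 (A v).1
    have h4 : (A w).1 - (A v).1 = -(A Δ).1 := by rw [hAv]; simp
    have h5 : (A v).2 = (A w).2 - τ + (A Δ).2 := by rw [hAv]; simp
    rw [Real.dist_eq, Real.dist_eq, h4, abs_neg] at h3
    have h6 := (le_abs_self _).trans h3
    have h7 : (L : ℝ) * |(A Δ).1| ≤ L * (‖(A : E2 →L[ℝ] E2)‖ * ε) := by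
      gcongr
      exact h1.trans hAΔ
    have h8 := hWgraph w hw
    rw [h5]
    nlinarith

/-- Luzin N-property with respect to Hausdorff content for `W^{2,1}` functions in the plane:
images of sets of small `H¹`-content have small `H¹`-measure. -/
theorem luzin_N_W21
    (Ω : Set E2) (hΩo : IsOpen Ω) (hΩb : IsBounded Ω) (hΩc : IsConnected Ω)
    (hΩlip : HasLipschitzBoundary Ω)
    (ψ : E2 → ℝ) (g : E2 → E2) (hW : MemW21 Ω ψ g)
    (hcont : ContinuousOn ψ (closure Ω)) :
    ∀ ε : ℝ≥0∞, 0 < ε → ∃ δ : ℝ≥0∞, 0 < δ ∧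
      ∀ U ⊆ closure Ω, hausdorffContent1 U < δ → μH[1] (ψ '' U) < ε := by
  change HasLuzinN ψ (closure Ω)
  refine hΩb.isCompact_closure.induction_on ?_ (fun _ _ h => HasLuzinN.mono h)
    (fun _ _ => HasLuzinN.union) fun x hx => ?_
  · refine fun ε hε => ⟨1, one_pos, fun U hU _ => ?_⟩
    rw [subset_empty_iff.1 hU]
    simpa using hε
  · rw [closure_eq_self_union_frontier] at hx
    rcases hx with hx | hx
    · exact exists_mem_nhds_hasLuzinN_of_mem hΩo hΩb hW hcont hx
    · exact exists_mem_nhds_hasLuzinN_of_mem_frontier hΩo hΩb hΩlip hW hcont hx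
end
end

section
/- Let Q = [0,1]² and f : Q → ℝ continuous. For any two distinct elements A, B of the Kronrod tree T_f (the space of connected components of level sets of f), there exists an injective map φ : [0,1] → T_f with φ(0) = A, φ(1) = B, such that φ is continuous in the sense that for every t₀ ∈ [0,1], sup_{x ∈ φ(t)} dist(x, φ(t₀)) → 0 as t → t₀, and for every t ∈ (0,1), the sets A and B lie in different connected components of Q \ φ(t). -/
open Set Metric

noncomputable section

/-- The unit square `Q = [0,1]²`. -/
def Q : Set (ℝ × ℝ) := Icc ((0, 0) : ℝ × ℝ) (1, 1)

/-- `C` is an element of the Kronrod tree `T_f`: a connected component of a level set of `f`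
in `Q`. -/
def IsLevelComp (f : ℝ × ℝ → ℝ) (C : Set (ℝ × ℝ)) : Prop :=
  ∃ x₀ ∈ Q, C = connectedComponentIn {x ∈ Q | f x = f x₀} x₀

open Topology

/-- `C` separates `x` from `y`: every preconnected set containing both points meets `C`. -/
def Separates {X : Type*} [TopologicalSpace X] (C : Set X) (x y : X) : Prop :=
  ∀ G : Set X, IsPreconnected G → x ∈ G → y ∈ G → (G ∩ C).Nonempty

section Separation

variable {X : Type*} [TopologicalSpace X]

lemma Separates.symm {C : Set X} {x y : X} (h : Separates C x y) : Separates C y x :=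
  fun G hG hy hx => h G hG hx hy

lemma Separates.mono {C D : Set X} {x y : X} (h : Separates C x y) (hCD : C ⊆ D) :
    Separates D x y :=
  fun G hG hx hy => (h G hG hx hy).mono (inter_subset_inter_right _ hCD)

lemma Separates.disjoint {C : Set X} {x y : X} (h : Separates C x y) :
    Disjoint (connectedComponentIn Cᶜ x) (connectedComponentIn Cᶜ y) := by
  rw [Set.disjoint_left]
  intro z hx hy
  have hxm : x ∈ Cᶜ := by
    by_contra hc
    rw [connectedComponentIn_eq_empty hc] at hx
    exact hx
  have hym : y ∈ Cᶜ := by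
    by_contra hc
    rw [connectedComponentIn_eq_empty hc] at hy
    exact hy
  obtain ⟨w, hw, hwC⟩ := h (connectedComponentIn Cᶜ x ∪ connectedComponentIn Cᶜ y)
    (IsPreconnected.union z hx hy isPreconnected_connectedComponentIn
      isPreconnected_connectedComponentIn)
    (Or.inl (mem_connectedComponentIn hxm)) (Or.inr (mem_connectedComponentIn hym))
  rcases hw with hw | hw
  · exact connectedComponentIn_subset _ _ hw hwC
  · exact connectedComponentIn_subset _ _ hw hwC

/-- A preconnected set that meets a component of the complement of `C` and avoids `C` lies in that
component. -/
lemma IsPreconnected.subset_connectedComponentIn_of_mem {F G : Set X} {a z : X}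
    (hG : IsPreconnected G) (hz : z ∈ G) (hza : z ∈ _root_.connectedComponentIn F a) (hGF : G ⊆ F) :
    G ⊆ _root_.connectedComponentIn F a := by
  rw [connectedComponentIn_eq hza]
  exact hG.subset_connectedComponentIn hz hGF

lemma closure_connectedComponentIn_inter_subset {F : Set X} {a : X} (ha : a ∈ F) :
    closure (connectedComponentIn F a) ∩ F ⊆ connectedComponentIn F a := by
  rintro z ⟨hz, hzF⟩
  refine (isPreconnected_connectedComponentIn.subset_closure (subset_insert z _)
    (insert_subset hz subset_closure)).subset_connectedComponentIn
      (mem_insert_of_mem _ (mem_connectedComponentIn ha))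
      (insert_subset hzF (connectedComponentIn_subset _ _)) (mem_insert _ _)

/-- Janiszewski's theorem for simply connected, locally path connected normal spaces. -/
theorem not_separates_union [SimplyConnectedSpace X] [LocallyPathConnectedSpace X] [NormalSpace X]
    {K₁ K₂ : Set X} (h₁ : IsClosed K₁) (h₂ : IsClosed K₂) (hd : Disjoint K₁ K₂) {p q : X}
    (hp₁ : ¬ Separates K₁ p q) (hp₂ : ¬ Separates K₂ p q) : ¬ Separates (K₁ ∪ K₂) p q := by
  classical
  intro hsep
  simp only [Separates, not_forall, not_nonempty_iff_eq_empty] at hp₁ hp₂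
  obtain ⟨G₁, hG₁, hpG₁, hqG₁, hG₁K⟩ := hp₁
  obtain ⟨G₂, hG₂, hpG₂, hqG₂, hG₂K⟩ := hp₂
  rw [← disjoint_iff_inter_eq_empty, Set.disjoint_left] at hG₁K hG₂K
  set U := connectedComponentIn (K₁ ∪ K₂)ᶜ p with hU
  have hUo : IsOpen U := (h₁.union h₂).isOpen_compl.connectedComponentIn
  have hpK : p ∈ (K₁ ∪ K₂)ᶜ := by
    rintro (h | h)
    · exact hG₁K hpG₁ h
    · exact hG₂K hpG₂ h
  have hpU : p ∈ U := mem_connectedComponentIn hpK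
  have hqU : q ∉ U := fun hq => by
    obtain ⟨z, hz, hzK⟩ := hsep U isPreconnected_connectedComponentIn hpU hq
    exact connectedComponentIn_subset _ _ hz hzK
  have hfr : frontier U ⊆ K₁ ∪ K₂ := by
    intro z hz
    by_contra hzK
    rw [hUo.frontier_eq] at hz
    exact hz.2 (closure_connectedComponentIn_inter_subset hpK ⟨hz.1, hzK⟩)
  obtain ⟨u, hu₁, hu₂, hu⟩ := exists_continuous_zero_one_of_isClosed h₁ h₂ hd
  have : Fact (0 < (2 : ℝ)) := ⟨two_pos⟩
  have h2 : ((2 : ℝ) : AddCircle (2 : ℝ)) = 0 := AddCircle.coe_period 2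
  let h : X → AddCircle (2 : ℝ) := fun x => if x ∈ U then ((u x : ℝ) : AddCircle (2 : ℝ))
    else ((-u x : ℝ) : AddCircle (2 : ℝ))
  have hh : Continuous h := by
    refine Continuous.if ?_ ?_ ?_
    · intro x hx
      rcases hfr hx with hx | hx
      · simp [hu₁ hx]
      · rw [hu₂ hx, ← sub_eq_zero, ← AddCircle.coe_sub, ← h2]
        norm_num
    · exact (AddCircle.continuous_mk' 2).comp u.continuous
    · exact (AddCircle.continuous_mk' 2).comp u.continuous.neg
  obtain ⟨θ, ⟨-, hθ⟩, -⟩ := (AddCircle.isCoveringMap_coe (2 : ℝ)).existsUnique_continuousMap_lifts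
    ⟨h, hh⟩ p (u p) (by simp [h, hpU])
  have hθ' : ∀ x, ((θ x : ℝ) : AddCircle (2 : ℝ)) = h x := fun x => congrFun hθ x
  have key : ∀ (G : Set X) (v : X → ℝ), IsPreconnected G → ContinuousOn v G →
      (∀ x, ((v x : ℝ) : AddCircle (2 : ℝ)) = h x) → p ∈ G → q ∈ G →
      θ p - v p = θ q - v q := by
    intro G v hG hv hvh hp hq
    refine hG.constant_of_mapsTo (T := (AddSubgroup.zmultiples (2 : ℝ) : Set ℝ))
      (f := fun x => θ x - v x) ?_ (θ.continuous.continuousOn.sub hv) ?_ hp hq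
    · exact ⟨inferInstanceAs (DiscreteTopology (AddSubgroup.zmultiples (2 : ℝ)))⟩
    · intro x _
      have : ((θ x - v x : ℝ) : AddCircle (2 : ℝ)) = 0 := by
        rw [AddCircle.coe_sub, hθ', hvh, sub_self]
      rw [AddCircle.coe_eq_zero_iff] at this
      exact this
  have e₂ := key G₂ (fun x => if x ∈ U then u x else -u x) hG₂ (by
    refine ContinuousOn.if ?_ (u.continuous.continuousOn) u.continuous.neg.continuousOn
    rintro x ⟨hx, hxf⟩
    rcases hfr hxf with hx' | hx'
    · simp [hu₁ hx']
    · exact absurd hx' (hG₂K hx)) (fun x => by simp only [h]; split_ifs <;> rfl) hpG₂ hqG₂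
  have e₁ := key G₁ (fun x => if x ∈ U then u x else 2 - u x) hG₁ (by
    refine ContinuousOn.if ?_ (u.continuous.continuousOn)
      (continuous_const.sub u.continuous).continuousOn
    rintro x ⟨hx, hxf⟩
    rcases hfr hxf with hx' | hx'
    · exact absurd hx' (hG₁K hx)
    · rw [hu₂ hx']
      norm_num) (fun x => by
        simp only [h]
        split_ifs
        · rfl
        · rw [AddCircle.coe_sub, h2, zero_sub, AddCircle.coe_neg]) hpG₁ hqG₁
  simp only [hpU, hqU, if_true, if_false] at e₁ e₂
  linarith

/-- In a locally path connected space, points not separated by a closed set lie in a compact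
preconnected set avoiding it. -/
lemma exists_isCompact_of_not_separates [LocallyPathConnectedSpace X] {F : Set X}
    (hF : IsClosed F) {p q : X} (h : ¬ Separates F p q) :
    ∃ K, IsCompact K ∧ IsPreconnected K ∧ p ∈ K ∧ q ∈ K ∧ Disjoint K F := by
  simp only [Separates, not_forall, not_nonempty_iff_eq_empty] at h
  obtain ⟨G, hG, hp, hq, hGF⟩ := h
  have hGF' : G ⊆ Fᶜ := fun x hx hxF => (hGF.subset ⟨hx, hxF⟩ : x ∈ (∅ : Set X))
  have hsub := hG.subset_connectedComponentIn hp hGF'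
  have hconn : IsPathConnected (connectedComponentIn Fᶜ p) :=
    hF.isOpen_compl.connectedComponentIn.isConnected_iff_isPathConnected.1
      (isConnected_connectedComponentIn_iff.2 (hGF' hp))
  obtain ⟨γ, hγ⟩ := hconn.joinedIn p (hsub hp) q (hsub hq)
  refine ⟨range γ, isCompact_range γ.continuous, isPreconnected_range γ.continuous,
    ⟨0, γ.source⟩, ⟨1, γ.target⟩, ?_⟩
  rw [Set.disjoint_left]
  rintro _ ⟨t, rfl⟩ ht
  exact connectedComponentIn_subset _ _ (hγ t) ht

/-- A closed separator contains a preconnected closed separator. -/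
theorem Separates.exists_isPreconnected [SimplyConnectedSpace X] [LocallyPathConnectedSpace X]
    [NormalSpace X] {F : Set X} (hF : IsClosed F) {p q : X} (h : Separates F p q) :
    ∃ C ⊆ F, IsClosed C ∧ IsPreconnected C ∧ Separates C p q := by
  obtain ⟨M, hMF, hM⟩ := zorn_superset_nonempty {G : Set X | IsClosed G ∧ Separates G p q}
    (by
      intro c hc hchain hne
      refine ⟨⋂₀ c, ⟨isClosed_sInter fun s hs => (hc hs).1, ?_⟩, fun s hs => sInter_subset_of_mem hs⟩
      by_contra hns
      obtain ⟨K, hK, hKc, hp, hq, hKd⟩ :=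
        exists_isCompact_of_not_separates (isClosed_sInter fun s hs => (hc hs).1) hns
      have : Nonempty c := hne.to_subtype
      obtain ⟨i, hi⟩ := hK.elim_directed_family_closed (fun s : c => (s : Set X))
        (fun s => (hc s.2).1) (by rw [← sInter_eq_iInter]; exact hKd.inter_eq)
        (fun i j => (hchain.total i.2 j.2).elim (fun h => ⟨i, Subset.rfl, h⟩)
          fun h => ⟨j, h, Subset.rfl⟩)
      obtain ⟨z, hz⟩ := (hc i.2).2 K hKc hp hq
      exact hi.subset hz) F ⟨hF, h⟩
  refine ⟨M, hMF, hM.prop.1, ?_, hM.prop.2⟩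
  rw [isPreconnected_iff_subset_of_disjoint_closed]
  intro u v hu hv hMuv hdis
  by_contra! hcon
  have hun : M ∩ u ∪ M ∩ v = M := by
    rw [← inter_union_distrib_left, inter_eq_left]
    exact hMuv
  refine not_separates_union (hM.prop.1.inter hu) (hM.prop.1.inter hv) ?_ ?_ ?_
    (hun.symm ▸ hM.prop.2)
  · rw [Set.disjoint_left]
    exact fun x hx hx' => hdis.subset ⟨hx.1, hx.2, hx'.2⟩
  · exact fun hs => hcon.1 fun x hx =>
      (hM.le_of_le ⟨hM.prop.1.inter hu, hs⟩ inter_subset_left hx).2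
  · exact fun hs => hcon.2 fun x hx =>
      (hM.le_of_le ⟨hM.prop.1.inter hv, hs⟩ inter_subset_left hx).2

end Separation

/-- The connected component through `x` of the level set of `f` at height `f x`. -/
def levelComp {X : Type*} [TopologicalSpace X] (f : X → ℝ) (x : X) : Set X :=
  connectedComponentIn {y | f y = f x} x

section LevelComp

variable {X : Type*} [TopologicalSpace X] {f : X → ℝ} {a b x y : X}

lemma mem_levelComp (f : X → ℝ) (x : X) : x ∈ levelComp f x :=
  mem_connectedComponentIn rfl

lemma isPreconnected_levelComp : IsPreconnected (levelComp f x) :=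
  isPreconnected_connectedComponentIn

lemma levelComp_subset : levelComp f x ⊆ {y | f y = f x} :=
  connectedComponentIn_subset _ _

lemma levelComp_eq (h : y ∈ levelComp f x) : levelComp f y = levelComp f x := by
  have h' : f y = f x := levelComp_subset h
  unfold levelComp at h ⊢
  rw [connectedComponentIn_eq h, h']

lemma levelComp_eq_or_disjoint (f : X → ℝ) (x y : X) :
    levelComp f x = levelComp f y ∨ Disjoint (levelComp f x) (levelComp f y) := by
  by_cases h : Disjoint (levelComp f x) (levelComp f y)
  · exact Or.inr h
  · obtain ⟨z, hx, hy⟩ := Set.not_disjoint_iff.1 h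
    exact Or.inl ((levelComp_eq hx).symm.trans (levelComp_eq hy))

lemma isClosed_levelComp (hf : Continuous f) : IsClosed (levelComp f x) :=
  isClosed_of_closure_subset <|
    isPreconnected_levelComp.closure.subset_connectedComponentIn (subset_closure (mem_levelComp f x))
      (closure_minimal levelComp_subset (isClosed_eq hf continuous_const))

/-- A component of a compact set, avoiding a closed set `K`, has an open neighbourhood whose closure
avoids `K` and whose frontier avoids the compact set. -/
lemma exists_isOpen_connectedComponentIn_subset [CompactSpace X] [T2Space X] {L K : Set X}
    (hL : IsClosed L) (hK : IsClosed K) (hx : x ∈ L) (hd : Disjoint (connectedComponentIn L x) K) :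
    ∃ N, IsOpen N ∧ connectedComponentIn L x ⊆ N ∧ Disjoint (closure N) K ∧
      Disjoint (frontier N) L := by
  have hLc : CompactSpace L := isCompact_iff_compactSpace.1 hL.isCompact
  rw [connectedComponentIn_eq_image hx] at hd ⊢
  rw [connectedComponent_eq_iInter_isClopen] at hd ⊢
  have hne : Nonempty {s : Set L // IsClopen s ∧ (⟨x, hx⟩ : L) ∈ s} :=
    ⟨⟨univ, isClopen_univ, mem_univ _⟩⟩
  obtain ⟨⟨Z, hZ, hxZ⟩, hZK⟩ := (hK.preimage continuous_subtype_val).isCompact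
      |>.elim_directed_family_closed
    (fun s : {s : Set L // IsClopen s ∧ (⟨x, hx⟩ : L) ∈ s} => (s : Set L))
    (fun s => s.2.1.isClosed) (by
      rw [← disjoint_iff_inter_eq_empty, Set.disjoint_left]
      exact fun z hzK hz => Set.disjoint_left.1 hd ⟨z, hz, rfl⟩ hzK)
    (fun s t => ⟨⟨s ∩ t, s.2.1.inter t.2.1, s.2.2, t.2.2⟩, inter_subset_left, inter_subset_right⟩)
  have hZc : IsClosed (Subtype.val '' Z) := hL.isClosedEmbedding_subtypeVal.isClosedMap _ hZ.isClosed
  have hZc' : IsClosed (Subtype.val '' Zᶜ) :=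
    hL.isClosedEmbedding_subtypeVal.isClosedMap _ hZ.compl.isClosed
  have hdis : Disjoint (Subtype.val '' Z) (Subtype.val '' Zᶜ ∪ K) := by
    rw [Set.disjoint_left]
    rintro _ ⟨z, hz, rfl⟩ (⟨w, hw, hwz⟩ | hzK')
    · exact hw (Subtype.val_injective hwz ▸ hz)
    · exact hZK.subset ⟨hzK', hz⟩
  obtain ⟨N, hN, hZN, hNd⟩ := normal_exists_closure_subset hZc (hZc'.union hK).isOpen_compl
    hdis.subset_compl_right
  refine ⟨N, hN, (image_mono (iInter_subset _ ⟨Z, hZ, hxZ⟩)).trans hZN, ?_, ?_⟩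
  · exact Set.disjoint_left.2 fun z hz hzK => hNd hz (Or.inr hzK)
  · rw [hN.frontier_eq, Set.disjoint_left]
    rintro z ⟨hz, hzN⟩ hzL
    by_cases hzZ : (⟨z, hzL⟩ : L) ∈ Z
    · exact hzN (hZN ⟨_, hzZ, rfl⟩)
    · exact hNd hz (Or.inl ⟨_, hzZ, rfl⟩)

/-- A level component can be separated from a disjoint closed set by another level
component. -/
theorem exists_levelComp_separating [CompactSpace X] [T2Space X] [SimplyConnectedSpace X]
    [LocallyPathConnectedSpace X] (hf : Continuous f) {K : Set X} (hK : IsClosed K)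
    (hy : y ∈ K) (hd : Disjoint (levelComp f x) K) :
    ∃ z, Disjoint (levelComp f z) (levelComp f x) ∧ Disjoint (levelComp f z) K ∧
      Separates (levelComp f z) x y := by
  obtain ⟨N, hN, hxN, hNK, hNL⟩ := exists_isOpen_connectedComponentIn_subset
    (isClosed_eq hf continuous_const) hK (rfl : f x = f x) hd
  have hxN : x ∈ N := hxN (mem_levelComp f x)
  obtain ⟨e, he, heN⟩ : ∃ e > 0, ∀ z ∈ frontier N, e < |f z - f x| := by
    rcases (frontier N).eq_empty_or_nonempty with h | h
    · exact ⟨1, one_pos, by simp [h]⟩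
    · obtain ⟨w, hw, hmin⟩ := isClosed_frontier.isCompact.exists_isMinOn h
        ((hf.sub continuous_const).abs.continuousOn (f := fun z => |f z - f x|))
      have hpos : 0 < |f w - f x| :=
        abs_pos.2 (sub_ne_zero.2 fun h => Set.disjoint_left.1 hNL hw h)
      exact ⟨_, half_pos hpos, fun z hz => (half_lt_self hpos).trans_le (hmin hz)⟩
  have habs : Continuous fun z => |f z - f x| := (hf.sub continuous_const).abs
  set F : Set X := {z | z ∈ closure N ∧ |f z - f x| = e} with hF
  have hFc : IsClosed F := isClosed_closure.inter (isClosed_eq habs continuous_const)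
  have hyN : y ∉ closure N := fun h => Set.disjoint_left.1 hNK h hy
  have hsep : Separates F x y := by
    intro G hG hx hy
    by_contra hGF
    have hO : IsOpen (N ∩ {z | |f z - f x| < e}) := hN.inter (isOpen_lt habs continuous_const)
    refine hyN (subset_closure (hG.subset_of_closure_inter_subset hO
      ⟨x, hx, hxN, by simpa using he⟩ ?_ hy).1)
    rintro z ⟨hz, hzG⟩
    have hz₁ : z ∈ closure N := closure_mono inter_subset_left hz
    have hz₂ : |f z - f x| ≤ e :=
      closure_minimal (fun w hw => le_of_lt hw.2) (isClosed_le habs continuous_const) hz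
    have hz₃ : |f z - f x| < e := lt_of_le_of_ne hz₂ fun h => hGF ⟨z, hzG, hz₁, h⟩
    refine ⟨?_, hz₃⟩
    by_contra hzN
    exact (heN z (hN.frontier_eq ▸ ⟨hz₁, hzN⟩)).not_ge hz₂
  obtain ⟨C, hCF, -, hC, hCsep⟩ := hsep.exists_isPreconnected hFc
  obtain ⟨z, -, hz⟩ := hCsep univ isPreconnected_univ (mem_univ _) (mem_univ _)
  have hzF := hCF hz
  have hconst : C ⊆ {w | f w = f z} := by
    have aux : ∀ v ∈ C, ∀ w ∈ C, f v = f x - e → f w = f x + e → False := by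
      intro v hv w hw hv' hw'
      obtain ⟨u, hu, hux⟩ := hC.intermediate_value hv hw hf.continuousOn
        (⟨by linarith, by linarith⟩ : f x ∈ Icc (f v) (f w))
      have := (hCF hu).2
      rw [hux, sub_self, abs_zero] at this
      exact he.ne this
    intro w hw
    have h₁ := (hCF hw).2
    have h₂ := hzF.2
    rcases (abs_eq he.le).1 h₁ with h₁ | h₁ <;> rcases (abs_eq he.le).1 h₂ with h₂ | h₂
    · exact (by linarith : f w = f z)
    · exact (aux z hz w hw (by linarith) (by linarith)).elim
    · exact (aux w hw z hz (by linarith) (by linarith)).elim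
    · exact (by linarith : f w = f z)
  have hCz : C ⊆ levelComp f z := hC.subset_connectedComponentIn hz hconst
  have hnot : ∀ w ∈ levelComp f z, w ∈ closure N → w ∈ N := by
    intro w hw hwN
    have hwz : f w = f z := levelComp_subset hw
    by_contra hwN'
    have := heN w (hN.frontier_eq ▸ ⟨hwN, hwN'⟩)
    rw [hwz, hzF.2] at this
    exact this.false
  have hzN : levelComp f z ⊆ N := isPreconnected_levelComp.subset_of_closure_inter_subset hN
    ⟨z, mem_levelComp f z, hnot z (mem_levelComp f z) hzF.1⟩ fun w hw => hnot w hw.2 hw.1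
  refine ⟨z, ?_, ?_, hCsep.mono hCz⟩
  · rw [Set.disjoint_left]
    intro w hw hw'
    have h₁ : f w = f z := levelComp_subset hw
    have h₂ : f w = f x := levelComp_subset hw'
    have := hzF.2
    rw [← h₁, h₂, sub_self, abs_zero] at this
    exact he.ne this
  · exact Set.disjoint_left.2 fun w hw hwK => Set.disjoint_left.1 hNK (subset_closure (hzN hw)) hwK

end LevelComp

section Order

variable {X : Type*} [TopologicalSpace X] {f : X → ℝ} {a b x y : X} {C D : Set X}

lemma Separates.nonempty [PreconnectedSpace X] (h : Separates C a b) : C.Nonempty :=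
  (h univ isPreconnected_univ (mem_univ _) (mem_univ _)).mono inter_subset_right

/-- A closed connected set `C` separating `a` from `b` can be joined to `a` by a preconnected set
within `C` and the component of `a` in its complement. -/
lemma Separates.exists_isPreconnected_collar [PathConnectedSpace X] (hC : IsClosed C)
    (hCc : IsPreconnected C) (h : Separates C a b) :
    ∃ G, IsPreconnected G ∧ a ∈ G ∧ C ⊆ G ∧ G ⊆ connectedComponentIn Cᶜ a ∪ C := by
  obtain ⟨γ⟩ := PathConnectedSpace.joined a b
  have hγ : Continuous γ.extend := γ.continuous_extend
  have hpre : ∀ t, IsPreconnected (γ.extend '' Icc 0 t) := fun t =>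
    isPreconnected_Icc.image _ hγ.continuousOn
  have hne : (Icc (0 : ℝ) 1 ∩ γ.extend ⁻¹' C).Nonempty := by
    obtain ⟨_, ⟨t, ht, rfl⟩, htC⟩ := h _ (hpre 1) ⟨0, by simp, by simp⟩ ⟨1, by simp, by simp⟩
    exact ⟨t, ht, htC⟩
  obtain ⟨τ, ⟨hτ, hτC⟩, hmin⟩ :=
    (isCompact_Icc.inter_right (hC.preimage hγ)).exists_isLeast hne
  refine ⟨γ.extend '' Icc 0 τ ∪ C, ?_, Or.inl ⟨0, ⟨le_rfl, hτ.1⟩, by simp⟩, subset_union_right, ?_⟩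
  · exact IsPreconnected.union (γ.extend τ) ⟨τ, ⟨hτ.1, le_rfl⟩, rfl⟩ hτC (hpre τ) hCc
  · refine union_subset ?_ subset_union_right
    rintro _ ⟨t, ht, rfl⟩
    rcases ht.2.eq_or_lt with rfl | hlt
    · exact Or.inr hτC
    · refine Or.inl ((hpre t).subset_connectedComponentIn ⟨0, ⟨le_rfl, ht.1⟩, by simp⟩ ?_
        ⟨t, ⟨ht.1, le_rfl⟩, rfl⟩)
      rintro _ ⟨s, hs, rfl⟩ hsC
      exact (hmin ⟨⟨hs.1, (hs.2.trans ht.2).trans hτ.2⟩, hsC⟩).not_gt (hs.2.trans_lt hlt)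

lemma Separates.subset_left [PathConnectedSpace X] (hC : IsClosed C) (hCc : IsPreconnected C)
    (h : Separates C a b) (hD : D ⊆ connectedComponentIn Cᶜ b) :
    C ⊆ connectedComponentIn Dᶜ a := by
  obtain ⟨G, hG, haG, hCG, hGs⟩ := h.exists_isPreconnected_collar hC hCc
  refine hCG.trans (hG.subset_connectedComponentIn haG fun z hz hzD => ?_)
  rcases hGs hz with hz | hz
  · exact Set.disjoint_left.1 h.disjoint hz (hD hzD)
  · exact connectedComponentIn_subset _ _ (hD hzD) hz

lemma Separates.connectedComponentIn_subset_of_subset (h : Separates C a b)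
    (hD : D ⊆ connectedComponentIn Cᶜ b) :
    connectedComponentIn Cᶜ a ⊆ connectedComponentIn Dᶜ a := by
  by_cases ha : a ∈ Cᶜ
  · exact isPreconnected_connectedComponentIn.subset_connectedComponentIn
      (mem_connectedComponentIn ha) fun z hz hzD => Set.disjoint_left.1 h.disjoint hz (hD hzD)
  · rw [connectedComponentIn_eq_empty ha]
    exact empty_subset _

/-- Disjoint closed connected sets separating `a` from `b` are linearly ordered. -/
theorem Separates.subset_or_subset [PathConnectedSpace X] (hC : IsClosed C)
    (hCc : IsPreconnected C) (hDc : IsPreconnected D) (hd : Disjoint C D)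
    (h : Separates C a b) (h' : Separates D a b) :
    (D ⊆ connectedComponentIn Cᶜ b ∧ C ⊆ connectedComponentIn Dᶜ a) ∨
      (C ⊆ connectedComponentIn Dᶜ b ∧ D ⊆ connectedComponentIn Cᶜ a) := by
  obtain ⟨G, hG, haG, hCG, hGs⟩ := h.exists_isPreconnected_collar hC hCc
  obtain ⟨H, hH, hbH, hCH, hHs⟩ := h.symm.exists_isPreconnected_collar hC hCc
  obtain ⟨c, hc⟩ := h.nonempty
  obtain ⟨z, hz, hzD⟩ := h' (G ∪ H) (hG.union c (hCG hc) (hCH hc) hH) (Or.inl haG) (Or.inr hbH)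
  have hzC : z ∉ C := Set.disjoint_right.1 hd hzD
  rcases hz with hz | hz
  · have hDC := hDc.subset_connectedComponentIn_of_mem hzD ((hGs hz).resolve_right hzC)
      hd.symm.subset_compl_right
    exact Or.inr ⟨h.symm.subset_left hC hCc hDC, hDC⟩
  · have hDC := hDc.subset_connectedComponentIn_of_mem hzD ((hHs hz).resolve_right hzC)
      hd.symm.subset_compl_right
    exact Or.inl ⟨hDC, h.subset_left hC hCc hDC⟩

variable [CompactSpace X] [T2Space X] [SimplyConnectedSpace X] [LocallyPathConnectedSpace X]

lemma exists_levelComp_left (hf : Continuous f) (h : Separates (levelComp f x) a b)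
    (hy : y ∈ connectedComponentIn (levelComp f x)ᶜ a) :
    ∃ z, Separates (levelComp f z) a b ∧
      levelComp f z ⊆ connectedComponentIn (levelComp f x)ᶜ a ∧
      y ∈ connectedComponentIn (levelComp f z)ᶜ a := by
  have ha : a ∈ (levelComp f x)ᶜ := connectedComponentIn_nonempty_iff.1 ⟨y, hy⟩
  obtain ⟨K, hK, hKc, haK, hyK, hKd⟩ := exists_isCompact_of_not_separates (isClosed_levelComp hf)
    (p := a) (q := y) (fun hs => by
      obtain ⟨w, hw, hw'⟩ := hs _ isPreconnected_connectedComponentIn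
        (mem_connectedComponentIn ha) hy
      exact connectedComponentIn_subset _ _ hw hw')
  obtain ⟨z, hzx, hzK, hz⟩ := exists_levelComp_separating hf hK.isClosed hyK hKd.symm
  have hKz : K ⊆ connectedComponentIn (levelComp f z)ᶜ a :=
    hKc.subset_connectedComponentIn haK hzK.subset_compl_left
  have hzab : Separates (levelComp f z) a b := by
    intro G hG haG hbG
    obtain ⟨w, hwG, hwx⟩ := h G hG haG hbG
    obtain ⟨v, hv, hvz⟩ := hz (levelComp f x ∪ (G ∪ K))
      (isPreconnected_levelComp.union w hwx (Or.inl hwG) (hG.union a haG haK hKc))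
      (Or.inl (mem_levelComp f x)) (Or.inr (Or.inr hyK))
    rcases hv with hv | hv | hv
    · exact absurd hv (Set.disjoint_left.1 hzx hvz)
    · exact ⟨v, hv, hvz⟩
    · exact absurd hv (Set.disjoint_left.1 hzK hvz)
  refine ⟨z, hzab, ?_, hKz hyK⟩
  rcases h.subset_or_subset (isClosed_levelComp hf) isPreconnected_levelComp
    isPreconnected_levelComp hzx.symm hzab with ⟨-, h₁⟩ | ⟨-, h₁⟩
  · obtain ⟨v, hv, hvz⟩ := hz _ isPreconnected_connectedComponentIn (h₁ (mem_levelComp f x))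
      (hKz hyK)
    exact absurd hvz (connectedComponentIn_subset _ _ hv)
  · exact h₁

/-- Level components separating `a` from `b` that precede a given one and are close to it in the
order lie in a given neighbourhood of it. -/
theorem exists_levelComp_left_subset (hf : Continuous f) (h : Separates (levelComp f x) a b)
    (ha : a ∉ levelComp f x) {N : Set X} (hN : IsOpen N) (hxN : levelComp f x ⊆ N) :
    ∃ z, Separates (levelComp f z) a b ∧
      levelComp f z ⊆ connectedComponentIn (levelComp f x)ᶜ a ∧
      ∀ w, levelComp f w ⊆ connectedComponentIn (levelComp f z)ᶜ b →
        levelComp f w ⊆ connectedComponentIn (levelComp f x)ᶜ a → levelComp f w ⊆ N := by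
  set U := connectedComponentIn (levelComp f x)ᶜ a with hU
  let ι := {z // Separates (levelComp f z) a b ∧ levelComp f z ⊆ U}
  have hι : Nonempty ι := by
    obtain ⟨z, hz, hzx, -⟩ := exists_levelComp_left hf h (mem_connectedComponentIn ha)
    exact ⟨⟨z, hz, hzx⟩⟩
  obtain ⟨⟨z, hz, hzx⟩, hcov⟩ := (isClosed_closure.sdiff hN).isCompact.elim_directed_cover
    (s := closure U \ N) (fun z : ι => connectedComponentIn (levelComp f z.1)ᶜ a)
    (fun z => (isClosed_levelComp hf).isOpen_compl.connectedComponentIn)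
    (by
      rintro y ⟨hy, hyN⟩
      obtain ⟨z, hz, hzx, hyz⟩ := exists_levelComp_left hf h
        (closure_connectedComponentIn_inter_subset ha ⟨hy, fun hyx => hyN (hxN hyx)⟩)
      exact mem_iUnion.2 ⟨⟨z, hz, hzx⟩, hyz⟩)
    (by
      rintro ⟨z, hz, hzx⟩ ⟨w, hw, hwx⟩
      rcases levelComp_eq_or_disjoint f z w with he | hd
      · exact ⟨⟨z, hz, hzx⟩, Subset.rfl, by simp only [he]; exact Subset.rfl⟩
      · rcases hz.subset_or_subset (isClosed_levelComp hf) isPreconnected_levelComp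
          isPreconnected_levelComp hd hw with ⟨h₁, -⟩ | ⟨h₁, -⟩
        · exact ⟨⟨w, hw, hwx⟩, hz.connectedComponentIn_subset_of_subset h₁, Subset.rfl⟩
        · exact ⟨⟨z, hz, hzx⟩, Subset.rfl, hw.connectedComponentIn_subset_of_subset h₁⟩)
  refine ⟨z, hz, hzx, fun w hwz hwx v hv => ?_⟩
  by_contra hvN
  exact Set.disjoint_left.1 hz.disjoint (hcov ⟨subset_closure (hwx hv), hvN⟩) (hwz hv)

/-- Between two level components separating `a` from `b` there is a third one. -/
theorem exists_levelComp_between (hf : Continuous f) (hx : Separates (levelComp f x) a b)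
    (hy : Separates (levelComp f y) a b)
    (hxy : levelComp f y ⊆ connectedComponentIn (levelComp f x)ᶜ b) :
    ∃ z, Separates (levelComp f z) a b ∧
      levelComp f z ⊆ connectedComponentIn (levelComp f x)ᶜ b ∧
      levelComp f y ⊆ connectedComponentIn (levelComp f z)ᶜ b := by
  have hd : Disjoint (levelComp f x) (levelComp f y) :=
    (subset_compl_iff_disjoint_left.1 (hxy.trans (connectedComponentIn_subset _ _)))
  obtain ⟨z, hzx, hzy, hz⟩ :=
    exists_levelComp_separating hf (isClosed_levelComp hf) (mem_levelComp f y) hd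
  have hzab : Separates (levelComp f z) a b := by
    intro G hG haG hbG
    obtain ⟨w, hwG, hwx⟩ := hx G hG haG hbG
    obtain ⟨u, huG, huy⟩ := hy G hG haG hbG
    obtain ⟨v, hv, hvz⟩ := hz (levelComp f x ∪ (G ∪ levelComp f y))
      (isPreconnected_levelComp.union w hwx (Or.inl hwG)
        (hG.union u huG huy isPreconnected_levelComp))
      (Or.inl (mem_levelComp f x)) (Or.inr (Or.inr (mem_levelComp f y)))
    rcases hv with hv | hv | hv
    · exact absurd hv (Set.disjoint_left.1 hzx hvz)
    · exact ⟨v, hv, hvz⟩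
    · exact absurd hv (Set.disjoint_left.1 hzy hvz)
  have hsame : ∀ c, levelComp f x ⊆ connectedComponentIn (levelComp f z)ᶜ c →
      levelComp f y ⊆ connectedComponentIn (levelComp f z)ᶜ c → False := by
    intro c h₁ h₂
    obtain ⟨v, hv, hvz⟩ := hz _ isPreconnected_connectedComponentIn (h₁ (mem_levelComp f x))
      (h₂ (mem_levelComp f y))
    exact connectedComponentIn_subset _ _ hv hvz
  refine ⟨z, hzab, ?_⟩
  rcases hx.subset_or_subset (isClosed_levelComp hf) isPreconnected_levelComp
    isPreconnected_levelComp hzx.symm hzab with ⟨h₁, h₂⟩ | ⟨h₁, h₂⟩ <;>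
  rcases hzab.subset_or_subset (isClosed_levelComp hf) isPreconnected_levelComp
    isPreconnected_levelComp hzy hy with ⟨h₃, h₄⟩ | ⟨h₃, h₄⟩
  · exact ⟨h₁, h₃⟩
  · exact (hsame a h₂ h₄).elim
  · exact (hsame b h₁ h₃).elim
  · exact (Set.disjoint_left.1 hx.disjoint
      (hzab.connectedComponentIn_subset_of_subset h₁ (h₄ (mem_levelComp f y)))
      (hxy (mem_levelComp f y))).elim

end Order

/-- A set of reals with two extreme points that is densely ordered and in which suprema exist is
order isomorphic to the unit interval. -/
theorem exists_strictMonoOn_image_eq {K : Set ℝ} {k₀ k₁ : ℝ} (hlt : k₀ < k₁) (h₀ : IsLeast K k₀)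
    (h₁ : IsGreatest K k₁) (hdense : ∀ x ∈ K, ∀ y ∈ K, x < y → ∃ z ∈ K, x < z ∧ z < y)
    (hsup : ∀ S ⊆ K, S.Nonempty →
      ∃ u ∈ K, u ∈ upperBounds S ∧ ∀ w ∈ K, w ∈ upperBounds S → u ≤ w) :
    ∃ e : ℝ → ℝ, StrictMonoOn e (Icc 0 1) ∧ e '' Icc 0 1 = K := by
  obtain ⟨D₀, hD₀K, hD₀c, hD₀⟩ :=
    (TopologicalSpace.IsSeparable.of_separableSpace K).exists_countable_dense_subset
  set D : Set ℝ := D₀ ∩ Ioo k₀ k₁ with hD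
  have hDd : ∀ x ∈ K, ∀ y ∈ K, x < y → ∃ d ∈ D, x < d ∧ d < y := by
    intro x hx y hy hxy
    obtain ⟨z, hz, hxz, hzy⟩ := hdense x hx y hy hxy
    obtain ⟨d, hd, hdD⟩ := mem_closure_iff.1 (hD₀ hz) _ isOpen_Ioo ⟨hxz, hzy⟩
    exact ⟨d, ⟨hdD, (h₀.2 hx).trans_lt hd.1, hd.2.trans_le (h₁.2 hy)⟩, hd⟩
  have hDK : D ⊆ K := fun d hd => hD₀K hd.1
  have : Countable D := (hD₀c.mono inter_subset_left).to_subtype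
  have : DenselyOrdered D := ⟨fun x y hxy => by
    obtain ⟨d, hd, h⟩ := hDd x (hDK x.2) y (hDK y.2) hxy
    exact ⟨⟨d, hd⟩, h⟩⟩
  have : NoMinOrder D := ⟨fun x => by
    obtain ⟨d, hd, h⟩ := hDd k₀ h₀.1 x (hDK x.2) x.2.2.1
    exact ⟨⟨d, hd⟩, h.2⟩⟩
  have : NoMaxOrder D := ⟨fun x => by
    obtain ⟨d, hd, h⟩ := hDd x (hDK x.2) k₁ h₁.1 x.2.2.2
    exact ⟨⟨d, hd⟩, h.1⟩⟩
  have : Nonempty D := by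
    obtain ⟨d, hd, -⟩ := hDd k₀ h₀.1 k₁ h₁.1 hlt
    exact ⟨⟨d, hd⟩⟩
  have : Nonempty (Ioo (0 : ℚ) 1) := ⟨⟨1 / 2, by norm_num, by norm_num⟩⟩
  obtain ⟨E⟩ := Order.iso_of_countable_dense D (Ioo (0 : ℚ) 1)
  let r : D → ℝ := fun d => ((E d : ℚ) : ℝ)
  have hr : StrictMono r := fun d d' h => Rat.cast_lt.2 (E.strictMono h)
  have hr₀ : ∀ d, 0 < r d := fun d => Rat.cast_pos.2 (E d).2.1
  have hr₁ : ∀ d, r d < 1 := fun d => by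
    have := (Rat.cast_lt (K := ℝ)).2 (E d).2.2
    simpa [r] using this
  have hrd : ∀ s t : ℝ, 0 ≤ s → t ≤ 1 → s < t → ∃ d, s < r d ∧ r d < t := by
    intro s t hs ht hst
    obtain ⟨q, hsq, hqt⟩ := exists_rat_btwn hst
    have hq : q ∈ Ioo (0 : ℚ) 1 :=
      ⟨by exact_mod_cast hs.trans_lt hsq, by exact_mod_cast hqt.trans_le ht⟩
    exact ⟨E.symm ⟨q, hq⟩, by simpa [r] using hsq, by simpa [r] using hqt⟩
  let S : ℝ → Set ℝ := fun t => insert k₀ (Subtype.val '' {d : D | r d ≤ t})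
  have hS : ∀ t, ∃ u ∈ K, u ∈ upperBounds (S t) ∧ ∀ w ∈ K, w ∈ upperBounds (S t) → u ≤ w :=
    fun t => hsup _ (insert_subset h₀.1 (by rintro _ ⟨d, -, rfl⟩; exact hDK d.2))
      (insert_nonempty _ _)
  choose e heK heub heleast using hS
  have hmem : ∀ t d, r d ≤ t → (d : ℝ) ≤ e t := fun t d h => heub t (Or.inr ⟨d, h, rfl⟩)
  have hle : ∀ t, ∀ k ∈ K, (∀ d, r d ≤ t → (d : ℝ) ≤ k) → e t ≤ k := by
    refine fun t k hk h => heleast t k hk ?_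
    rintro _ (rfl | ⟨d, hd, rfl⟩)
    exacts [h₀.2 hk, h d hd]
  refine ⟨e, ?_, Subset.antisymm (by rintro _ ⟨t, -, rfl⟩; exact heK t) ?_⟩
  · intro s hs t ht hst
    obtain ⟨d, hsd, hdt⟩ := hrd s t hs.1 ht.2 hst
    obtain ⟨d', hdd', hdt'⟩ := hrd (r d) t (hr₀ d).le ht.2 hdt
    calc e s ≤ d := hle s d (hDK d.2) fun c hc => (hr.lt_iff_lt.1 (hc.trans_lt hsd)).le
      _ < d' := hr.lt_iff_lt.1 hdd'
      _ ≤ e t := hmem t d' hdt'.le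
  · intro k hk
    set R : Set ℝ := insert 0 (r '' {d : D | (d : ℝ) ≤ k}) with hR
    have hR₁ : ∀ c ∈ R, c ≤ 1 := by
      rintro _ (rfl | ⟨d, -, rfl⟩)
      exacts [zero_le_one, (hr₁ d).le]
    have hRb : BddAbove R := ⟨1, hR₁⟩
    have hRn : R.Nonempty := insert_nonempty _ _
    refine ⟨sSup R, ⟨le_csSup hRb (mem_insert _ _), csSup_le hRn hR₁⟩, le_antisymm ?_ ?_⟩
    · refine hle _ k hk fun d hd => ?_
      by_contra! hkd
      obtain ⟨c, hc, hkc, hcd⟩ := hDd k hk d (hDK d.2) hkd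
      have h : sSup R ≤ r ⟨c, hc⟩ := by
        refine csSup_le hRn ?_
        rintro _ (rfl | ⟨d', hd', rfl⟩)
        exacts [(hr₀ _).le, hr.monotone (show d' ≤ ⟨c, hc⟩ from (hd'.trans_lt hkc).le)]
      exact (hd.trans h).not_gt (hr (show (⟨c, hc⟩ : D) < d from hcd))
    · by_contra! hek
      obtain ⟨d, hd, hed, hdk⟩ := hDd _ (heK _) k hk hek
      exact (hmem (sSup R) ⟨d, hd⟩ (le_csSup hRb (Or.inr ⟨_, hdk.le, rfl⟩))).not_gt hed

/-- The times at which the path `γ` on `[0, 1]` leaves for the last time a level component of `f`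
that separates its endpoints. -/
def lastTimes {X : Type*} [TopologicalSpace X] (f : X → ℝ) (γ : ℝ → X) : Set ℝ :=
  {s | s ∈ Icc (0 : ℝ) 1 ∧ Separates (levelComp f (γ s)) (γ 0) (γ 1) ∧
    ∀ t ∈ Icc (0 : ℝ) 1, γ t ∈ levelComp f (γ s) → t ≤ s}

section Arc

variable {X : Type*} [TopologicalSpace X] {f : X → ℝ} {γ : ℝ → X} {s t : ℝ} {z : X}

lemma exists_isGreatest_levelComp (hf : Continuous f) (hγ : Continuous γ)
    (ht : t ∈ Icc (0 : ℝ) 1) (htz : γ t ∈ levelComp f z) :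
    ∃ s ∈ Icc (0 : ℝ) 1, levelComp f (γ s) = levelComp f z ∧
      ∀ r ∈ Icc (0 : ℝ) 1, γ r ∈ levelComp f (γ s) → r ≤ s := by
  obtain ⟨s, ⟨hs, hsz⟩, hmax⟩ := (isCompact_Icc.inter_right
    ((isClosed_levelComp hf (x := z)).preimage hγ)).exists_isGreatest ⟨t, ht, htz⟩
  have he : levelComp f (γ s) = levelComp f z := levelComp_eq hsz
  exact ⟨s, hs, he, fun r hr hrs => hmax ⟨hr, he ▸ hrs⟩⟩

lemma exists_mem_lastTimes (hf : Continuous f) (hγ : Continuous γ)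
    (hz : Separates (levelComp f z) (γ 0) (γ 1)) :
    ∃ s ∈ lastTimes f γ, levelComp f (γ s) = levelComp f z := by
  obtain ⟨_, ⟨t, ht, rfl⟩, htz⟩ := hz (γ '' Icc 0 1) (isPreconnected_Icc.image _ hγ.continuousOn)
    ⟨0, by simp, rfl⟩ ⟨1, by simp, rfl⟩
  obtain ⟨s, hs, he, hmax⟩ := exists_isGreatest_levelComp hf hγ ht htz
  exact ⟨s, ⟨hs, he ▸ hz, hmax⟩, he⟩

lemma mem_connectedComponentIn_of_lt (hγ : Continuous γ) (hs : s ∈ lastTimes f γ)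
    (ht : t ∈ Icc (0 : ℝ) 1) (hst : s < t) :
    γ t ∈ connectedComponentIn (levelComp f (γ s))ᶜ (γ 1) := by
  refine (isPreconnected_Icc.image γ hγ.continuousOn).subset_connectedComponentIn
    ⟨1, ⟨ht.2, le_rfl⟩, rfl⟩ ?_ ⟨t, ⟨le_rfl, ht.2⟩, rfl⟩
  rintro _ ⟨r, hr, rfl⟩ hrs
  exact (hs.2.2 r ⟨ht.1.trans hr.1, hr.2⟩ hrs).not_gt (hst.trans_le hr.1)

lemma levelComp_subset_of_lt (hγ : Continuous γ) (hs : s ∈ lastTimes f γ)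
    (ht : t ∈ Icc (0 : ℝ) 1) (hst : s < t) :
    levelComp f (γ t) ⊆ connectedComponentIn (levelComp f (γ s))ᶜ (γ 1) := by
  refine isPreconnected_levelComp.subset_connectedComponentIn_of_mem (mem_levelComp f _)
    (mem_connectedComponentIn_of_lt hγ hs ht hst) ?_
  rcases levelComp_eq_or_disjoint f (γ s) (γ t) with h | h
  · exact ((hs.2.2 t ht (h ▸ mem_levelComp f _)).not_gt hst).elim
  · exact h.symm.subset_compl_right

lemma lastTimes_eq (hs : s ∈ lastTimes f γ) (ht : t ∈ lastTimes f γ)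
    (h : levelComp f (γ s) = levelComp f (γ t)) : s = t :=
  le_antisymm (ht.2.2 s hs.1 (h ▸ mem_levelComp f _)) (hs.2.2 t ht.1 (h ▸ mem_levelComp f _))

lemma lt_of_levelComp_subset [PathConnectedSpace X] (hf : Continuous f) (hγ : Continuous γ)
    (hs : s ∈ lastTimes f γ) (ht : t ∈ lastTimes f γ)
    (h : levelComp f (γ t) ⊆ connectedComponentIn (levelComp f (γ s))ᶜ (γ 1)) : s < t := by
  by_contra! hts
  rcases hts.eq_or_lt with rfl | hts
  · exact connectedComponentIn_subset _ _ (h (mem_levelComp f _)) (mem_levelComp f _)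
  · have h₁ := levelComp_subset_of_lt hγ ht hs.1 hts
    have h₂ := hs.2.1.subset_left (isClosed_levelComp hf) isPreconnected_levelComp h
    exact Set.disjoint_left.1 ht.2.1.disjoint (h₂ (mem_levelComp f _)) (h₁ (mem_levelComp f _))

lemma lt_of_levelComp_subset' [PathConnectedSpace X] (hf : Continuous f) (hγ : Continuous γ)
    (hs : s ∈ lastTimes f γ) (ht : t ∈ lastTimes f γ)
    (h : levelComp f (γ s) ⊆ connectedComponentIn (levelComp f (γ t))ᶜ (γ 0)) : s < t :=
  lt_of_levelComp_subset hf hγ hs ht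
    (ht.2.1.symm.subset_left (isClosed_levelComp hf) isPreconnected_levelComp h)

lemma levelComp_subset_of_lt' [PathConnectedSpace X] (hf : Continuous f) (hγ : Continuous γ)
    (hs : s ∈ lastTimes f γ) (ht : t ∈ lastTimes f γ) (hst : s < t) :
    levelComp f (γ s) ⊆ connectedComponentIn (levelComp f (γ t))ᶜ (γ 0) :=
  hs.2.1.subset_left (isClosed_levelComp hf) isPreconnected_levelComp
    (levelComp_subset_of_lt hγ hs ht.1 hst)

variable [CompactSpace X] [T2Space X] [SimplyConnectedSpace X] [LocallyPathConnectedSpace X]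

/-- Limits of level components separating the endpoints of `γ` separate them as well. -/
lemma separates_sSup (hf : Continuous f) (hγ : Continuous γ) {S : Set ℝ} (hS : S ⊆ lastTimes f γ)
    (hne : S.Nonempty) (hmax : ∀ s ∈ S, ∃ t ∈ S, s < t) :
    Separates (levelComp f (γ (sSup S))) (γ 0) (γ 1) := by
  have hbdd : BddAbove S := ⟨1, fun s hs => (hS hs).1.2⟩
  by_contra hns
  obtain ⟨K, hK, hKc, h₀, h₁, hKd⟩ :=
    exists_isCompact_of_not_separates (isClosed_levelComp hf) hns
  obtain ⟨z, hzx, hzK, hz⟩ := exists_levelComp_separating hf hK.isClosed h₀ hKd.symm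
  set O := connectedComponentIn (levelComp f z)ᶜ (γ (sSup S)) with hO
  have hxO : γ (sSup S) ∈ O :=
    mem_connectedComponentIn (hzx.subset_compl_left (mem_levelComp f _))
  have hOo : IsOpen O := (isClosed_levelComp hf).isOpen_compl.connectedComponentIn
  obtain ⟨δ, hδ, hball⟩ := Metric.isOpen_iff.1 (hOo.preimage hγ) _ hxO
  have heq : ∀ s ∈ S, γ s ∈ O → levelComp f (γ s) = levelComp f z := by
    intro s hs hsO
    refine (levelComp_eq_or_disjoint f (γ s) z).resolve_right fun hd => ?_
    obtain ⟨w, hwK, hws⟩ := (hS hs).2.1 K hKc h₀ h₁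
    obtain ⟨v, hv, hvz⟩ := hz (O ∪ (levelComp f (γ s) ∪ K))
      (isPreconnected_connectedComponentIn.union (γ s) hsO (Or.inl (mem_levelComp f _))
        (isPreconnected_levelComp.union w hws hwK hKc)) (Or.inl hxO) (Or.inr (Or.inr h₀))
    rcases hv with hv | hv | hv
    · exact connectedComponentIn_subset _ _ hv hvz
    · exact Set.disjoint_left.1 hd hv hvz
    · exact Set.disjoint_left.1 hzK hvz hv
  have hnear : ∀ s ∈ S, sSup S - δ < s → γ s ∈ O := fun s hs hlt => hball (by
    rw [Metric.mem_ball, Real.dist_eq, abs_lt]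
    exact ⟨by linarith, by linarith [le_csSup hbdd hs]⟩)
  obtain ⟨s, hs, hsδ⟩ := exists_lt_of_lt_csSup hne (sub_lt_self (sSup S) hδ)
  obtain ⟨t, ht, hst⟩ := hmax s hs
  exact hst.ne (lastTimes_eq (hS hs) (hS ht)
    ((heq s hs (hnear s hs hsδ)).trans (heq t ht (hnear t ht (hsδ.trans hst))).symm))

lemma exists_lub_lastTimes (hf : Continuous f) (hγ : Continuous γ) {S : Set ℝ}
    (hS : S ⊆ lastTimes f γ) (hne : S.Nonempty) :
    ∃ u ∈ lastTimes f γ, u ∈ upperBounds S ∧ ∀ w ∈ lastTimes f γ, w ∈ upperBounds S → u ≤ w := by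
  by_cases hmax : ∀ s ∈ S, ∃ t ∈ S, s < t
  · have hbdd : BddAbove S := ⟨1, fun s hs => (hS hs).1.2⟩
    have hmem : sSup S ∈ Icc (0 : ℝ) 1 := by
      obtain ⟨s, hs⟩ := hne
      exact ⟨(hS hs).1.1.trans (le_csSup hbdd hs), csSup_le ⟨s, hs⟩ fun s hs => (hS hs).1.2⟩
    have hsep := separates_sSup hf hγ hS hne hmax
    obtain ⟨u, hu, he, hlast⟩ :=
      exists_isGreatest_levelComp hf hγ hmem (mem_levelComp f (γ (sSup S)))
    have huK : u ∈ lastTimes f γ := ⟨hu, he ▸ hsep, hlast⟩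
    refine ⟨u, huK, fun s hs => (le_csSup hbdd hs).trans
      (hlast _ hmem (he ▸ mem_levelComp f _)), fun w hw hwS => ?_⟩
    by_contra! hwu
    have hV : γ (sSup S) ∈ connectedComponentIn (levelComp f (γ w))ᶜ (γ 1) :=
      levelComp_subset_of_lt hγ hw hu hwu (he ▸ mem_levelComp f _)
    have hVo : IsOpen (connectedComponentIn (levelComp f (γ w))ᶜ (γ 1)) :=
      (isClosed_levelComp hf).isOpen_compl.connectedComponentIn
    obtain ⟨δ, hδ, hball⟩ := Metric.isOpen_iff.1 (hVo.preimage hγ) _ hV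
    obtain ⟨s, hs, hsδ⟩ := exists_lt_of_lt_csSup hne (sub_lt_self (sSup S) hδ)
    obtain ⟨t, ht, hst⟩ := hmax s hs
    have hsV : γ s ∈ connectedComponentIn (levelComp f (γ w))ᶜ (γ 1) := hball (by
      rw [Metric.mem_ball, Real.dist_eq, abs_lt]
      exact ⟨by linarith, by linarith [le_csSup hbdd hs]⟩)
    exact Set.disjoint_left.1 hw.2.1.disjoint
      (levelComp_subset_of_lt' hf hγ (hS hs) hw (hst.trans_le (hwS ht)) (mem_levelComp f _)) hsV
  · push Not at hmax
    obtain ⟨s, hs, hsmax⟩ := hmax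
    exact ⟨s, hS hs, hsmax, fun w _ hw => hw hs⟩

/-- Kronrod's theorem on simply connected compact spaces: distinct level components are joined by an
arc of level components, each of which separates them. -/
theorem exists_levelComp_arc (hf : Continuous f) {a b : X}
    (hab : levelComp f a ≠ levelComp f b) :
    ∃ p : ℝ → X, InjOn (fun t => levelComp f (p t)) (Icc 0 1) ∧
      levelComp f (p 0) = levelComp f a ∧ levelComp f (p 1) = levelComp f b ∧
      (∀ t ∈ Icc (0 : ℝ) 1, Separates (levelComp f (p t)) a b) ∧
      ∀ t₀ ∈ Icc (0 : ℝ) 1, ∀ N, IsOpen N → levelComp f (p t₀) ⊆ N →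
        ∃ δ > 0, ∀ t ∈ Icc (0 : ℝ) 1, |t - t₀| < δ → levelComp f (p t) ⊆ N := by
  obtain ⟨g⟩ := PathConnectedSpace.joined a b
  obtain ⟨γ, hγ, rfl, rfl⟩ : ∃ γ : ℝ → X, Continuous γ ∧ γ 0 = a ∧ γ 1 = b :=
    ⟨g.extend, g.continuous_extend, by simp, by simp⟩
  have h0 : Separates (levelComp f (γ 0)) (γ 0) (γ 1) := fun G _ h _ => ⟨_, h, mem_levelComp f _⟩
  have h1 : Separates (levelComp f (γ 1)) (γ 0) (γ 1) := fun G _ _ h => ⟨_, h, mem_levelComp f _⟩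
  obtain ⟨k₀, hk₀, he₀⟩ := exists_mem_lastTimes hf hγ h0
  obtain ⟨k₁, hk₁, he₁⟩ := exists_mem_lastTimes hf hγ h1
  have hmin : ∀ k ∈ lastTimes f γ, k₀ ≤ k := by
    intro k hk
    by_contra! hlt
    have := levelComp_subset_of_lt' hf hγ hk hk₀ hlt (mem_levelComp f _)
    rw [connectedComponentIn_eq_empty (by simp [he₀, mem_levelComp])] at this
    exact this
  have hmax : ∀ k ∈ lastTimes f γ, k ≤ k₁ := by
    intro k hk
    by_contra! hlt
    have := levelComp_subset_of_lt hγ hk₁ hk.1 hlt (mem_levelComp f _)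
    rw [connectedComponentIn_eq_empty (by simp [he₁, mem_levelComp])] at this
    exact this
  have hne : k₀ ≠ k₁ := by
    rintro rfl
    exact hab (he₀.symm.trans he₁)
  obtain ⟨e, hmono, himage⟩ := exists_strictMonoOn_image_eq ((hmin _ hk₁).lt_of_ne hne)
    ⟨hk₀, hmin⟩ ⟨hk₁, hmax⟩ (by
      intro x hx y hy hxy
      obtain ⟨z, hz, hxz, hzy⟩ := exists_levelComp_between hf hx.2.1 hy.2.1
        (levelComp_subset_of_lt hγ hx hy.1 hxy)
      obtain ⟨s, hs, he⟩ := exists_mem_lastTimes hf hγ hz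
      rw [← he] at hxz hzy
      exact ⟨s, hs, lt_of_levelComp_subset hf hγ hx hs hxz, lt_of_levelComp_subset hf hγ hs hy hzy⟩)
    (fun S => exists_lub_lastTimes hf hγ)
  have heK : ∀ t ∈ Icc (0 : ℝ) 1, e t ∈ lastTimes f γ := fun t ht => himage ▸ mem_image_of_mem e ht
  have hsurj : ∀ k ∈ lastTimes f γ, ∃ t ∈ Icc (0 : ℝ) 1, e t = k := fun k hk => by
    rw [← himage] at hk
    exact hk
  have e0 : e 0 = k₀ := by
    obtain ⟨t, ht, rfl⟩ := hsurj k₀ hk₀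
    exact le_antisymm (hmono.monotoneOn (by simp) ht ht.1) (hmin _ (heK 0 (by simp)))
  have e1 : e 1 = k₁ := by
    obtain ⟨t, ht, rfl⟩ := hsurj k₁ hk₁
    exact le_antisymm (hmax _ (heK 1 (by simp))) (hmono.monotoneOn ht (by simp) ht.2)
  refine ⟨fun t => γ (e t), ?_, by simp only [e0, he₀],
    by simp only [e1, he₁], fun t ht => (heK t ht).2.1, ?_⟩
  · intro s hs t ht hst
    exact hmono.injOn hs ht (lastTimes_eq (heK s hs) (heK t ht) hst)
  intro t₀ ht₀ N hN hsub
  have hleft : ∃ δ > 0, ∀ t ∈ Icc (0 : ℝ) 1, t < t₀ → t₀ - δ < t → levelComp f (γ (e t)) ⊆ N := by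
    by_cases ha : γ 0 ∈ levelComp f (γ (e t₀))
    · refine ⟨1, one_pos, fun t ht htt₀ _ => ?_⟩
      have := levelComp_subset_of_lt' hf hγ (heK t ht) (heK t₀ ht₀) (hmono ht ht₀ htt₀)
        (mem_levelComp f _)
      rw [connectedComponentIn_eq_empty (by simpa using ha)] at this
      exact this.elim
    · obtain ⟨z, hz, hzx, hzN⟩ :=
        exists_levelComp_left_subset hf (heK t₀ ht₀).2.1 ha hN hsub
      obtain ⟨s, hs, he⟩ := exists_mem_lastTimes hf hγ hz
      obtain ⟨t₁, ht₁, rfl⟩ := hsurj s hs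
      rw [← he] at hzx hzN
      have hlt : t₁ < t₀ :=
        (hmono.lt_iff_lt ht₁ ht₀).1 (lt_of_levelComp_subset' hf hγ hs (heK t₀ ht₀) hzx)
      refine ⟨t₀ - t₁, sub_pos.2 hlt, fun t ht htt₀ hδ => hzN _ ?_ ?_⟩
      · exact levelComp_subset_of_lt hγ hs (heK t ht).1 (hmono ht₁ ht (by linarith))
      · exact levelComp_subset_of_lt' hf hγ (heK t ht) (heK t₀ ht₀) (hmono ht ht₀ htt₀)
  have hright : ∃ δ > 0, ∀ t ∈ Icc (0 : ℝ) 1, t₀ < t → t < t₀ + δ → levelComp f (γ (e t)) ⊆ N := by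
    by_cases hb : γ 1 ∈ levelComp f (γ (e t₀))
    · refine ⟨1, one_pos, fun t ht htt₀ _ => ?_⟩
      have := levelComp_subset_of_lt hγ (heK t₀ ht₀) (heK t ht).1 (hmono ht₀ ht htt₀)
        (mem_levelComp f _)
      rw [connectedComponentIn_eq_empty (by simpa using hb)] at this
      exact this.elim
    · obtain ⟨z, hz, hzx, hzN⟩ :=
        exists_levelComp_left_subset hf (heK t₀ ht₀).2.1.symm hb hN hsub
      obtain ⟨s, hs, he⟩ := exists_mem_lastTimes hf hγ hz.symm
      obtain ⟨t₁, ht₁, rfl⟩ := hsurj s hs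
      rw [← he] at hzx hzN
      have hlt : t₀ < t₁ :=
        (hmono.lt_iff_lt ht₀ ht₁).1 (lt_of_levelComp_subset hf hγ (heK t₀ ht₀) hs hzx)
      refine ⟨t₁ - t₀, sub_pos.2 hlt, fun t ht htt₀ hδ => hzN _ ?_ ?_⟩
      · exact levelComp_subset_of_lt' hf hγ (heK t ht) hs (hmono ht ht₁ (by linarith))
      · exact levelComp_subset_of_lt hγ (heK t₀ ht₀) (heK t ht).1 (hmono ht₀ ht htt₀)
  obtain ⟨δ₁, hδ₁, h₁⟩ := hleft
  obtain ⟨δ₂, hδ₂, h₂⟩ := hright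
  refine ⟨min δ₁ δ₂, lt_min hδ₁ hδ₂, fun t ht htδ => ?_⟩
  rw [abs_lt] at htδ
  rcases lt_trichotomy t t₀ with h | rfl | h
  · exact h₁ t ht h (by linarith [min_le_left δ₁ δ₂])
  · exact hsub
  · exact h₂ t ht h (by linarith [min_le_right δ₁ δ₂])

end Arc


/-- The components of a subset of the subspace `s` are those of its image. -/
lemma image_val_connectedComponentIn {X : Type*} [TopologicalSpace X] {s F : Set X} (hF : F ⊆ s)
    {x : s} (hx : (x : X) ∈ F) :
    Subtype.val '' connectedComponentIn (Subtype.val ⁻¹' F : Set s) x =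
      connectedComponentIn F (x : X) := by
  have hs : connectedComponentIn F (x : X) ⊆ s := (connectedComponentIn_subset _ _).trans hF
  refine Subset.antisymm ?_ ?_
  · refine (isPreconnected_connectedComponentIn.image _
      continuous_subtype_val.continuousOn).subset_connectedComponentIn
      ⟨x, mem_connectedComponentIn hx, rfl⟩ ?_
    rintro _ ⟨y, hy, rfl⟩
    exact connectedComponentIn_subset (Subtype.val ⁻¹' F : Set s) x hy
  · have himage : Subtype.val '' (Subtype.val ⁻¹' connectedComponentIn F (x : X) : Set s) =
        connectedComponentIn F (x : X) := by
      rwa [Subtype.image_preimage_coe, inter_eq_right]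
    rw [← himage]
    refine image_mono (IsPreconnected.subset_connectedComponentIn ?_
      (mem_connectedComponentIn hx) (preimage_mono (connectedComponentIn_subset _ _)))
    rw [← Topology.IsInducing.subtypeVal.isPreconnected_image, himage]
    exact isPreconnected_connectedComponentIn

instance : CompactSpace Q := isCompact_iff_compactSpace.1 isCompact_Icc

instance : ContractibleSpace Q :=
  (convex_Icc _ _).contractibleSpace ⟨(0, 0), by simp⟩

instance : LocallyPathConnectedSpace Q :=
  (convex_Icc _ _).locallyPathConnectedSpace

/-- Kronrod's theorem: any two distinct components of level sets of a continuous function on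
the unit square are joined by a unique arc in the Kronrod tree; the arc is an injective
"continuous" path of level-set components, and every intermediate component separates the
endpoints in `Q`. -/
theorem kronrod_arc (f : ℝ × ℝ → ℝ) (hf : ContinuousOn f Q)
    (A B : Set (ℝ × ℝ)) (hA : IsLevelComp f A) (hB : IsLevelComp f B) (hAB : A ≠ B) :
    ∃ φ : ℝ → Set (ℝ × ℝ),
      InjOn φ (Icc 0 1) ∧ φ 0 = A ∧ φ 1 = B ∧
      (∀ t ∈ Icc (0 : ℝ) 1, IsLevelComp f (φ t)) ∧
      (∀ t₀ ∈ Icc (0 : ℝ) 1, ∀ ε > (0 : ℝ), ∃ δ > (0 : ℝ),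
        ∀ t ∈ Icc (0 : ℝ) 1, |t - t₀| < δ → ∀ x ∈ φ t, infDist x (φ t₀) < ε) ∧
      (∀ t ∈ Ioo (0 : ℝ) 1, ∀ x ∈ A, ∀ y ∈ B,
        x ∈ Q \ φ t ∧ y ∈ Q \ φ t ∧
        connectedComponentIn (Q \ φ t) x ≠ connectedComponentIn (Q \ φ t) y) := by
  set g : Q → ℝ := fun x => f x with hg
  have hgc : Continuous g := continuousOn_iff_continuous_domRestrict.1 hf
  have himage (x : Q) : Subtype.val '' levelComp g x =
      connectedComponentIn {y ∈ Q | f y = f x} (x : ℝ × ℝ) := by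
    rw [← image_val_connectedComponentIn (F := {y ∈ Q | f y = f x}) (sep_subset _ _) ⟨x.2, rfl⟩]
    congr 2
    ext y
    simp [hg, levelComp]
  obtain ⟨a, ha, rfl⟩ := hA
  obtain ⟨b, hb, rfl⟩ := hB
  lift a to Q using ha
  lift b to Q using hb
  simp only [← himage] at hAB ⊢
  obtain ⟨p, hinj, h0, h1, hsep, hcont⟩ :=
    exists_levelComp_arc hgc fun h => hAB (congrArg (Subtype.val '' ·) h)
  refine ⟨fun t => Subtype.val '' levelComp g (p t), fun s hs t ht hst =>
    hinj hs ht (Subtype.val_injective.image_injective hst), by simp only [h0], by simp only [h1],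
    fun t _ => ⟨p t, (p t).2, himage _⟩, fun t₀ ht₀ ε hε => ?_, ?_⟩
  · obtain ⟨δ, hδ, h⟩ := hcont t₀ ht₀
      {x | infDist (x : ℝ × ℝ) (Subtype.val '' levelComp g (p t₀)) < ε}
      (isOpen_lt ((continuous_infDist_pt _).comp continuous_subtype_val) continuous_const)
      fun x hx => by
        rw [mem_ofPred_eq, infDist_zero_of_mem (mem_image_of_mem _ hx)]
        exact hε
    refine ⟨δ, hδ, fun t ht htδ => ?_⟩
    rintro _ ⟨x, hx, rfl⟩
    exact h t ht htδ hx
  · rintro t ht _ ⟨x, hx, rfl⟩ _ ⟨y, hy, rfl⟩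
    have ht' : t ∈ Icc (0 : ℝ) 1 := Ioo_subset_Icc_self ht
    have hda : Disjoint (levelComp g a) (levelComp g (p t)) :=
      (levelComp_eq_or_disjoint g _ _).resolve_left fun h =>
        ht.1.ne (hinj (by simp) ht' (h0.trans h))
    have hdb : Disjoint (levelComp g b) (levelComp g (p t)) :=
      (levelComp_eq_or_disjoint g _ _).resolve_left fun h =>
        ht.2.ne' (hinj (by simp) ht' (h1.trans h))
    have hmem {z : Q} (hz : z ∉ levelComp g (p t)) :
        (z : ℝ × ℝ) ∈ Q \ Subtype.val '' levelComp g (p t) :=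
      ⟨z.2, fun h => hz ((Subtype.val_injective.mem_set_image).1 h)⟩
    have hx' := hmem (Set.disjoint_left.1 hda hx)
    have hy' := hmem (Set.disjoint_left.1 hdb hy)
    refine ⟨hx', hy', fun h => ?_⟩
    rw [← image_val_connectedComponentIn sdiff_subset hx',
      ← image_val_connectedComponentIn sdiff_subset hy'] at h
    have h := Subtype.val_injective.image_injective h
    set H := connectedComponentIn
      (Subtype.val ⁻¹' (Q \ Subtype.val '' levelComp g (p t)) : Set Q) x with hH
    have hxH : x ∈ H := mem_connectedComponentIn hx'
    have hyH : y ∈ H := h ▸ mem_connectedComponentIn hy'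
    obtain ⟨z, hz, hzp⟩ := hsep t ht' (levelComp g a ∪ (levelComp g b ∪ H))
      (isPreconnected_levelComp.union x hx (Or.inr hxH)
        (isPreconnected_levelComp.union y hy hyH isPreconnected_connectedComponentIn))
      (Or.inl (mem_levelComp g a)) (Or.inr (Or.inl (mem_levelComp g b)))
    rcases hz with hz | hz | hz
    · exact Set.disjoint_left.1 hda hz hzp
    · exact Set.disjoint_left.1 hdb hz hzp
    · exact (connectedComponentIn_subset _ _ hz).2 ⟨z, hzp, rfl⟩
end
end
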